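/- arXiv:2208.04064 — 4 statements merged into one kernel-verified Lean document; each statement's English description precedes it below -/
import Mathlib

section
/- Let n ≥ 5 and let S be the alternating group Alt_n. Then there exists an element s of S such that: (i) the normaliser of ⟨s⟩ in S properly contains the centraliser of s in S; and (ii) for every finite group G that is almost simple with socle S, at most one member of M'_G(s) is a novelty maximal of G, and no two members of M'_G(s) are conjugate in G. -/
/-! ### Part 1: reduction from almost simple groups to the socle -/

section Reduction

variable {S G : Type*} [Group S] [Group G]

theorem red_exists_phi (ι : S →* G) (hι : Function.Injective ι) (hN : ι.range.Normal) (g : G) :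
    ∃ φ : S ≃* S, ∀ x, ι (φ x) = g * ι x * g⁻¹ := by
  let e := MonoidHom.ofInjective hι
  refine ⟨(e.trans (MulAut.conjNormal g)).trans e.symm, fun x => ?_⟩
  have h : ∀ y : ι.range, ι (e.symm y) = y := by
    intro y
    have := MonoidHom.apply_ofInjective_symm hι y
    exact this
  simp only [MulEquiv.trans_apply]
  rw [h, MulAut.conjNormal_apply]
  rfl

/-- `M` normalises `K`, in the sense that all automorphisms of `S` induced by `M` fix `K`. -/
def RedInv (ι : S →* G) (M : Subgroup G) (K : Subgroup S) : Prop :=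
  ∀ m ∈ M, ∀ φ : S ≃* S, (∀ x, ι (φ x) = m * ι x * m⁻¹) → K.map φ.toMonoidHom = K

theorem red_comap_inv (ι : S →* G) (M : Subgroup G) : RedInv ι M (M.comap ι) := by
  intro m hm φ hφ
  ext x
  constructor
  · rintro ⟨y, hy, rfl⟩
    change ι (φ y) ∈ M
    rw [hφ]
    exact M.mul_mem (M.mul_mem hm hy) (M.inv_mem hm)
  · intro hx
    refine ⟨φ.symm x, ?_, by simp⟩
    change ι (φ.symm x) ∈ M
    have h1 := hφ (φ.symm x)
    rw [MulEquiv.apply_symm_apply] at h1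
    have h2 : ι (φ.symm x) = m⁻¹ * ι x * m := by rw [h1]; group
    rw [h2]
    exact M.mul_mem (M.mul_mem (M.inv_mem hm) hx) hm

theorem red_eq_normalizer [IsSimpleGroup S] (ι : S →* G) (hι : Function.Injective ι)
    (hN : ι.range.Normal) (M : Subgroup G) (hM : IsCoatom M) (K : Subgroup S)
    (hK0 : K ≠ ⊥) (hK1 : K ≠ ⊤) (hK : RedInv ι M K) :
    M = Subgroup.normalizer (K.map ι : Set G) ∧
      M.comap ι = Subgroup.normalizer (K : Set S) := by
  have key : M = Subgroup.normalizer (K.map ι : Set G) := by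
    have hle : M ≤ Subgroup.normalizer (K.map ι : Set G) := by
      intro m hm
      obtain ⟨φ, hφ⟩ := red_exists_phi ι hι hN m
      have h1 := hK m hm φ hφ
      rw [Subgroup.mem_normalizer_iff]
      intro h
      constructor
      · rintro ⟨k, hk, rfl⟩
        rw [← hφ]
        refine ⟨φ k, ?_, rfl⟩
        have : φ k ∈ K.map φ.toMonoidHom := ⟨k, hk, rfl⟩
        rw [h1] at this; exact this
      · rintro ⟨k, hk, hk2⟩
        have hk' : k ∈ K.map φ.toMonoidHom := by rw [h1]; exact hk
        obtain ⟨l, hl, hlk⟩ := hk'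
        refine ⟨l, hl, ?_⟩
        have h3 : ι k = m * ι l * m⁻¹ := by rw [← hφ, ← hlk]; rfl
        rw [h3] at hk2
        have := mul_right_cancel hk2
        exact mul_left_cancel this
    rcases hM.le_iff.mp hle with h | h
    · exfalso
      have : K.Normal := by
        rw [Subgroup.normalizer_eq_top_iff] at h
        have := h.comap ι
        rwa [Subgroup.comap_map_eq_self_of_injective hι] at this
      rcases IsSimpleGroup.eq_bot_or_eq_top_of_normal K this with h | h
      · exact hK0 h
      · exact hK1 h
    · exact h.symm
  refine ⟨key, ?_⟩
  ext x
  rw [Subgroup.mem_comap, key, Subgroup.mem_normalizer_iff, Subgroup.mem_normalizer_iff]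
  constructor
  · intro h y
    have := h (ι y)
    rw [← map_inv, ← map_mul, ← map_mul] at this
    rwa [Subgroup.mem_map_iff_mem hι, Subgroup.mem_map_iff_mem hι] at this
  · intro h y
    constructor
    · rintro ⟨k, hk, rfl⟩
      rw [← map_inv, ← map_mul, ← map_mul, Subgroup.mem_map_iff_mem hι]
      exact (h k).mp hk
    · rintro ⟨k, hk, hk2⟩
      refine ⟨x⁻¹ * k * x, ?_, ?_⟩
      · apply (h _).mpr; simpa [mul_assoc] using hk
      · rw [map_mul, map_mul, hk2, map_inv]; group

theorem red_conj_comap (ι : S →* G) (M₁ M₂ : Subgroup G) (g : G)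
    (hg : Subgroup.map (MulAut.conj g).toMonoidHom M₁ = M₂) (φ : S ≃* S)
    (hφ : ∀ x, ι (φ x) = g * ι x * g⁻¹) :
    (M₁.comap ι).map φ.toMonoidHom = M₂.comap ι := by
  subst hg
  ext x
  constructor
  · rintro ⟨y, hy, rfl⟩
    exact ⟨ι y, hy, by simp [hφ]⟩
  · rintro ⟨m, hm, hmx⟩
    refine ⟨φ.symm x, ?_, by simp⟩
    change ι (φ.symm x) ∈ M₁
    have h1 := hφ (φ.symm x)
    rw [MulEquiv.apply_symm_apply, ← hmx] at h1
    have h2 : m = ι (φ.symm x) := by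
      have h3 : g * m * g⁻¹ = g * ι (φ.symm x) * g⁻¹ := h1
      exact mul_left_cancel (mul_right_cancel h3)
    rw [← h2]; exact hm

theorem red_normalizer_coatom [IsSimpleGroup S] (K : Subgroup S) (hK : IsCoatom K) (h0 : K ≠ ⊥) :
    Subgroup.normalizer (K : Set S) = K := by
  rcases hK.le_iff.mp (Subgroup.le_normalizer (H := K)) with h | h
  · rw [Subgroup.normalizer_eq_top_iff] at h
    rcases IsSimpleGroup.eq_bot_or_eq_top_of_normal K h with h | h
    · exact absurd h h0
    · exact absurd h hK.1
  · exact h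

theorem red_ne_bot (s : S) (hs : s ≠ 1) (K : Subgroup S) (h : s ∈ K) : K ≠ ⊥ := by
  rintro rfl; exact hs (Subgroup.mem_bot.mp h)

theorem red_comap_ne_top (ι : S →* G) (M : Subgroup G) (h : ¬ ι.range ≤ M) :
    M.comap ι ≠ ⊤ := by
  intro h1
  apply h
  rintro _ ⟨x, rfl⟩
  have : x ∈ M.comap ι := by rw [h1]; trivial
  exact this

/-- If maximal subgroups containing `s` are determined by their order, every member of
`M'_G(s)` is the normaliser of such a maximal subgroup. -/
theorem red_distinct_aux [Finite S] [IsSimpleGroup S] (s : S) (hs : s ≠ 1)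
    (hd : ∀ K₁ K₂ : Subgroup S, IsCoatom K₁ → IsCoatom K₂ → s ∈ K₁ → s ∈ K₂ →
      Nat.card K₁ = Nat.card K₂ → K₁ = K₂)
    (ι : S →* G) (hι : Function.Injective ι) (hN : ι.range.Normal)
    (M : Subgroup G) (hM : IsCoatom M ∧ ι s ∈ M ∧ ¬ ι.range ≤ M) :
    IsCoatom (M.comap ι) ∧ M = Subgroup.normalizer ((M.comap ι).map ι : Set G) := by
  obtain ⟨hM, hsM, hMr⟩ := hM
  have hne := red_comap_ne_top ι M hMr
  obtain ⟨K, hK, hle⟩ := (eq_top_or_exists_le_coatom (M.comap ι)).resolve_left hne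
  have hsK : s ∈ K := hle hsM
  have hinv : RedInv ι M K := by
    intro m hm φ hφ
    have h1 := red_comap_inv ι M m hm φ hφ
    apply hd _ _ _ hK _ hsK
    · exact Nat.card_congr (K.equivMapOfInjective φ.toMonoidHom φ.injective).symm.toEquiv
    · exact (OrderIso.isCoatom_iff φ.mapSubgroup K).mpr hK
    · have : s ∈ (M.comap ι).map φ.toMonoidHom := by rw [h1]; exact hsM
      exact Subgroup.map_mono hle this
  have h0 := red_ne_bot s hs K hsK
  obtain ⟨h1, h2⟩ := red_eq_normalizer ι hι hN M hM K h0 hK.1 hinv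
  rw [red_normalizer_coatom K hK h0] at h2
  rw [h2]
  exact ⟨hK, h1⟩

theorem red_distinct [Finite S] [IsSimpleGroup S] (s : S) (hs : s ≠ 1)
    (hd : ∀ K₁ K₂ : Subgroup S, IsCoatom K₁ → IsCoatom K₂ → s ∈ K₁ → s ∈ K₂ →
      Nat.card K₁ = Nat.card K₂ → K₁ = K₂)
    (ι : S →* G) (hι : Function.Injective ι) (hN : ι.range.Normal) :
    ((∀ M₁ M₂ : Subgroup G,
            (IsCoatom M₁ ∧ ι s ∈ M₁ ∧ ¬ ι.range ≤ M₁) →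
            (IsCoatom M₂ ∧ ι s ∈ M₂ ∧ ¬ ι.range ≤ M₂) →
            (M₁.comap ι ≠ ⊤ ∧ ¬ IsCoatom (M₁.comap ι)) →
            (M₂.comap ι ≠ ⊤ ∧ ¬ IsCoatom (M₂.comap ι)) →
            M₁ = M₂) ∧
          (∀ M₁ M₂ : Subgroup G,
            (IsCoatom M₁ ∧ ι s ∈ M₁ ∧ ¬ ι.range ≤ M₁) →
            (IsCoatom M₂ ∧ ι s ∈ M₂ ∧ ¬ ι.range ≤ M₂) →
            (∃ g : G, Subgroup.map (MulAut.conj g).toMonoidHom M₁ = M₂) →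
            M₁ = M₂)) := by
  constructor
  · intro M₁ M₂ h₁ _ h _
    exact absurd (red_distinct_aux s hs hd ι hι hN M₁ h₁).1 h.2
  · rintro M₁ M₂ h₁ h₂ ⟨g, hg⟩
    obtain ⟨φ, hφ⟩ := red_exists_phi ι hι hN g
    have hc := red_conj_comap ι M₁ M₂ g hg φ hφ
    have a₁ := red_distinct_aux s hs hd ι hι hN M₁ h₁
    have a₂ := red_distinct_aux s hs hd ι hι hN M₂ h₂
    have : M₁.comap ι = M₂.comap ι := by
      apply hd _ _ a₁.1 a₂.1 h₁.2.1 h₂.2.1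
      rw [← hc]
      exact Nat.card_congr
        ((M₁.comap ι).equivMapOfInjective φ.toMonoidHom φ.injective).toEquiv
    rw [a₁.2, a₂.2, this]

/-- A subgroup of order `p` of a subgroup `H` of the normaliser of `P` is `P`. -/
theorem red_unique_sylow [Finite S] {p : ℕ} [hp : Fact p.Prime] (P Q : Subgroup S)
    (hP : Nat.card P = p) (hQ : Nat.card Q = p) (hpp : ¬ p ^ 2 ∣ Nat.card S)
    (hQP : Q ≤ Subgroup.normalizer (P : Set S)) : Q = P := by
  have hpP : IsPGroup p P := IsPGroup.of_card (n := 1) (by rw [hP, pow_one])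
  have hpQ : IsPGroup p Q := IsPGroup.of_card (n := 1) (by rw [hQ, pow_one])
  have h1 : IsPGroup p (Q ⊔ P : Subgroup S) := hpQ.to_sup_of_normal_right' hpP hQP
  obtain ⟨k, hk⟩ := IsPGroup.iff_card.mp h1
  have hk2 : k ≤ 1 := by
    by_contra h
    exact hpp ((pow_dvd_pow p (by omega)).trans (hk ▸ Subgroup.card_subgroup_dvd_card _))
  have hk3 : Nat.card (Q ⊔ P : Subgroup S) ≤ p := by
    rw [hk]
    calc p ^ k ≤ p ^ 1 := Nat.pow_le_pow_right hp.out.pos hk2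
      _ = p := pow_one p
  rw [Subgroup.eq_of_le_of_card_ge (le_sup_left : Q ≤ Q ⊔ P) (by rw [hQ]; exact hk3),
    ← Subgroup.eq_of_le_of_card_ge (le_sup_right : P ≤ Q ⊔ P) (by rw [hP]; exact hk3)]

theorem red_fact [Finite S] {p : ℕ} [hp : Fact p.Prime] (H P : Subgroup S) (hPH : P ≤ H)
    (hP : Nat.card P = p) (hpp : ¬ p ^ 2 ∣ Nat.card S) :
    Nat.card (P.subgroupOf H) = p ^ (Nat.card H).factorization p := by
  have h1 : Nat.card (P.subgroupOf H) = p := by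
    rw [← hP]; exact Nat.card_congr (Subgroup.subgroupOfEquivOfLe hPH).toEquiv
  have h2 : p ∣ Nat.card H := hP ▸ Subgroup.card_dvd_of_le hPH
  have h3 : (Nat.card H).factorization p = 1 := by
    apply le_antisymm
    · by_contra h
      apply hpp
      exact ((Nat.Prime.pow_dvd_iff_le_factorization hp.out Nat.card_pos.ne').mpr
        (by omega)).trans (Subgroup.card_subgroup_dvd_card H)
    · exact (hp.out.dvd_iff_one_le_factorization Nat.card_pos.ne').mp h2
  rw [h1, h3, pow_one]

theorem red_sylow_conj [Finite S] {p : ℕ} [hp : Fact p.Prime] (H P Q : Subgroup S)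
    (hPH : P ≤ H) (hQH : Q ≤ H)
    (hP : Nat.card P = p) (hQ : Nat.card Q = p) (hpp : ¬ p ^ 2 ∣ Nat.card S) :
    ∃ h ∈ H, P.map (MulAut.conj h).toMonoidHom = Q := by
  let P' : Sylow p H := Sylow.ofCard (P.subgroupOf H) (red_fact H P hPH hP hpp)
  let Q' : Sylow p H := Sylow.ofCard (Q.subgroupOf H) (red_fact H Q hQH hQ hpp)
  obtain ⟨h, hh⟩ := MulAction.exists_smul_eq H P' Q'
  refine ⟨h, h.2, ?_⟩
  apply Subgroup.eq_of_le_of_card_ge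
  · rintro _ ⟨x, hx, rfl⟩
    have h1 : (⟨x, hPH hx⟩ : H) ∈ P' := by
      change _ ∈ P.subgroupOf H
      rw [Subgroup.mem_subgroupOf]; exact hx
    have h2 : h * ⟨x, hPH hx⟩ * h⁻¹ ∈ (h • P' : Sylow p H) := by
      have := Subgroup.smul_mem_pointwise_smul _ (MulAut.conj h) _ h1
      exact this
    rw [hh] at h2
    have h3 : h * ⟨x, hPH hx⟩ * h⁻¹ ∈ Q.subgroupOf H := h2
    rw [Subgroup.mem_subgroupOf] at h3
    exact h3
  · rw [hQ, ← hP]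
    exact (Nat.card_congr (P.equivMapOfInjective (MulAut.conj (h : S)).toMonoidHom
      (MulAut.conj (h : S)).injective).toEquiv).le

theorem red_sylow [Finite S] [IsSimpleGroup S] {p : ℕ} [hp : Fact p.Prime] (s : S)
    (hs : orderOf s = p) (hpp : ¬ p ^ 2 ∣ Nat.card S) (hnp : Nat.card S ≠ p)
    (hd : ∀ H : Subgroup S, s ∈ H → H ≠ ⊤ →
      H ≤ Subgroup.normalizer (Subgroup.zpowers s : Set S) ∨
      (Subgroup.normalizer (Subgroup.zpowers s : Set S) ≤ H ∧ IsCoatom H))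
    (ι : S →* G) (hι : Function.Injective ι) (hN : ι.range.Normal) :
    ((∀ M₁ M₂ : Subgroup G,
            (IsCoatom M₁ ∧ ι s ∈ M₁ ∧ ¬ ι.range ≤ M₁) →
            (IsCoatom M₂ ∧ ι s ∈ M₂ ∧ ¬ ι.range ≤ M₂) →
            (M₁.comap ι ≠ ⊤ ∧ ¬ IsCoatom (M₁.comap ι)) →
            (M₂.comap ι ≠ ⊤ ∧ ¬ IsCoatom (M₂.comap ι)) →
            M₁ = M₂) ∧
          (∀ M₁ M₂ : Subgroup G,
            (IsCoatom M₁ ∧ ι s ∈ M₁ ∧ ¬ ι.range ≤ M₁) →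
            (IsCoatom M₂ ∧ ι s ∈ M₂ ∧ ¬ ι.range ≤ M₂) →
            (∃ g : G, Subgroup.map (MulAut.conj g).toMonoidHom M₁ = M₂) →
            M₁ = M₂)) := by
  set P := Subgroup.zpowers s with hPdef
  have hPc : Nat.card P = p := by rw [← hs]; exact Nat.card_zpowers s
  have hs1 : s ≠ 1 := by
    rintro rfl
    rw [orderOf_one] at hs
    exact hp.out.one_lt.ne hs
  have hP0 : P ≠ ⊥ := red_ne_bot s hs1 P (Subgroup.mem_zpowers s)
  have hP1 : P ≠ ⊤ := by
    intro h; rw [h, Subgroup.card_top] at hPc; exact hnp hPc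
  have kind1 : ∀ M : Subgroup G, (IsCoatom M ∧ ι s ∈ M ∧ ¬ ι.range ≤ M) →
      M.comap ι ≤ Subgroup.normalizer (P : Set S) →
      M = Subgroup.normalizer (P.map ι : Set G) ∧
        M.comap ι = Subgroup.normalizer (P : Set S) := by
    rintro M ⟨hM, hsM, hMr⟩ hle
    refine red_eq_normalizer ι hι hN M hM P hP0 hP1 ?_
    intro m hm φ hφ
    have h1 := red_comap_inv ι M m hm φ hφ
    apply red_unique_sylow P _ hPc _ hpp
    · refine le_trans ?_ hle
      rw [← h1]
      apply Subgroup.map_mono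
      rw [hPdef, Subgroup.zpowers_le]
      exact hsM
    · rw [← hPc]
      exact Nat.card_congr (P.equivMapOfInjective φ.toMonoidHom φ.injective).symm.toEquiv
  have kind2 : ∀ M : Subgroup G, (IsCoatom M ∧ ι s ∈ M ∧ ¬ ι.range ≤ M) →
      M = Subgroup.normalizer ((M.comap ι).map ι : Set G) := by
    rintro M ⟨hM, hsM, hMr⟩
    exact (red_eq_normalizer ι hι hN M hM _ (red_ne_bot s hs1 _ hsM)
      (red_comap_ne_top ι M hMr) (red_comap_inv ι M)).1
  constructor
  · intro M₁ M₂ h₁ h₂ n₁ n₂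
    have a₁ := (hd _ h₁.2.1 n₁.1).resolve_right (fun h => n₁.2 h.2)
    have a₂ := (hd _ h₂.2.1 n₂.1).resolve_right (fun h => n₂.2 h.2)
    rw [(kind1 M₁ h₁ a₁).1, (kind1 M₂ h₂ a₂).1]
  · rintro M₁ M₂ h₁ h₂ ⟨g, hg⟩
    suffices M₁.comap ι = M₂.comap ι by
      rw [kind2 M₁ h₁, kind2 M₂ h₂, this]
    have hcard : Nat.card (M₁.comap ι) = Nat.card (M₂.comap ι) := by
      obtain ⟨φ, hφ⟩ := red_exists_phi ι hι hN g
      rw [← red_conj_comap ι M₁ M₂ g hg φ hφ]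
      exact Nat.card_congr
        ((M₁.comap ι).equivMapOfInjective φ.toMonoidHom φ.injective).toEquiv
    have t₁ := red_comap_ne_top ι M₁ h₁.2.2
    have t₂ := red_comap_ne_top ι M₂ h₂.2.2
    rcases hd _ h₁.2.1 t₁ with a₁ | a₁ <;> rcases hd _ h₂.2.1 t₂ with a₂ | a₂
    · rw [(kind1 M₁ h₁ a₁).2, (kind1 M₂ h₂ a₂).2]
    · apply Subgroup.eq_of_le_of_card_ge
      · exact a₁.trans a₂.1
      · exact hcard.ge
    · symm
      apply Subgroup.eq_of_le_of_card_ge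
      · exact a₂.trans a₁.1
      · exact hcard.le
    · skip
      have hsup : ι.range ⊔ M₁ = ⊤ := by
        refine h₁.1.2 _ (lt_of_le_of_ne le_sup_right ?_)
        intro h
        apply h₁.2.2
        rw [h]; exact le_sup_left
      have hgm : g ∈ ι.range ⊔ M₁ := by rw [hsup]; trivial
      rw [Subgroup.mem_sup_of_normal_left] at hgm
      obtain ⟨_, ⟨x, rfl⟩, m, hm, rfl⟩ := hgm
      have hmM : Subgroup.map (MulAut.conj m).toMonoidHom M₁ = M₁ := by
        ext y
        constructor
        · rintro ⟨z, hz, rfl⟩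
          exact M₁.mul_mem (M₁.mul_mem hm hz) (M₁.inv_mem hm)
        · intro hy
          exact ⟨m⁻¹ * y * m, M₁.mul_mem (M₁.mul_mem (M₁.inv_mem hm) hy) hm, by
            simp [mul_assoc]⟩
      have hg2 : Subgroup.map (MulAut.conj (ι x)).toMonoidHom M₁ = M₂ := by
        rw [← hg]
        conv_lhs => rw [← hmM]
        rw [Subgroup.map_map]
        congr 1
        ext z
        simp [mul_assoc]
      have hx := red_conj_comap ι M₁ M₂ (ι x) hg2 (MulAut.conj x) (by intro y; simp)
      set H := M₁.comap ι with hH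
      have hPH : P ≤ H := by rw [hPdef, Subgroup.zpowers_le]; exact h₁.2.1
      have hsx : x⁻¹ * s * x ∈ H := by
        have h3 : s ∈ M₂.comap ι := h₂.2.1
        rw [← hx] at h3
        obtain ⟨y, hy, hys⟩ := h3
        have : x * y * x⁻¹ = s := hys
        rw [← this]
        simpa [mul_assoc] using hy
      have hQ : P.map (MulAut.conj x⁻¹).toMonoidHom ≤ H := by
        rw [hPdef, MonoidHom.map_zpowers, Subgroup.zpowers_le]
        simpa using hsx
      obtain ⟨h, hhH, hh⟩ := red_sylow_conj H P _ hPH hQ hPc (by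
        rw [← hPc]
        exact Nat.card_congr (P.equivMapOfInjective (MulAut.conj x⁻¹).toMonoidHom
          (MulAut.conj x⁻¹).injective).symm.toEquiv) hpp
      have hxh : x * h ∈ Subgroup.normalizer (P : Set S) := by
        have h5 : P.map (MulAut.conj (x * h)).toMonoidHom = P := by
          have : (MulAut.conj (x * h)).toMonoidHom =
            (MulAut.conj x).toMonoidHom.comp (MulAut.conj h).toMonoidHom := by
              ext z; simp [mul_assoc]
          rw [this, ← Subgroup.map_map, hh, Subgroup.map_map]
          convert Subgroup.map_id P
          ext z; simp [mul_assoc]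
        rw [Subgroup.mem_normalizer_iff]
        intro z
        constructor
        · intro hz
          have : x * h * z * (x * h)⁻¹ ∈ P.map (MulAut.conj (x * h)).toMonoidHom := ⟨z, hz, rfl⟩
          rwa [h5] at this
        · intro hz
          rw [← h5] at hz
          obtain ⟨w, hw, hwz⟩ := hz
          have : x * h * w * (x * h)⁻¹ = x * h * z * (x * h)⁻¹ := hwz
          have := mul_left_cancel (mul_right_cancel this)
          rw [← this]; exact hw
      have hxH : x ∈ H := by
        have := H.mul_mem (a₁.1 hxh) (H.inv_mem hhH)
        simpa [mul_assoc] using this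
      rw [← hx]
      ext y
      constructor
      · intro hy
        exact ⟨x⁻¹ * y * x, H.mul_mem (H.mul_mem (H.inv_mem hxH) hy) hxH, by simp [mul_assoc]⟩
      · rintro ⟨z, hz, rfl⟩
        exact H.mul_mem (H.mul_mem hxH hz) (H.inv_mem hxH)

/-- Numerical constraints on subgroups containing a Sylow subgroup of prime order. -/
theorem red_numeric [Finite S] {p : ℕ} [hp : Fact p.Prime] (P H : Subgroup S)
    (hPH : P ≤ H) (hP : Nat.card P = p) (hpp : ¬ p ^ 2 ∣ Nat.card S) :
    ∃ k : ℕ, k ≡ 1 [MOD p] ∧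
      Nat.card H = k * Nat.card (Subgroup.normalizer (P : Set S) ⊓ H : Subgroup S) ∧
      (k = 1 → H ≤ Subgroup.normalizer (P : Set S)) := by
  let P' : Sylow p H := Sylow.ofCard (P.subgroupOf H) (red_fact H P hPH hP hpp)
  have h1 := card_sylow_modEq_one p H
  rw [Sylow.card_eq_index_normalizer P'] at h1
  have h2 : Subgroup.normalizer (P' : Set H) =
      (Subgroup.normalizer (P : Set S)).subgroupOf H := by
    rw [Subgroup.subgroupOf_normalizer_eq hPH]
    rfl
  rw [h2] at h1
  refine ⟨_, h1, ?_, ?_⟩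
  · rw [← Subgroup.card_mul_index ((Subgroup.normalizer (P : Set S)).subgroupOf H), mul_comm]
    congr 1
    rw [← Subgroup.inf_subgroupOf_right]
    exact Nat.card_congr (Subgroup.subgroupOfEquivOfLe inf_le_right).toEquiv
  · intro h
    rw [Subgroup.index_eq_one, Subgroup.subgroupOf_eq_top] at h
    exact h

/-- In a simple group, the order divides the factorial of the index of a proper subgroup. -/
theorem red_index [Finite S] [IsSimpleGroup S] (H : Subgroup S) (hH : H ≠ ⊤) :
    Nat.card S ∣ H.index.factorial := by
  have h1 := Subgroup.normalCore_le H
  have h2 : H.normalCore = ⊥ := by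
    rcases IsSimpleGroup.eq_bot_or_eq_top_of_normal H.normalCore inferInstance with h | h
    · exact h
    · rw [h, top_le_iff] at h1; exact absurd h1 hH
  have h3 : Function.Injective (MulAction.toPermHom S (S ⧸ H)) := by
    rw [← MonoidHom.ker_eq_bot_iff, ← Subgroup.normalCore_eq_ker, h2]
  have h4 := Subgroup.card_dvd_of_injective _ h3
  rwa [Nat.card_perm] at h4

end Reduction

/-! ### Part 2: Jordan's theorem on primitive groups containing a cycle of prime length -/

section JordanPrime

open Equiv Equiv.Perm MulAction

variable {α : Type*} [Fintype α] [DecidableEq α]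

theorem jp_ext {G : Subgroup (Perm α)} (hG : IsPreprimitive G α) {p : ℕ} (hp : p.Prime)
    (hp3 : p + 3 ≤ Nat.card α) {c : Perm α} (hc : c.IsCycle) (hcp : c.support.card = p)
    (hcG : c ∈ G) (σ : Perm α) :
    ∃ g ∈ G, ∀ x ∉ c.support, g x = σ x := by
  classical
  obtain ⟨k, hk⟩ := Nat.exists_eq_add_of_le hp3
  have hsn : Set.ncard ((c.support : Set α)ᶜ) = (k + 2) + 1 := by
    apply Nat.add_left_cancel (n := p)
    have := Set.ncard_add_ncard_compl (c.support : Set α)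
    rw [Set.ncard_coe_finset, hcp] at this
    rw [this, hk]; ring
  have hmp : IsMultiplyPreprimitive G α (k + 2 + 2) := by
    apply hG.isMultiplyPreprimitive hsn
    · have := hp.two_le; omega
    have := isPretransitive_of_isCycle_mem hc hcG
    apply IsPreprimitive.of_prime_card
    convert! hp
    rw [Nat.card_eq_fintype_card, Fintype.card_subtype, ← hcp]
    apply congr_arg
    ext x
    simp [SubMulAction.mem_ofFixingSubgroup_iff]
  have hmt : IsMultiplyPretransitive G α (k + 2 + 2) := hmp.isMultiplyPretransitive
  have hmt' : IsMultiplyPretransitive G α (k + 3) := by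
    refine isMultiplyPretransitive_of_le' (n := k + 2 + 2) (by omega) ?_
    rw [ENat.card_eq_coe_fintype_card, ← Nat.card_eq_fintype_card, hk]
    have := hp.two_le
    norm_cast
    omega
  have hcard : Fintype.card {x // x ∉ c.support} = k + 3 := by
    rw [← Nat.card_eq_fintype_card, ← hsn]
    rfl
  let e : Fin (k + 3) ≃ {x // x ∉ c.support} := (Fintype.equivFinOfCardEq hcard).symm
  let e₁ : Fin (k + 3) ↪ α := e.toEmbedding.trans (Function.Embedding.subtype _)
  let e₂ : Fin (k + 3) ↪ α := e₁.trans σ.toEmbedding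
  obtain ⟨g, hg⟩ := hmt'.exists_smul_eq e₁ e₂
  refine ⟨g, g.2, fun x hx => ?_⟩
  have h1 := DFunLike.congr_fun hg (e.symm ⟨x, hx⟩)
  have h2 : e₁ (e.symm ⟨x, hx⟩) = x := by simp [e₁]
  have h3 : g • e₁ (e.symm ⟨x, hx⟩) = σ (e₁ (e.symm ⟨x, hx⟩)) := h1
  rw [h2] at h3
  exact h3

theorem jp_range (T : Finset α) (f : Perm α) :
    f ∈ (ofSubtype (p := fun x => x ∈ T)).range ↔ ∀ x ∉ T, f x = x := by
  constructor
  · rintro ⟨f, rfl⟩ x hx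
    exact ofSubtype_apply_of_not_mem _ hx
  · intro h
    have h2 : ∀ x, f x ≠ x → x ∈ T := fun x hx => by
      by_contra h3; exact hx (h x h3)
    have h1 : ∀ x, f x ∈ T ↔ x ∈ T := by
      intro x
      by_cases hx : f x = x
      · rw [hx]
      · refine ⟨fun _ => h2 x hx, fun _ => h2 _ fun h => hx (f.injective h)⟩
    exact ⟨f.subtypePerm h1, ofSubtype_subtypePerm h1 h2⟩

theorem jp_norm {G : Subgroup (Perm α)} (hG : IsPreprimitive G α) {p : ℕ} (hp : p.Prime)
    (hp3 : p + 3 ≤ Nat.card α) {c : Perm α} (hc : c.IsCycle) (hcp : c.support.card = p)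
    (hcG : c ∈ G) (σ : Perm α) (hσ : ∀ x, σ x ∉ c.support ↔ x ∉ c.support) :
    ∃ g ∈ G, (∀ x ∉ c.support, g x = σ x) ∧ ∃ k : ℤ, g * c * g⁻¹ = c ^ k := by
  obtain ⟨g, hg, hgσ⟩ := jp_ext hG hp hp3 hc hcp hcG σ
  have : Fact p.Prime := ⟨hp⟩
  let F : Subgroup (Perm α) := G ⊓ (ofSubtype (p := fun x => x ∈ c.support)).range
  have hFcard : Nat.card F ∣ p.factorial := by
    have h1 : Nat.card F ∣ Nat.card (ofSubtype (p := fun x => x ∈ c.support)).range :=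
      Subgroup.card_dvd_of_le inf_le_right
    have h2 : Nat.card (ofSubtype (p := fun x => x ∈ c.support)).range = p.factorial := by
      rw [← Nat.card_congr (MonoidHom.ofInjective (ofSubtype_injective)).toEquiv, Nat.card_perm]
      rw [Nat.card_eq_fintype_card, Fintype.card_coe, hcp]
    rwa [h2] at h1
  have hpp : ¬ p ^ 2 ∣ Nat.card F := by
    intro h
    have h1 := h.trans hFcard
    obtain ⟨q, rfl⟩ : ∃ q, p = q + 1 := ⟨p - 1, by have := hp.pos; omega⟩
    rw [Nat.factorial_succ, pow_two] at h1
    have h2 := Nat.dvd_of_mul_dvd_mul_left hp.pos h1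
    have := (hp.dvd_factorial).mp h2
    omega
  have hcF : c ∈ F := ⟨hcG, (jp_range _ _).mpr fun x hx => notMem_support.mp hx⟩
  have hginv : ∀ x ∉ c.support, g⁻¹ x = σ⁻¹ x ∧ σ⁻¹ x ∉ c.support := by
    intro x hx
    have h1 : σ⁻¹ x ∉ c.support := by
      rw [← hσ]; simpa using hx
    refine ⟨?_, h1⟩
    rw [Perm.inv_eq_iff_eq, hgσ _ h1]; simp
  have hgcF : g * c * g⁻¹ ∈ F := by
    refine ⟨G.mul_mem (G.mul_mem hg hcG) (G.inv_mem hg), (jp_range _ _).mpr fun x hx => ?_⟩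
    obtain ⟨h1, h2⟩ := hginv x hx
    rw [mul_apply, mul_apply, h1, notMem_support.mp h2, ← h1]; simp
  have hord : orderOf c = p := by rw [hc.orderOf, hcp]
  obtain ⟨h, -, hh⟩ := red_sylow_conj (S := F) (p := p) ⊤ (Subgroup.zpowers ⟨g * c * g⁻¹, hgcF⟩)
    (Subgroup.zpowers ⟨c, hcF⟩) le_top le_top
    (by
      rw [Nat.card_zpowers, Subgroup.orderOf_mk, ← hord]
      exact orderOf_injective (MulAut.conj g).toMonoidHom (MulAut.conj g).injective c)
    (by rw [Nat.card_zpowers, Subgroup.orderOf_mk, hord]) hpp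
  refine ⟨h * g, G.mul_mem h.2.1 hg, ?_, ?_⟩
  · intro x hx
    rw [mul_apply, hgσ x hx]
    exact (jp_range _ _).mp h.2.2 _ ((hσ x).mpr hx)
  · rw [MonoidHom.map_zpowers] at hh
    have h1 := Subgroup.mem_zpowers ((MulAut.conj h).toMonoidHom ⟨g * c * g⁻¹, hgcF⟩)
    rw [hh] at h1
    obtain ⟨k, hk⟩ := h1
    refine ⟨k, ?_⟩
    have h2 := congrArg (Subtype.val) hk
    simp only [SubgroupClass.coe_zpow, MulEquiv.coe_toMonoidHom, MulAut.conj_apply,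
      Subgroup.coe_mul, InvMemClass.coe_inv] at h2
    rw [h2]
    group

theorem jordan_prime {G : Subgroup (Perm α)} (hG : IsPreprimitive G α) {p : ℕ} (hp : p.Prime)
    (hp3 : p + 3 ≤ Nat.card α) {c : Perm α} (hc : c.IsCycle) (hcp : c.support.card = p)
    (hcG : c ∈ G) : alternatingGroup α ≤ G := by
  have hcard : 2 < (c.support)ᶜ.card := by
    rw [Finset.card_compl, hcp, ← Nat.card_eq_fintype_card]; omega
  obtain ⟨a, b, d, ha, hb, hd, hab, had, hbd⟩ := Finset.two_lt_card_iff.mp hcard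
  rw [Finset.mem_compl] at ha hb hd
  have hsw : ∀ u v : α, u ∉ c.support → v ∉ c.support →
      ∀ x, swap u v x ∉ c.support ↔ x ∉ c.support := by
    intro u v hu hv x
    by_cases h1 : x = u
    · subst h1; simp [swap_apply_left, hu, hv, -mem_support]
    by_cases h2 : x = v
    · subst h2; simp [swap_apply_right, hu, hv, -mem_support]
    rw [swap_apply_of_ne_of_ne h1 h2]
  have hinv : ∀ (g : Perm α) (u v : α), u ∉ c.support → v ∉ c.support →
      (∀ x ∉ c.support, g x = swap u v x) → ∀ x ∉ c.support, g⁻¹ x = swap u v x := by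
    intro g u v hu hv h x hx
    rw [Perm.inv_eq_iff_eq, h _ ((hsw u v hu hv x).mpr hx), swap_apply_self]
  obtain ⟨g₁, hg₁, hs₁, k₁, hk₁⟩ := jp_norm hG hp hp3 hc hcp hcG (swap a b) (hsw a b ha hb)
  obtain ⟨g₂, hg₂, hs₂, k₂, hk₂⟩ := jp_norm hG hp hp3 hc hcp hcG (swap a d) (hsw a d ha hd)
  set w := g₁⁻¹ * g₂⁻¹ * g₁ * g₂ with hw
  have hwG : w ∈ G := G.mul_mem (G.mul_mem (G.mul_mem (G.inv_mem hg₁) (G.inv_mem hg₂)) hg₁) hg₂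
  have e₁ : g₁ * g₂ * c * (g₁ * g₂)⁻¹ = c ^ (k₁ * k₂) := by
    calc g₁ * g₂ * c * (g₁ * g₂)⁻¹ = g₁ * (g₂ * c * g₂⁻¹) * g₁⁻¹ := by group
      _ = (g₁ * c * g₁⁻¹) ^ k₂ := by rw [hk₂, conj_zpow]
      _ = _ := by rw [hk₁, zpow_mul]
  have e₂ : g₂ * g₁ * c * (g₂ * g₁)⁻¹ = c ^ (k₁ * k₂) := by
    calc g₂ * g₁ * c * (g₂ * g₁)⁻¹ = g₂ * (g₁ * c * g₁⁻¹) * g₂⁻¹ := by group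
      _ = (g₂ * c * g₂⁻¹) ^ k₁ := by rw [hk₁, conj_zpow]
      _ = _ := by rw [hk₂, ← zpow_mul, mul_comm]
  have hcomm : Commute w c := by
    have h1 : w * c * w⁻¹ = c := by
      calc w * c * w⁻¹ = (g₂ * g₁)⁻¹ * (g₁ * g₂ * c * (g₁ * g₂)⁻¹) * (g₂ * g₁) := by
            rw [hw]; group
        _ = (g₂ * g₁)⁻¹ * (g₂ * g₁ * c * (g₂ * g₁)⁻¹) * (g₂ * g₁) := by rw [e₁, e₂]
        _ = c := by group
    rw [mul_inv_eq_iff_eq_mul] at h1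
    exact h1
  set τ := (swap a b * swap a d) ^ 2 with hτ
  have hτ3 : IsThreeCycle τ := by
    have := (isThreeCycle_swap_mul_swap_same hab had hbd).isThreeCycle_sq
    rwa [← pow_two] at this
  have hwτ : ∀ x ∉ c.support, w x = τ x := by
    intro x hx
    have n1 := (hsw a d ha hd x).mpr hx
    have n2 := (hsw a b ha hb _).mpr n1
    have n3 := (hsw a d ha hd _).mpr n2
    rw [hw, hτ]
    simp only [mul_apply, pow_two]
    rw [hs₂ x hx, hs₁ _ n1, hinv g₂ a d ha hd hs₂ _ n2, hinv g₁ a b ha hb hs₁ _ n3]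
  obtain ⟨hc', hu⟩ := hc.commute_iff.mp hcomm
  set u := ofSubtype (w.subtypePerm hc') with hudef
  have huG : u ∈ G := (Subgroup.zpowers_le.mpr hcG) hu
  have hwu : w = τ * u := by
    ext x
    by_cases hx : x ∈ c.support
    · have h1 : u x = w x := by
        rw [hudef, ofSubtype_apply_of_mem _ hx]; rfl
      have h2 : w x ∈ c.support := (hc' x).mpr hx
      change w x = τ (u x)
      rw [h1]
      have h3 : ∀ e f, e ∉ c.support → f ∉ c.support → swap e f (w x) = w x := by
        intro e f he hf
        apply swap_apply_of_ne_of_ne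
        · rintro rfl; exact he h2
        · rintro rfl; exact hf h2
      simp only [hτ, pow_two, mul_apply]
      rw [h3 a d ha hd, h3 a b ha hb, h3 a d ha hd, h3 a b ha hb]
    · have h1 : u x = x := ofSubtype_apply_of_not_mem _ hx
      change w x = τ (u x)
      rw [h1, hwτ x hx]
  have hτG : τ ∈ G := by
    have : τ = w * u⁻¹ := by rw [hwu]; group
    rw [this]; exact G.mul_mem hwG (G.inv_mem huG)
  exact alternatingGroup_le_of_isPreprimitive_of_isThreeCycle_mem hG hτ3 hτG

end JordanPrime

/-! ### Part 3: the general case, products of two disjoint cycles -/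

section General

open Equiv Equiv.Perm MulAction
open scoped Pointwise

/-- A criterion for the centraliser of `s` to be properly contained in the normaliser of
`zpowers s`. -/
theorem ge_norm {S : Type*} [Group S] [Finite S] (s x : S)
    (h1 : x * s * x⁻¹ ∈ Subgroup.zpowers s) (h2 : x * s * x⁻¹ ≠ s) :
    Subgroup.centralizer {s} < Subgroup.normalizer (Subgroup.zpowers s : Set S) := by
  rw [SetLike.lt_iff_le_and_exists]
  refine ⟨fun y hy => ?_, x, ?_, ?_⟩
  · rw [Subgroup.mem_centralizer_singleton_iff] at hy
    have hy' : Commute y s := hy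
    rw [Subgroup.mem_normalizer_iff]
    intro h
    have key : ∀ z ∈ Subgroup.zpowers s, Commute y z := by
      rintro z ⟨k, rfl⟩
      exact hy'.zpow_right k
    constructor
    · intro hh
      rw [(key h hh).eq, mul_inv_cancel_right]; exact hh
    · intro hh
      have h3 := key _ hh
      have h4 : y * h * y⁻¹ = h := by
        have := h3.eq
        calc y * h * y⁻¹ = y⁻¹ * (y * (y * h * y⁻¹)) := by group
          _ = y⁻¹ * ((y * h * y⁻¹) * y) := by rw [this]
          _ = h := by group
      rwa [h4] at hh
  · have hle : (Subgroup.zpowers s).map (MulAut.conj x).toMonoidHom ≤ Subgroup.zpowers s := by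
      rw [MonoidHom.map_zpowers, Subgroup.zpowers_le]
      exact h1
    have heq : (Subgroup.zpowers s).map (MulAut.conj x).toMonoidHom = Subgroup.zpowers s := by
      apply Subgroup.eq_of_le_of_card_ge hle
      rw [Subgroup.card_map_of_injective (MulAut.conj x).injective]
    rw [Subgroup.mem_normalizer_iff]
    intro h
    conv_rhs => rw [← heq]
    constructor
    · intro hh
      exact ⟨h, hh, rfl⟩
    · rintro ⟨k, hk, hkh⟩
      have : k = h := (MulAut.conj x).injective hkh
      rwa [← this]
  · rw [Subgroup.mem_centralizer_singleton_iff]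
    intro h
    apply h2
    rw [h, mul_inv_cancel_right]

theorem ge_choose_lt (n k : ℕ) (h : 2 * k + 1 < n) : n.choose k < n.choose (k + 1) := by
  have h1 := Nat.choose_succ_right_eq n k
  have h2 : 0 < n.choose k := Nat.choose_pos (by omega)
  have h3 : k + 1 < n - k := by omega
  by_contra h4
  push Not at h4
  have h5 : n.choose (k + 1) * (k + 1) ≤ n.choose k * (k + 1) := Nat.mul_le_mul_right _ h4
  have h6 : n.choose k * (k + 1) < n.choose k * (n - k) := Nat.mul_lt_mul_of_pos_left h3 h2
  omega

theorem ge_choose_lt' (n a b : ℕ) (hab : a < b) (hb : 2 * b ≤ n) : n.choose a < n.choose b := by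
  induction b, hab using Nat.le_induction with
  | base => exact ge_choose_lt n a (by omega)
  | succ m hm ih => exact (ih (by omega)).trans (ge_choose_lt n m (by omega))

theorem ge_choose_inj (n a b : ℕ) (ha : a ≤ n) (hb : b ≤ n) (h : n.choose a = n.choose b) :
    a = b ∨ a + b = n := by
  have key : ∀ x y, 2 * x ≤ n → 2 * y ≤ n → n.choose x = n.choose y → x = y := by
    intro x y hx hy hxy
    rcases lt_trichotomy x y with h1 | h1 | h1
    · have := ge_choose_lt' n x y h1 hy; omega
    · exact h1
    · have := ge_choose_lt' n y x h1 hx; omega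
  have ea := Nat.choose_symm ha
  have eb := Nat.choose_symm hb
  by_cases h1 : 2 * a ≤ n <;> by_cases h2 : 2 * b ≤ n
  · left; exact key a b h1 h2 h
  · have := key a (n - b) h1 (by omega) (by rw [eb, h]); omega
  · have := key (n - a) b (by omega) h2 (by rw [ea, h]); omega
  · have := key (n - a) (n - b) (by omega) (by omega) (by rw [ea, eb, h]); omega

variable {α : Type*} [Fintype α] [DecidableEq α]

theorem ge_exists (p b : ℕ) (hp : 2 ≤ p) (hb : 2 ≤ b) (h : p + b ≤ Fintype.card α) :
    ∃ c r : Perm α, c.IsCycle ∧ r.IsCycle ∧ c.Disjoint r ∧ c.support.card = p ∧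
      r.support.card = b := by
  obtain ⟨g, hg⟩ := (exists_with_cycleType_iff α (m := {p, b})).mpr
    ⟨by simpa using h, by simp [hp, hb]⟩
  obtain ⟨c, r, hcr, hd, hc, hcp⟩ := mem_cycleType_iff.mp
    (show p ∈ g.cycleType by rw [hg]; simp)
  have h1 : g.cycleType = c.cycleType + r.cycleType := by rw [hcr, hd.cycleType_mul]
  rw [hc.cycleType, hg, hcp] at h1
  have h2 : r.cycleType = {b} := by
    have h3 : ({p} : Multiset ℕ) + {b} = {p} + r.cycleType := h1
    exact (add_left_cancel h3).symm
  have hr : r.IsCycle := by rw [← card_cycleType_eq_one, h2]; simp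
  refine ⟨c, r, hc, hr, hd, hcp, ?_⟩
  rw [hr.cycleType] at h2
  simpa using h2

theorem ge_mem_zpowers {G : Type*} [Group G] (c r : G) (h : Commute c r)
    (hco : (orderOf c).Coprime (orderOf r)) : c ∈ Subgroup.zpowers (c * r) := by
  obtain ⟨k, hk1, hk2⟩ := Nat.chineseRemainder hco 1 0
  refine ⟨k, ?_⟩
  simp only [zpow_natCast]
  rw [h.mul_pow, pow_eq_pow_iff_modEq.mpr hk1, pow_eq_pow_iff_modEq.mpr hk2]
  simp

theorem ge_inverter (c : Perm α) :
    ∃ x : Perm α, x * c * x⁻¹ = c⁻¹ ∧ ∀ y ∉ c.support, x y = y := by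
  obtain ⟨x, hx⟩ := isConj_iff.mp
    (isConj_iff_cycleType_eq.mpr (show c.cycleType = c⁻¹.cycleType by rw [cycleType_inv]))
  have hxc : ∀ y, x (c y) = c⁻¹ (x y) := by
    intro y
    rw [← hx]; simp
  have hs : ∀ y, x y ∈ c.support ↔ y ∈ c.support := by
    intro y
    rw [← support_inv c, mem_support, ← hxc, support_inv, mem_support, x.injective.ne_iff]
  refine ⟨ofSubtype (x.subtypePerm hs), ?_, fun y hy => ofSubtype_apply_of_not_mem _ hy⟩
  rw [mul_inv_eq_iff_eq_mul]
  ext y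
  rw [mul_apply, mul_apply]
  by_cases hy : y ∈ c.support
  · rw [ofSubtype_apply_of_mem _ hy, ofSubtype_apply_of_mem _ (apply_mem_support.mpr hy)]
    exact hxc y
  · rw [ofSubtype_apply_of_not_mem _ hy, notMem_support.mp hy, ofSubtype_apply_of_not_mem _ hy]
    rw [← support_inv] at hy
    exact (notMem_support.mp hy).symm

theorem ge_inv_ne (c : Perm α) (hc : c.IsCycle) (h : 3 ≤ c.support.card) : c⁻¹ ≠ c := by
  intro h1
  have h2 : c ^ 2 = 1 := by
    rw [pow_two]; nth_rewrite 1 [← h1]; simp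
  have h3 := Nat.le_of_dvd (by norm_num) (orderOf_dvd_of_pow_eq_one h2)
  rw [hc.orderOf] at h3
  omega

theorem ge_part_one (c r : Perm α) (hc : c.IsCycle) (hr : r.IsCycle) (hd : c.Disjoint r)
    (hcp : 3 ≤ c.support.card) (hrb : 3 ≤ r.support.card)
    (hco : c.support.card.Coprime r.support.card) (hs : c * r ∈ alternatingGroup α) :
    Subgroup.centralizer {(⟨c * r, hs⟩ : alternatingGroup α)} <
      Subgroup.normalizer (Subgroup.zpowers (⟨c * r, hs⟩ : alternatingGroup α) :
        Set (alternatingGroup α)) := by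
  have hcz : c ∈ Subgroup.zpowers (c * r) :=
    ge_mem_zpowers c r hd.commute (by rwa [hc.orderOf, hr.orderOf])
  have hrz : r ∈ Subgroup.zpowers (c * r) := by
    rw [hd.commute.eq]
    exact ge_mem_zpowers r c hd.commute.symm (by rw [hc.orderOf, hr.orderOf]; exact hco.symm)
  suffices h : ∃ x ∈ alternatingGroup α, x * (c * r) * x⁻¹ ∈ Subgroup.zpowers (c * r) ∧
      x * (c * r) * x⁻¹ ≠ c * r by
    obtain ⟨x, hx, h1, h2⟩ := h
    refine ge_norm _ ⟨x, hx⟩ ?_ ?_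
    · obtain ⟨k, hk⟩ := h1
      exact ⟨k, Subtype.ext (by simpa using hk)⟩
    · intro h3
      exact h2 (congrArg Subtype.val h3)
  obtain ⟨x, hx, hx'⟩ := ge_inverter c
  obtain ⟨y, hy, hy'⟩ := ge_inverter r
  have hxr : Commute x r := by
    apply Disjoint.commute
    intro z
    by_cases hz : z ∈ c.support
    · right
      exact (hd z).resolve_left (mem_support.mp hz)
    · left; exact hx' z hz
  have hyc : Commute y c := by
    apply Disjoint.commute
    intro z
    by_cases hz : z ∈ r.support
    · right
      exact (hd z).resolve_right (mem_support.mp hz)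
    · left; exact hy' z hz
  have hcne := ge_inv_ne c hc hcp
  have hrne := ge_inv_ne r hr hrb
  have e1 : x * (c * r) * x⁻¹ = c⁻¹ * r := by
    calc x * (c * r) * x⁻¹ = (x * c * x⁻¹) * (x * r * x⁻¹) := by group
      _ = _ := by rw [hx, hxr.eq, mul_inv_cancel_right]
  have e2 : y * (c * r) * y⁻¹ = c * r⁻¹ := by
    calc y * (c * r) * y⁻¹ = (y * c * y⁻¹) * (y * r * y⁻¹) := by group
      _ = _ := by rw [hy, hyc.eq, mul_inv_cancel_right]
  have e3 : (x * y) * (c * r) * (x * y)⁻¹ = c⁻¹ * r⁻¹ := by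
    calc (x * y) * (c * r) * (x * y)⁻¹ = x * (y * (c * r) * y⁻¹) * x⁻¹ := by group
      _ = (x * c * x⁻¹) * (x * r * x⁻¹)⁻¹ := by rw [e2]; group
      _ = _ := by rw [hx, hxr.eq, mul_inv_cancel_right]
  have hciz := Subgroup.inv_mem _ hcz
  have hriz := Subgroup.inv_mem _ hrz
  rcases Int.units_eq_one_or (sign x) with h1 | h1
  · refine ⟨x, mem_alternatingGroup.mpr h1, ?_, ?_⟩
    · rw [e1]; exact Subgroup.mul_mem _ hciz hrz
    · rw [e1]; intro h; exact hcne (mul_right_cancel h)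
  rcases Int.units_eq_one_or (sign y) with h2 | h2
  · refine ⟨y, mem_alternatingGroup.mpr h2, ?_, ?_⟩
    · rw [e2]; exact Subgroup.mul_mem _ hcz hriz
    · rw [e2]; intro h; exact hrne (mul_left_cancel h)
  refine ⟨x * y, mem_alternatingGroup.mpr (by rw [Perm.sign_mul, h1, h2]; rfl), ?_, ?_⟩
  · rw [e3]; exact Subgroup.mul_mem _ hciz hriz
  · rw [e3]; intro h
    obtain ⟨z, hz⟩ : c.support.Nonempty := Finset.card_pos.mp (by omega)
    have hrz : r z = z := (hd z).resolve_left (mem_support.mp hz)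
    have hriz : r⁻¹ z = z := by rw [Perm.inv_eq_iff_eq, hrz]
    apply hcne
    have hdi : c⁻¹.Disjoint r⁻¹ := hd.inv_left.inv_right
    ext w
    by_cases hw : w ∈ c.support
    · have h4 : r w = w := (hd w).resolve_left (mem_support.mp hw)
      have h5 : r⁻¹ w = w := by rw [Perm.inv_eq_iff_eq, h4]
      have := DFunLike.congr_fun h w
      rw [mul_apply, mul_apply, h4, h5] at this
      rw [this]
    · rw [notMem_support.mp hw]
      rw [← support_inv] at hw
      exact notMem_support.mp hw

end General

section GeneralTwo

open Equiv Equiv.Perm MulAction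
open scoped Pointwise

variable {α : Type*} [Fintype α] [DecidableEq α]

theorem ge_stab_mem {g : Perm α} {B : Set α} (h : g ∈ stabilizer (Perm α) B) {x : α}
    (hx : x ∈ B) : g x ∈ B := by
  have h1 : g • B = B := h
  rw [← h1]
  exact Set.smul_mem_smul_set hx

theorem ge_cyc_mem {c : Perm α} (hc : c.IsCycle) (B : Set α) (h : c ∈ stabilizer (Perm α) B)
    {x y : α} (hx : x ∈ c.support) (hxB : x ∈ B) (hy : y ∈ c.support) : y ∈ B := by
  obtain ⟨i, rfl⟩ := hc.exists_zpow_eq (mem_support.mp hx) (mem_support.mp hy)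
  exact ge_stab_mem (Subgroup.zpow_mem _ h i) hxB

theorem ge_block_stab {K : Subgroup (Perm α)} {B : Set α} (hB : IsBlock K B) {g : Perm α}
    (hg : g ∈ K) {x : α} (hx : x ∈ B) (hgx : g x ∈ B) : g ∈ stabilizer (Perm α) B :=
  hB.smul_eq_of_mem (g := ⟨g, hg⟩) hx hgx

theorem ge_prim_odd {c r : Perm α} (hc : c.IsCycle) (hr : r.IsCycle)
    (hcp : Odd c.support.card) (f : α) (hf : ∀ x, x ∉ c.support → x ∉ r.support → x = f)
    (hfc : f ∉ c.support) (hfr : f ∉ r.support) (hodd : Odd (Nat.card α))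
    (hrb : Odd r.support.card)
    (K : Subgroup (Perm α)) [IsPretransitive K α] (hcK : c ∈ K) (hrK : r ∈ K) :
    IsPreprimitive K α := by
  apply IsPreprimitive.of_isTrivialBlock_base f
  intro B hfB hB
  have hcB := ge_block_stab hB hcK hfB (by rwa [notMem_support.mp hfc])
  have hrB := ge_block_stab hB hrK hfB (by rwa [notMem_support.mp hfr])
  have hdvd := hB.ncard_dvd_card ⟨f, hfB⟩
  have hBodd : Odd B.ncard := hodd.of_dvd_nat hdvd
  have key : ∀ D : Finset α, Odd D.card → f ∉ D → B = (insert f D : Finset α) → False := by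
    intro D hD hfD h
    rw [h, Set.ncard_coe_finset, Finset.card_insert_of_notMem hfD] at hBodd
    rw [Nat.odd_add_one] at hBodd
    exact hBodd hD
  by_cases h1 : ∃ x ∈ c.support, x ∈ B
  · obtain ⟨x, hx, hxB⟩ := h1
    by_cases h2 : ∃ y ∈ r.support, y ∈ B
    · obtain ⟨y, hy, hyB⟩ := h2
      right
      rw [Set.eq_univ_iff_forall]
      intro z
      by_cases hz : z ∈ c.support
      · exact ge_cyc_mem hc B hcB hx hxB hz
      by_cases hz' : z ∈ r.support
      · exact ge_cyc_mem hr B hrB hy hyB hz'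
      · rw [hf z hz hz']; exact hfB
    · exfalso
      push Not at h2
      refine key c.support hcp hfc ?_
      ext z
      rw [Finset.mem_coe, Finset.mem_insert]
      constructor
      · intro hz
        by_cases hzc : z ∈ c.support
        · exact Or.inr hzc
        · exact Or.inl (hf z hzc fun h => h2 z h hz)
      · rintro (rfl | h)
        · exact hfB
        · exact ge_cyc_mem hc B hcB hx hxB h
  · push Not at h1
    by_cases h2 : ∃ y ∈ r.support, y ∈ B
    · obtain ⟨y, hy, hyB⟩ := h2
      exfalso
      refine key r.support hrb hfr ?_
      ext z
      rw [Finset.mem_coe, Finset.mem_insert]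
      constructor
      · intro hz
        by_cases hzc : z ∈ r.support
        · exact Or.inr hzc
        · exact Or.inl (hf z (fun h => h1 z h hz) hzc)
      · rintro (rfl | h)
        · exact hfB
        · exact ge_cyc_mem hr B hrB hy hyB h
    · push Not at h2
      left
      intro z hz w hw
      rw [hf z (fun h => h1 z h hz) (fun h => h2 z h hz),
        hf w (fun h => h1 w h hw) (fun h => h2 w h hw)]

theorem ge_prim_even {c r : Perm α} (hc : c.IsCycle) (hr : r.IsCycle) (hd : c.Disjoint r)
    (hcp : c.support.card.Prime) (hf : ∀ x, x ∈ c.support ∨ x ∈ r.support)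
    (hdvd : ¬ c.support.card ∣ Nat.card α)
    (K : Subgroup (Perm α)) [IsPretransitive K α] (hcK : c ∈ K) (hrK : r ∈ K) :
    IsPreprimitive K α := by
  obtain ⟨x, hx⟩ : c.support.Nonempty := Finset.card_pos.mp hcp.pos
  apply IsPreprimitive.of_isTrivialBlock_base x
  intro B hxB hB
  have hrx : r x = x := (hd x).resolve_left (mem_support.mp hx)
  have hrB := ge_block_stab hB hrK hxB (by rwa [hrx])
  by_cases h2 : ∃ y ∈ r.support, y ∈ B
  · obtain ⟨y, hy, hyB⟩ := h2
    have hcy : c y = y := (hd y).resolve_right (mem_support.mp hy)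
    have hcB := ge_block_stab hB hcK hyB (by rwa [hcy])
    right
    rw [Set.eq_univ_iff_forall]
    intro z
    rcases hf z with hz | hz
    · exact ge_cyc_mem hc B hcB hx hxB hz
    · exact ge_cyc_mem hr B hrB hy hyB hz
  · push Not at h2
    have hBc : ∀ z ∈ B, z ∈ c.support := fun z hz => (hf z).resolve_right fun h => h2 z h hz
    left
    by_contra hns
    obtain ⟨y, hy, hyx⟩ : ∃ y ∈ B, y ≠ x := by
      by_contra h
      push Not at h
      exact hns fun z hz w hw => (h z hz).trans (h w hw).symm
    obtain ⟨i, hi⟩ := hc.exists_zpow_eq (mem_support.mp hx) (mem_support.mp (hBc y hy))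
    have hiB := ge_block_stab hB (Subgroup.zpow_mem _ hcK i) hxB (by rwa [hi])
    have hpow : c ^ c.support.card = 1 := by rw [← hc.orderOf, pow_orderOf_eq_one]
    have hndvd : ¬ (c.support.card : ℤ) ∣ i := by
      rintro ⟨j, rfl⟩
      apply hyx
      rw [← hi, zpow_mul, zpow_natCast, hpow]
      simp
    have hcop : IsCoprime (c.support.card : ℤ) i :=
      (Nat.prime_iff_prime_int.mp hcp).coprime_iff_not_dvd.mpr hndvd
    obtain ⟨u, v, huv⟩ := hcop
    have hcB : c ∈ stabilizer (Perm α) B := by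
      have : c = (c ^ i) ^ v := by
        rw [← zpow_mul]
        calc c = c ^ (u * (c.support.card : ℤ) + v * i) := by rw [huv, zpow_one]
          _ = _ := by
            rw [zpow_add, mul_comm u, zpow_mul, zpow_natCast, hpow, mul_comm v]; simp
      rw [this]
      exact Subgroup.zpow_mem _ hiB v
    apply hdvd
    have : B = (c.support : Set α) := by
      ext z
      exact ⟨hBc z, fun h => ge_cyc_mem hc B hcB hx hxB h⟩
    have h4 := hB.ncard_dvd_card ⟨x, hxB⟩
    rwa [this, Set.ncard_coe_finset] at h4

theorem ge_inter {c : Perm α} (hc : c.IsCycle) (O : Set α) (h : c ∈ stabilizer (Perm α) O) :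
    (∀ x ∈ c.support, x ∈ O) ∨ (∀ x ∈ c.support, x ∉ O) := by
  by_cases h1 : ∃ x ∈ c.support, x ∈ O
  · obtain ⟨x, hx, hxO⟩ := h1
    left
    intro y hy
    exact ge_cyc_mem hc O h hx hxO hy
  · right
    push Not at h1
    exact h1

theorem ge_card_aux (O C R : Finset α) (hCR : Disjoint C R) :
    O.card = (O ∩ C).card + (O ∩ R).card + (O ∩ (C ∪ R)ᶜ).card := by
  rw [← Finset.card_union_of_disjoint, ← Finset.card_union_of_disjoint]
  · congr 1
    ext x
    simp only [Finset.mem_union, Finset.mem_inter, Finset.mem_compl]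
    tauto
  · rw [Finset.disjoint_left]
    intro x
    simp only [Finset.mem_union, Finset.mem_inter, Finset.mem_compl]
    tauto
  · rw [Finset.disjoint_left] at hCR ⊢
    intro x
    have := @hCR x
    simp only [Finset.mem_inter]
    tauto

theorem ge_arith (i j a b x a' b' y C R : ℕ) (hi : C = 2 * i + 1) (hj : R = 2 * j + 1)
    (hC : 3 ≤ C) (hlt : C < R) (hx : x ≤ 1) (hy : y ≤ 1) (h1 : a = 0 ∨ a = C)
    (h2 : b = 0 ∨ b = R) (h3 : a' = 0 ∨ a' = C) (h4 : b' = 0 ∨ b' = R)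
    (h : a + b + x = a' + b' + y) : a = a' ∧ b = b' ∧ x = y := by
  rcases h1 with rfl | rfl <;> rcases h2 with rfl | rfl <;> rcases h3 with rfl | rfl <;>
    rcases h4 with rfl | rfl <;> omega

theorem ge_card_det (O₁ O₂ C R : Finset α) (hCR : Disjoint C R) (hC : Odd C.card)
    (hR : Odd R.card) (hC3 : 3 ≤ C.card) (hlt : C.card < R.card) (hF : (C ∪ R)ᶜ.card ≤ 1)
    (h1 : O₁ ∩ C = ∅ ∨ O₁ ∩ C = C) (h2 : O₁ ∩ R = ∅ ∨ O₁ ∩ R = R)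
    (h3 : O₂ ∩ C = ∅ ∨ O₂ ∩ C = C) (h4 : O₂ ∩ R = ∅ ∨ O₂ ∩ R = R)
    (h : O₁.card = O₂.card) : O₁ = O₂ := by
  have e1 := ge_card_aux O₁ C R hCR
  have e2 := ge_card_aux O₂ C R hCR
  have f1 : (O₁ ∩ (C ∪ R)ᶜ).card ≤ 1 := (Finset.card_le_card Finset.inter_subset_right).trans hF
  have f2 : (O₂ ∩ (C ∪ R)ᶜ).card ≤ 1 := (Finset.card_le_card Finset.inter_subset_right).trans hF
  obtain ⟨i, hi⟩ := hC
  obtain ⟨j, hj⟩ := hR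
  have key : O₁ ∩ C = O₂ ∩ C ∧ O₁ ∩ R = O₂ ∩ R ∧
      (O₁ ∩ (C ∪ R)ᶜ).card = (O₂ ∩ (C ∪ R)ᶜ).card := by
    have tr : ∀ O D : Finset α, (O ∩ D = ∅ ∨ O ∩ D = D) → (O ∩ D).card = 0 ∨
        (O ∩ D).card = D.card := by
      rintro O D (h | h)
      · left; rw [h, Finset.card_empty]
      · right; rw [h]
    have tr2 : ∀ D : Finset α, 0 < D.card → (O₁ ∩ D = ∅ ∨ O₁ ∩ D = D) →
        (O₂ ∩ D = ∅ ∨ O₂ ∩ D = D) → (O₁ ∩ D).card = (O₂ ∩ D).card → O₁ ∩ D = O₂ ∩ D := by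
      rintro D hD (h | h) (h' | h') he
      · rw [h, h']
      · rw [h, h', Finset.card_empty] at he; omega
      · rw [h, h', Finset.card_empty] at he; omega
      · rw [h, h']
    have t1 := tr _ _ h1
    have t2 := tr _ _ h2
    have t3 := tr _ _ h3
    have t4 := tr _ _ h4
    obtain ⟨d1, d2, d3⟩ := ge_arith i j _ _ _ _ _ _ _ _ hi hj hC3 hlt f1 f2 t1 t2 t3 t4
      (by rw [← e1, ← e2, h])
    exact ⟨tr2 C (by omega) h1 h3 d1, tr2 R (by omega) h2 h4 d2, d3⟩
  obtain ⟨k1, k2, k3⟩ := key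
  have k4 : O₁ ∩ (C ∪ R)ᶜ = O₂ ∩ (C ∪ R)ᶜ := by
    rw [Finset.card_le_one] at hF
    by_cases h0 : (O₁ ∩ (C ∪ R)ᶜ).card = 0
    · rw [h0] at k3
      rw [Finset.card_eq_zero.mp h0, Finset.card_eq_zero.mp k3.symm]
    · obtain ⟨a, ha⟩ := Finset.card_eq_one.mp (show (O₁ ∩ (C ∪ R)ᶜ).card = 1 by omega)
      obtain ⟨b, hb⟩ := Finset.card_eq_one.mp (show (O₂ ∩ (C ∪ R)ᶜ).card = 1 by omega)
      have ha' : a ∈ O₁ ∩ (C ∪ R)ᶜ := by rw [ha]; simp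
      have hb' : b ∈ O₂ ∩ (C ∪ R)ᶜ := by rw [hb]; simp
      rw [ha, hb, hF a (Finset.mem_of_mem_inter_right ha') b (Finset.mem_of_mem_inter_right hb')]
  ext x
  have m1 := Finset.ext_iff.mp k1 x
  have m2 := Finset.ext_iff.mp k2 x
  have m4 := Finset.ext_iff.mp k4 x
  simp only [Finset.mem_union, Finset.mem_inter, Finset.mem_compl] at m1 m2 m4
  by_cases hxC : x ∈ C
  · simpa [hxC] using m1
  by_cases hxR : x ∈ R
  · simpa [hxR] using m2
  · simpa [hxC, hxR] using m4

theorem ge_stab_index (hα : 3 ≤ Nat.card α) (O : Finset α) :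
    (stabilizer (alternatingGroup α) (O : Set α)).index = (Nat.card α).choose O.card := by
  have := Set.powersetCard.isPretransitive_alternatingGroup (n := O.card) hα
  let o : Set.powersetCard α O.card := ⟨O, rfl⟩
  have h1 := Set.powersetCard.stabilizer_coe (G := alternatingGroup α) o
  have h2 := index_stabilizer (alternatingGroup α) o
  have h3 : (orbit (alternatingGroup α) o).ncard = (Nat.card α).choose O.card := by
    rw [orbit_eq_univ, Set.ncard_univ, Set.powersetCard.card]
  exact (congrArg Subgroup.index h1).symm.trans (h2.trans h3)

end GeneralTwo

section GeneralThree

open Equiv Equiv.Perm MulAction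
open scoped Pointwise

variable {α : Type*} [Fintype α] [DecidableEq α]

theorem ge_max {c r : Perm α} (hc : c.IsCycle) (hcz : c ∈ Subgroup.zpowers (c * r))
    (hrz : r ∈ Subgroup.zpowers (c * r))
    (hcp : c.support.card.Prime) (hp3 : c.support.card + 3 ≤ Nat.card α)
    (hprim : ∀ K : Subgroup (Perm α), IsPretransitive K α → c ∈ K → r ∈ K → IsPreprimitive K α)
    (hs : c * r ∈ alternatingGroup α) (K : Subgroup (alternatingGroup α)) (hK : IsCoatom K)
    (hsK : (⟨c * r, hs⟩ : alternatingGroup α) ∈ K) :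
    ∃ O : Finset α, K = stabilizer (alternatingGroup α) (O : Set α) ∧
      c ∈ stabilizer (Perm α) (O : Set α) ∧ r ∈ stabilizer (Perm α) (O : Set α) := by
  classical
  set K' := K.map (alternatingGroup α).subtype with hK'
  have hsK' : c * r ∈ K' := ⟨_, hsK, rfl⟩
  have hcK : c ∈ K' := (Subgroup.zpowers_le.mpr hsK') hcz
  have hrK : r ∈ K' := (Subgroup.zpowers_le.mpr hsK') hrz
  have hnt : ¬ IsPretransitive K' α := by
    intro ht
    have h1 := jordan_prime (hprim K' ht hcK hrK) hcp hp3 hc rfl hcK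
    apply hK.1
    rw [eq_top_iff]
    intro x _
    obtain ⟨y, hy, hyx⟩ := h1 x.2
    have : y = x := Subtype.ext hyx
    rwa [← this]
  obtain ⟨a, ha⟩ : ∃ a : α, orbit K' a ≠ Set.univ := by
    by_contra h
    push Not at h
    apply hnt
    refine ⟨fun x y => ?_⟩
    have : y ∈ orbit K' x := by rw [h x]; trivial
    exact this
  have hinv : ∀ g ∈ K', g ∈ stabilizer (Perm α) (orbit K' a) := by
    intro g hg
    exact smul_orbit (⟨g, hg⟩ : K') a
  have hcoe : ((orbit K' a).toFinset : Set α) = orbit K' a := by simp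
  refine ⟨(orbit K' a).toFinset, ?_, ?_, ?_⟩
  · rw [hcoe]
    have hle : K ≤ stabilizer (alternatingGroup α) (orbit K' a) := by
      intro g hg
      exact hinv g ⟨g, hg, rfl⟩
    refine ((hK.le_iff.mp hle).resolve_left ?_).symm
    intro htop
    have hcard : 3 ≤ Nat.card α := by omega
    have ht := htop
    obtain ⟨z, hz⟩ := (Set.ne_univ_iff_exists_notMem _).mp ha
    have haO : a ∈ orbit K' a := mem_orbit_self a
    have h3 : 2 < (Finset.univ : Finset α).card := by
      rw [Finset.card_univ, ← Nat.card_eq_fintype_card]; omega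
    have haz : a ≠ z := by rintro rfl; exact hz haO
    obtain ⟨w, hw⟩ : ∃ w, w ∉ ({a, z} : Finset α) := by
      by_contra h
      push Not at h
      have h5 : (Finset.univ : Finset α) ⊆ {a, z} := fun w _ => h w
      have h6 := Finset.card_le_card h5
      have h7 := Finset.card_le_two (a := a) (b := z)
      omega
    simp only [Finset.mem_insert, Finset.mem_singleton, not_or] at hw
    have hg : swap a z * swap a w ∈ alternatingGroup α :=
      (isThreeCycle_swap_mul_swap_same haz (Ne.symm hw.1) (Ne.symm hw.2)).mem_alternatingGroup
    have hmem : ∀ g ∈ alternatingGroup α, g ∈ stabilizer (Perm α) (orbit K' a) := by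
      intro g hg
      have : (⟨g, hg⟩ : alternatingGroup α) ∈ stabilizer (alternatingGroup α) (orbit K' a) := by
        rw [ht]; trivial
      exact this
    have m1 := hmem _ hg
    have m2 := Subgroup.inv_mem _ m1
    by_cases hwO : w ∈ orbit K' a
    · have := ge_stab_mem m1 hwO
      rw [mul_apply, swap_apply_right, swap_apply_left] at this
      exact hz this
    · have := ge_stab_mem m1 haO
      rw [mul_apply, swap_apply_left, swap_apply_of_ne_of_ne hw.1 hw.2] at this
      exact hwO this
  · rw [hcoe]; exact hinv c hcK
  · rw [hcoe]; exact hinv r hrK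

theorem ge_inter' {c : Perm α} (hc : c.IsCycle) (O : Finset α)
    (h : c ∈ stabilizer (Perm α) (O : Set α)) : O ∩ c.support = ∅ ∨ O ∩ c.support = c.support := by
  rcases ge_inter hc O h with h | h
  · right
    rw [Finset.inter_eq_right]
    exact fun x hx => h x hx
  · left
    rw [Finset.eq_empty_iff_forall_notMem]
    intro x hx
    rw [Finset.mem_inter] at hx
    exact h x hx.2 hx.1

theorem ge_distinct {c r : Perm α} (hc : c.IsCycle) (hr : r.IsCycle) (hd : c.Disjoint r)
    (hcz : c ∈ Subgroup.zpowers (c * r)) (hrz : r ∈ Subgroup.zpowers (c * r))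
    (hcp : c.support.card.Prime) (hp3 : c.support.card + 3 ≤ Nat.card α)
    (hC : Odd c.support.card) (hR : Odd r.support.card) (hlt : c.support.card < r.support.card)
    (hF : (c.support ∪ r.support)ᶜ.card ≤ 1)
    (hprim : ∀ K : Subgroup (Perm α), IsPretransitive K α → c ∈ K → r ∈ K → IsPreprimitive K α)
    (hs : c * r ∈ alternatingGroup α) (K₁ K₂ : Subgroup (alternatingGroup α)) (hK₁ : IsCoatom K₁)
    (hK₂ : IsCoatom K₂)
    (hs₁ : (⟨c * r, hs⟩ : alternatingGroup α) ∈ K₁)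
    (hs₂ : (⟨c * r, hs⟩ : alternatingGroup α) ∈ K₂) (hcard : Nat.card K₁ = Nat.card K₂) :
    K₁ = K₂ := by
  have hcp3 : 3 ≤ c.support.card := by
    have := hcp.two_le
    obtain ⟨k, hk⟩ := hC
    omega
  have hα : 3 ≤ Nat.card α := by omega
  have hCR : Disjoint c.support r.support := disjoint_iff_disjoint_support.mp hd
  obtain ⟨O₁, h1, hc1, hr1⟩ := ge_max hc hcz hrz hcp hp3 hprim hs K₁ hK₁ hs₁
  obtain ⟨O₂, h2, hc2, hr2⟩ := ge_max hc hcz hrz hcp hp3 hprim hs K₂ hK₂ hs₂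
  have i1 := ge_stab_index hα O₁
  have i2 := ge_stab_index hα O₂
  rw [← h1] at i1
  rw [← h2] at i2
  have hidx : K₁.index = K₂.index := by
    have e1 := K₁.card_mul_index
    have e2 := K₂.card_mul_index
    rw [hcard, ← e2] at e1
    exact Nat.eq_of_mul_eq_mul_left Nat.card_pos e1
  rw [i1, i2] at hidx
  have hle : ∀ O : Finset α, O.card ≤ Nat.card α := fun O => by
    rw [Nat.card_eq_fintype_card]; exact Finset.card_le_univ O
  rcases ge_choose_inj _ _ _ (hle O₁) (hle O₂) hidx with h | h
  · have : O₁ = O₂ := ge_card_det O₁ O₂ c.support r.support hCR hC hR hcp3 hlt hF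
      (ge_inter' hc _ hc1) (ge_inter' hr _ hr1) (ge_inter' hc _ hc2) (ge_inter' hr _ hr2) h
    rw [h1, h2, this]
  · have hcc : c ∈ stabilizer (Perm α) ((O₂ᶜ : Finset α) : Set α) := by
      rw [Finset.coe_compl, stabilizer_compl]; exact hc2
    have hrc : r ∈ stabilizer (Perm α) ((O₂ᶜ : Finset α) : Set α) := by
      rw [Finset.coe_compl, stabilizer_compl]; exact hr2
    have : O₁ = O₂ᶜ := ge_card_det O₁ O₂ᶜ c.support r.support hCR hC hR hcp3 hlt hF
      (ge_inter' hc _ hc1) (ge_inter' hr _ hr1) (ge_inter' hc _ hcc) (ge_inter' hr _ hrc)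
      (by rw [Finset.card_compl, ← Nat.card_eq_fintype_card]; omega)
    rw [h1, h2, this, Finset.coe_compl, stabilizer_compl]

theorem ge_prime (N : ℕ) (hN : Even N) (h8 : 8 ≤ N) :
    ∃ p : ℕ, p.Prime ∧ Odd p ∧ 2 * p + 2 ≤ N ∧ ¬ p ∣ N := by
  obtain ⟨m, rfl⟩ := hN
  have key : ∀ q, Odd q → 3 ≤ q → q + 1 ≤ m → m ≤ q + 2 →
      ∃ p : ℕ, p.Prime ∧ Odd p ∧ 2 * p + 2 ≤ m + m ∧ ¬ p ∣ m + m := by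
    intro q hq h3 h1 h2
    have hp : (q.minFac).Prime := Nat.minFac_prime (by omega)
    have hdv := Nat.minFac_dvd q
    have hpo : Odd q.minFac := hq.of_dvd_nat hdv
    have hle := Nat.minFac_le (n := q) (by omega)
    refine ⟨q.minFac, hp, hpo, by omega, ?_⟩
    intro hd
    have hp2 := hp.two_le
    have h4 : q.minFac ∣ m + m - 2 * q := Nat.dvd_sub hd (hdv.mul_left 2)
    have h5 : m + m - 2 * q = 2 ∨ m + m - 2 * q = 4 := by omega
    have h6 : q.minFac ∣ 2 := by
      rcases h5 with h5 | h5
      · rwa [h5] at h4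
      · rw [h5] at h4
        exact hp.dvd_of_dvd_pow (show q.minFac ∣ 2 ^ 2 from h4)
    have h7 := Nat.le_of_dvd (by norm_num) h6
    obtain ⟨k, hk⟩ := hpo
    omega
  rcases Nat.even_or_odd m with he | ho
  · obtain ⟨k, hk⟩ := he
    exact key (m - 1) ⟨k - 1, by omega⟩ (by omega) (by omega) (by omega)
  · obtain ⟨k, hk⟩ := ho
    exact key (m - 2) ⟨k - 1, by omega⟩ (by omega) (by omega) (by omega)

theorem ge_main (hα : 8 ≤ Nat.card α) : ∃ s : alternatingGroup α, s ≠ 1 ∧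
    Subgroup.centralizer {s} < Subgroup.normalizer (Subgroup.zpowers s : Set (alternatingGroup α)) ∧
    ∀ K₁ K₂ : Subgroup (alternatingGroup α), IsCoatom K₁ → IsCoatom K₂ → s ∈ K₁ → s ∈ K₂ →
      Nat.card K₁ = Nat.card K₂ → K₁ = K₂ := by
  obtain ⟨N, hNe, hN8, hN1, hN2⟩ : ∃ N, Even N ∧ 8 ≤ N ∧ N ≤ Nat.card α ∧ Nat.card α ≤ N + 1 := by
    rcases Nat.even_or_odd (Nat.card α) with h | h
    · exact ⟨_, h, hα, le_rfl, by omega⟩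
    · obtain ⟨k, hk⟩ := h
      exact ⟨2 * k, ⟨k, by omega⟩, by omega, by omega, by omega⟩
  obtain ⟨p, hp, hpo, hpN, hpd⟩ := ge_prime N hNe hN8
  have hp3 : 3 ≤ p := by
    have := hp.two_le
    obtain ⟨k, hk⟩ := hpo
    omega
  obtain ⟨b, hb⟩ : ∃ b, N = p + b := ⟨N - p, by omega⟩
  have hbo : Odd b := by
    obtain ⟨k, hk⟩ := hpo
    obtain ⟨m, hm⟩ := hNe
    exact ⟨m - k - 1, by omega⟩
  obtain ⟨c, r, hc, hr, hd, hcp, hrb⟩ := ge_exists (α := α) p b (by omega) (by omega)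
    (by rw [← Nat.card_eq_fintype_card]; omega)
  have hcop : c.support.card.Coprime r.support.card := by
    rw [hcp, hrb, hp.coprime_iff_not_dvd]
    intro h
    apply hpd
    rw [hb]
    exact dvd_add dvd_rfl h
  have hs : c * r ∈ alternatingGroup α := by
    rw [mem_alternatingGroup, Perm.sign_mul, hc.sign, hr.sign, hcp, hrb, hpo.neg_one_pow,
      hbo.neg_one_pow]
    rfl
  have hcz : c ∈ Subgroup.zpowers (c * r) :=
    ge_mem_zpowers c r hd.commute (by rwa [hc.orderOf, hr.orderOf])
  have hrz : r ∈ Subgroup.zpowers (c * r) := by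
    rw [hd.commute.eq]
    exact ge_mem_zpowers r c hd.commute.symm (by rw [hc.orderOf, hr.orderOf]; exact hcop.symm)
  have hCR : Disjoint c.support r.support := disjoint_iff_disjoint_support.mp hd
  have hFc : (c.support ∪ r.support)ᶜ.card = Nat.card α - N := by
    rw [Finset.card_compl, Finset.card_union_of_disjoint hCR, hcp, hrb,
      ← Nat.card_eq_fintype_card, hb]
  have hprim : ∀ K : Subgroup (Perm α), IsPretransitive K α → c ∈ K → r ∈ K →
      IsPreprimitive K α := by
    intro K hK hcK hrK
    by_cases hcard : Nat.card α = N
    · refine ge_prim_even hc hr hd (by rwa [hcp]) ?_ (by rwa [hcp, hcard]) K hcK hrK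
      intro x
      have h0 : (c.support ∪ r.support)ᶜ = ∅ := by
        rw [← Finset.card_eq_zero, hFc]; omega
      have hx : x ∉ (c.support ∪ r.support)ᶜ := by rw [h0]; simp
      rwa [Finset.mem_compl, not_not, Finset.mem_union] at hx
    · obtain ⟨f, hf⟩ := Finset.card_eq_one.mp
        (show (c.support ∪ r.support)ᶜ.card = 1 by rw [hFc]; omega)
      have hf1 : f ∈ (c.support ∪ r.support)ᶜ := by rw [hf]; simp
      rw [Finset.mem_compl, Finset.mem_union, not_or] at hf1
      refine ge_prim_odd hc hr (by rwa [hcp]) f ?_ hf1.1 hf1.2 ?_ (by rwa [hrb]) K hcK hrK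
      · intro x h1 h2
        have : x ∈ (c.support ∪ r.support)ᶜ := by
          rw [Finset.mem_compl, Finset.mem_union, not_or]; exact ⟨h1, h2⟩
        rw [hf] at this
        simpa using this
      · obtain ⟨m, hm⟩ := hNe
        exact ⟨m, by omega⟩
  refine ⟨⟨c * r, hs⟩, ?_, ?_, ?_⟩
  · intro h
    have h1 : c * r = 1 := congrArg Subtype.val h
    rw [h1, Subgroup.zpowers_one_eq_bot, Subgroup.mem_bot] at hcz
    exact hc.ne_one hcz
  · exact ge_part_one c r hc hr hd (by omega) (by omega) hcop hs
  · intro K₁ K₂ hK₁ hK₂ h1 h2 h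
    exact ge_distinct hc hr hd hcz hrz (by rwa [hcp]) (by omega) (by rwa [hcp]) (by rwa [hrb])
      (by omega) (by omega) hprim hs K₁ K₂ hK₁ hK₂ h1 h2 h

end GeneralThree

/-! ### Part 4: the degrees five, six and seven -/

section Small

open Equiv Equiv.Perm MulAction

variable {S : Type*} [Group S]

theorem sm_norm_card [Finite S] {p : ℕ} [hp : Fact p.Prime] (s : S) (hs : orderOf s = p)
    (hcent : ∀ x : S, x * s = s * x → x ∈ Subgroup.zpowers s) (H : Subgroup S) (hsH : s ∈ H) :
    ∃ d, d ∣ p - 1 ∧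
      Nat.card (Subgroup.normalizer (Subgroup.zpowers s : Set S) ⊓ H : Subgroup S) = p * d := by
  set P := Subgroup.zpowers s with hP
  set M : Subgroup S := Subgroup.normalizer (P : Set S) ⊓ H with hM
  have hMN : M ≤ Subgroup.normalizer (P : Set S) := inf_le_left
  have hcardP : Nat.card P = p := by rw [hP, Nat.card_zpowers, hs]
  let f : M →* MulAut P := P.normalizerMonoidHom.comp (Subgroup.inclusion hMN)
  have hPM : P ≤ M := le_inf Subgroup.le_normalizer (Subgroup.zpowers_le.mpr hsH)
  have hker : f.ker = P.subgroupOf M := by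
    ext x
    rw [MonoidHom.mem_ker, Subgroup.mem_subgroupOf]
    have h1 : f x = 1 ↔ Subgroup.inclusion hMN x ∈ P.normalizerMonoidHom.ker := by
      rw [MonoidHom.mem_ker]; rfl
    rw [h1, Subgroup.normalizerMonoidHom_ker, Subgroup.mem_subgroupOf]
    change (x : S) ∈ _ ↔ _
    constructor
    · intro h
      rw [Subgroup.mem_centralizer_iff] at h
      exact hcent x (h s (Subgroup.mem_zpowers s)).symm
    · rintro ⟨k, hk⟩
      rw [Subgroup.mem_centralizer_iff]
      rintro y ⟨j, rfl⟩
      simp only at hk ⊢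
      rw [← hk, ← zpow_add, ← zpow_add, add_comm]
  refine ⟨Nat.card f.range, ?_, ?_⟩
  · have h1 := Subgroup.card_subgroup_dvd_card f.range
    rw [IsCyclic.card_mulAut, hcardP, Nat.totient_prime hp.out] at h1
    exact h1
  · rw [← Subgroup.index_ker, ← Subgroup.card_mul_index f.ker, hker]
    congr 1
    rw [← hcardP]
    exact Nat.card_congr (Subgroup.subgroupOfEquivOfLe hPM).toEquiv

/-- A bound on the order of proper subgroups of a simple group. -/
theorem sm_index [Finite S] [IsSimpleGroup S] (m : ℕ) (hm : ¬ Nat.card S ∣ m.factorial)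
    (H : Subgroup S) (hH : H ≠ ⊤) : Nat.card H * (m + 1) ≤ Nat.card S := by
  have h1 := red_index H hH
  have h2 : m < H.index := by
    by_contra h
    push Not at h
    exact hm (h1.trans (Nat.factorial_dvd_factorial h))
  rw [← H.card_mul_index]
  exact Nat.mul_le_mul_left _ h2

theorem sm_part_one [Finite S] {p d : ℕ} [hp : Fact p.Prime] (s : S) (hs : orderOf s = p)
    (hcent : ∀ x : S, x * s = s * x → x ∈ Subgroup.zpowers s)
    (hN : Nat.card (Subgroup.normalizer (Subgroup.zpowers s : Set S)) = p * d) (hd : 2 ≤ d) :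
    Subgroup.centralizer {s} < Subgroup.normalizer (Subgroup.zpowers s : Set S) := by
  have h1 : Subgroup.centralizer {s} ≤ Subgroup.zpowers s := fun x hx =>
    hcent x (Subgroup.mem_centralizer_singleton_iff.mp hx)
  have h2 : Subgroup.zpowers s ≤ Subgroup.normalizer (Subgroup.zpowers s : Set S) :=
    Subgroup.le_normalizer
  refine lt_of_le_of_ne (h1.trans h2) fun h => ?_
  rw [h] at h1
  have h3 := Nat.card_mono (Set.toFinite _) (SetLike.coe_subset_coe.mpr h1)
  change Nat.card (Subgroup.normalizer (Subgroup.zpowers s : Set S)) ≤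
    Nat.card (Subgroup.zpowers s) at h3
  rw [hN, Nat.card_zpowers, hs] at h3
  have := hp.out.two_le
  nlinarith

theorem sm_thirty {H : Type*} [Group H] [Finite H] (hH : Nat.card H = 30) (s : H)
    (hs : orderOf s = 5) : ∃ K : Subgroup H, Nat.card K = 15 ∧ s ∈ K := by
  have : Fact (Nat.Prime 2) := ⟨Nat.prime_two⟩
  let P : Sylow 2 H := default
  have hcard : Nat.card P = 2 := by
    rw [P.card_eq_multiplicity, hH]
    have : (30 : ℕ).factorization 2 = 1 := by
      rw [Nat.factorization_def _ Nat.prime_two]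
      have : (30 : ℕ) = 2 * 15 := by norm_num
      rw [this, padicValNat.mul (by norm_num) (by norm_num), padicValNat.self (by norm_num),
        padicValNat.eq_zero_of_not_dvd (by norm_num)]
    rw [this, pow_one]
  have hmin : (Nat.card H).minFac = 2 := by rw [hH]; norm_num
  have hcyc : IsCyclic P := isCyclic_of_prime_card hcard
  have hc := IsCyclic.isComplement' hmin hcyc
  set K := (MonoidHom.transferSylow P (IsCyclic.normalizer_le_centralizer hmin hcyc)).ker
  have h1 := hc.card_mul_card
  rw [hH, show Nat.card (P : Subgroup H) = 2 from hcard] at h1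
  have h2 : K.index = 2 := by
    have := K.card_mul_index
    rw [hH] at this
    have h3 : Nat.card K = 15 := by omega
    rw [h3] at this
    omega
  refine ⟨K, by omega, ?_⟩
  have h3 := Subgroup.sq_mem_of_index_two h2 s
  have h4 : s = (s ^ 2) ^ 3 := by
    rw [← pow_mul]
    have : s ^ 5 = 1 := by rw [← hs, pow_orderOf_eq_one]
    calc s = s ^ 5 * s := by rw [this, one_mul]
      _ = _ := by rw [← pow_succ]
  rw [h4]
  exact Subgroup.pow_mem _ h3 3

variable {α : Type*} [Fintype α] [DecidableEq α]

theorem sm_exists (p : ℕ) (hp : 2 ≤ p) (hodd : Odd p) (h : p ≤ Fintype.card α)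
    (h1 : Fintype.card α ≤ p + 1) :
    ∃ s : alternatingGroup α, (s : Perm α).IsCycle ∧ (s : Perm α).support.card = p ∧
      orderOf s = p ∧ ∀ x : alternatingGroup α, x * s = s * x → x ∈ Subgroup.zpowers s := by
  obtain ⟨c, hct⟩ := (exists_with_cycleType_iff α (m := {p})).mpr
    ⟨by simpa using h, by simp [hp]⟩
  have hc : c.IsCycle := by rw [← card_cycleType_eq_one, hct]; simp
  have hcp : c.support.card = p := by
    rw [hc.cycleType] at hct; simpa using hct
  have hs : c ∈ alternatingGroup α := by
    rw [mem_alternatingGroup, hc.sign, hcp, hodd.neg_one_pow]; rfl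
  refine ⟨⟨c, hs⟩, hc, hcp, by rw [Subgroup.orderOf_mk, hc.orderOf, hcp], ?_⟩
  intro x hx
  have hx' : Commute (x : Perm α) c := congrArg Subtype.val hx
  obtain ⟨hc', hz⟩ := hc.commute_iff.mp hx'
  have hF : (c.supportᶜ).card ≤ 1 := by rw [Finset.card_compl, hcp]; omega
  rw [Finset.card_le_one] at hF
  rw [ofSubtype_subtypePerm] at hz
  · obtain ⟨k, hk⟩ := hz
    exact ⟨k, Subtype.ext (by simpa using hk)⟩
  · intro y hy
    by_contra hyc
    apply hy
    refine hF _ ?_ _ ?_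
    · rw [Finset.mem_compl, hc']; exact hyc
    · rw [Finset.mem_compl]; exact hyc

theorem sm_burnside {p : ℕ} [hp : Fact p.Prime] (hα : Nat.card α = p)
    (hpp : ¬ p ^ 2 ∣ Nat.card (alternatingGroup α))
    (s : alternatingGroup α) (hc : (s : Perm α).IsCycle) (hcp : (s : Perm α).support.card = p)
    (hs : orderOf s = p)
    (H : Subgroup (alternatingGroup α)) (hsH : s ∈ H)
    (hd : Nat.card (Subgroup.normalizer (Subgroup.zpowers s : Set (alternatingGroup α)) ⊓ H :
      Subgroup (alternatingGroup α)) = p) : Nat.card H = p := by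
  set P := Subgroup.zpowers s with hPdef
  have hPH : P ≤ H := Subgroup.zpowers_le.mpr hsH
  have hP : Nat.card P = p := by rw [hPdef, Nat.card_zpowers, hs]
  let P' : Sylow p H := Sylow.ofCard (P.subgroupOf H) (red_fact H P hPH hP hpp)
  have hNP : Subgroup.normalizer (P : Set (alternatingGroup α)) ⊓ H = P := by
    symm
    apply Subgroup.eq_of_le_of_card_ge (le_inf Subgroup.le_normalizer hPH)
    rw [hd, hP]
  have hn : Subgroup.normalizer (P' : Set H) ≤ Subgroup.centralizer (P' : Set H) := by
    have h2 : Subgroup.normalizer (P' : Set H) =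
        (Subgroup.normalizer (P : Set (alternatingGroup α))).subgroupOf H := by
      rw [Subgroup.subgroupOf_normalizer_eq hPH]
      rfl
    rw [h2]
    intro x hx
    rw [Subgroup.mem_subgroupOf] at hx
    have hxP : (x : alternatingGroup α) ∈ P := by
      rw [← hNP]; exact ⟨hx, x.2⟩
    rw [Subgroup.mem_centralizer_iff]
    intro y hy
    have hyP : (y : alternatingGroup α) ∈ P := hy
    obtain ⟨i, hi⟩ := hxP
    obtain ⟨j, hj⟩ := hyP
    apply Subtype.ext
    simp only [Subgroup.coe_mul] at hi hj ⊢
    rw [← hi, ← hj, ← zpow_add, ← zpow_add, add_comm]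
  have hcompl := MonoidHom.ker_transferSylow_isComplement' P' hn
  set K := (MonoidHom.transferSylow P' hn).ker with hK
  have hcard := hcompl.card_mul_card
  have hP' : Nat.card (P' : Subgroup H) = p :=
    (Nat.card_congr (Subgroup.subgroupOfEquivOfLe hPH).toEquiv).trans hP
  rw [hP'] at hcard
  have hsupp : ∀ x, x ∈ (s : Perm α).support := by
    have : (s : Perm α).support = Finset.univ := by
      rw [← Finset.card_eq_iff_eq_univ, hcp, ← Nat.card_eq_fintype_card, hα]
    intro x; rw [this]; simp
  have htrans : IsPretransitive H α := by
    refine ⟨fun x y => ?_⟩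
    obtain ⟨i, hi⟩ := hc.exists_zpow_eq (mem_support.mp (hsupp x)) (mem_support.mp (hsupp y))
    refine ⟨⟨s, hsH⟩ ^ i, ?_⟩
    rw [← hi]
    rfl
  have hprim : IsPreprimitive H α := IsPreprimitive.of_prime_card (by rw [hα]; exact hp.out)
  have hq : IsQuasiPreprimitive H α := IsPreprimitive.isQuasiPreprimitive
  by_cases hfix : fixedPoints K α = Set.univ
  · have hKbot : K = ⊥ := by
      rw [Subgroup.eq_bot_iff_forall]
      intro x hx
      apply Subtype.ext
      apply Subtype.ext
      ext y
      have : y ∈ fixedPoints K α := by rw [hfix]; trivial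
      exact this ⟨x, hx⟩
    rw [hKbot, Subgroup.card_bot, one_mul] at hcard
    exact hcard.symm
  · have ht := hq.isPretransitive_of_normal hfix
    exfalso
    have hne : Nonempty α := by
      rw [← Fintype.card_pos_iff, ← Nat.card_eq_fintype_card, hα]; exact hp.out.pos
    obtain ⟨a⟩ := hne
    have h1 : p ∣ Nat.card K := by
      have h2 := index_stabilizer K a
      rw [orbit_eq_univ, Set.ncard_univ, hα] at h2
      rw [← h2]
      exact Subgroup.index_dvd_card _
    apply hpp
    refine dvd_trans ?_ (Subgroup.card_subgroup_dvd_card H)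
    rw [← hcard, pow_two]
    exact Nat.mul_dvd_mul_right h1 p

end Small

section Final

open Equiv Equiv.Perm MulAction

/-- The dichotomy for subgroups containing `s`, in the three small degrees. -/
def SmallDich {S : Type*} [Group S] (s : S) : Prop :=
  ∀ H : Subgroup S, s ∈ H → H ≠ ⊤ →
      H ≤ Subgroup.normalizer (Subgroup.zpowers s : Set S) ∨
      (Subgroup.normalizer (Subgroup.zpowers s : Set S) ≤ H ∧ IsCoatom H)

/-- The order equation for a subgroup containing a suitable element of prime order. -/
theorem sm_order {S : Type*} [Group S] [Finite S] {p : ℕ} [hp : Fact p.Prime] (s : S)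
    (hs : orderOf s = p) (hpp : ¬ p ^ 2 ∣ Nat.card S)
    (hcent : ∀ x : S, x * s = s * x → x ∈ Subgroup.zpowers s) (H : Subgroup S) (hsH : s ∈ H) :
    ∃ k d, k % p = 1 ∧ d ∣ p - 1 ∧ Nat.card H = k * (p * d) ∧
      Nat.card (Subgroup.normalizer (Subgroup.zpowers s : Set S) ⊓ H : Subgroup S) = p * d ∧
      (k = 1 → H ≤ Subgroup.normalizer (Subgroup.zpowers s : Set S)) := by
  obtain ⟨d, hd, hcd⟩ := sm_norm_card s hs hcent H hsH
  obtain ⟨k, hk1, hk2, hk3⟩ := red_numeric (Subgroup.zpowers s) H (Subgroup.zpowers_le.mpr hsH)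
    (by rw [Nat.card_zpowers, hs]) hpp
  refine ⟨k, d, ?_, hd, by rw [hk2, hcd], hcd, hk3⟩
  rw [hk1, Nat.mod_eq_of_lt hp.out.one_lt]

theorem sm_five {S : Type*} [Group S] [Finite S] [IsSimpleGroup S] (hS : Nat.card S = 60)
    (s : S) (hs : orderOf s = 5)
    (hcent : ∀ x : S, x * s = s * x → x ∈ Subgroup.zpowers s) :
    Subgroup.centralizer {s} < Subgroup.normalizer (Subgroup.zpowers s : Set S) ∧
      SmallDich s := by
  have : Fact (Nat.Prime 5) := ⟨by norm_num⟩
  have hpp : ¬ 5 ^ 2 ∣ Nat.card S := by rw [hS]; norm_num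
  constructor
  · obtain ⟨k, d, hk, hd, hH, hN, -⟩ := sm_order s hs hpp hcent ⊤ trivial
    rw [inf_top_eq] at hN
    rw [Subgroup.card_top, hS] at hH
    refine sm_part_one s hs hcent hN ?_
    have h1 := Nat.le_of_dvd (by norm_num) hd
    interval_cases d <;> omega
  · intro H hsH hH
    have h1 := sm_index 4 (by rw [hS]; decide) H hH
    obtain ⟨k, d, hk, hd, hHc, hN, himp⟩ := sm_order s hs hpp hcent H hsH
    left
    apply himp
    rw [hS, hHc] at h1
    have h2 : 0 < d := Nat.pos_of_dvd_of_pos hd (by norm_num)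
    have h3 : k * 5 ≤ k * (5 * d) := Nat.mul_le_mul_left _ (by omega)
    omega

theorem sm_six {S : Type*} [Group S] [Finite S] [IsSimpleGroup S] (hS : Nat.card S = 360)
    (s : S) (hs : orderOf s = 5)
    (hcent : ∀ x : S, x * s = s * x → x ∈ Subgroup.zpowers s) :
    Subgroup.centralizer {s} < Subgroup.normalizer (Subgroup.zpowers s : Set S) ∧
      SmallDich s := by
  have : Fact (Nat.Prime 5) := ⟨by norm_num⟩
  have hpp : ¬ 5 ^ 2 ∣ Nat.card S := by rw [hS]; norm_num
  have hNc : Nat.card (Subgroup.normalizer (Subgroup.zpowers s : Set S)) = 5 * 2 := by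
    obtain ⟨k, d, hk, hd, hH, hN, -⟩ := sm_order s hs hpp hcent ⊤ trivial
    rw [inf_top_eq] at hN
    rw [Subgroup.card_top, hS] at hH
    rw [hN]
    have h1 := Nat.le_of_dvd (by norm_num) hd
    interval_cases d <;> omega
  refine ⟨sm_part_one s hs hcent hNc le_rfl, ?_⟩
  have key : ∀ H : Subgroup S, s ∈ H → H ≠ ⊤ →
      H ≤ Subgroup.normalizer (Subgroup.zpowers s : Set S) ∨ (Nat.card H = 60 ∧
      Subgroup.normalizer (Subgroup.zpowers s : Set S) ≤ H) := by
    intro H hsH hH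
    have h1 := sm_index 5 (by rw [hS]; decide) H hH
    obtain ⟨k, d, hk, hd, hHc, hN, himp⟩ := sm_order s hs hpp hcent H hsH
    by_cases hk1 : k = 1
    · exact Or.inl (himp hk1)
    have hdvd := Subgroup.card_subgroup_dvd_card H
    rw [hS] at h1 hdvd
    have hd4 := Nat.le_of_dvd (by norm_num) hd
    have h2 : 0 < d := Nat.pos_of_dvd_of_pos hd (by norm_num)
    have h3 : k * 5 ≤ k * (5 * d) := Nat.mul_le_mul_left _ (by omega)
    have hk6 : k = 6 ∨ k = 11 := by omega
    have hd12 : d = 1 ∨ d = 2 := by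
      interval_cases d <;> omega
    rcases hk6 with rfl | rfl
    · rcases hd12 with rfl | rfl
      · exfalso
        have h30 : Nat.card H = 30 := by omega
        obtain ⟨K, hK, hsK⟩ := sm_thirty h30 ⟨s, hsH⟩ (by rw [Subgroup.orderOf_mk, hs])
        have hsL : s ∈ K.map H.subtype := ⟨_, hsK, rfl⟩
        have hL : Nat.card (K.map H.subtype) = 15 := by
          rw [Subgroup.card_map_of_injective H.subtype_injective, hK]
        obtain ⟨j, e, hj, he, hLc, -, himp'⟩ := sm_order s hs hpp hcent _ hsL
        have he4 := Nat.le_of_dvd (by norm_num) he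
        rw [hL] at hLc
        have hj1 : j = 1 := by
          interval_cases e <;> omega
        have h5 := Subgroup.card_dvd_of_le (himp' hj1)
        rw [hL, hNc] at h5
        norm_num at h5
      · right
        refine ⟨by omega, ?_⟩
        have h5 : Subgroup.normalizer (Subgroup.zpowers s : Set S) ⊓ H =
            Subgroup.normalizer (Subgroup.zpowers s : Set S) :=
          Subgroup.eq_of_le_of_card_ge inf_le_left (by rw [hN, hNc])
        exact inf_eq_left.mp h5
    · exfalso
      rcases hd12 with rfl | rfl
      · rw [hHc] at hdvd; norm_num at hdvd
      · omega
  intro H hsH hH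
  rcases key H hsH hH with h | ⟨h60, hle⟩
  · exact Or.inl h
  · right
    refine ⟨hle, hH, fun L hL => ?_⟩
    by_contra hLtop
    rcases key L (hL.le hsH) hLtop with h | ⟨h60', -⟩
    · have := Subgroup.card_dvd_of_le (hL.le.trans h)
      rw [h60, hNc] at this
      norm_num at this
    · exact hL.ne (Subgroup.eq_of_le_of_card_ge hL.le (by rw [h60, h60']))

theorem sm_seven (s : alternatingGroup (Fin 7)) (hcyc : (s : Perm (Fin 7)).IsCycle)
    (hcp : (s : Perm (Fin 7)).support.card = 7)
    (hsimple : IsSimpleGroup (alternatingGroup (Fin 7)))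
    (hS : Nat.card (alternatingGroup (Fin 7)) = 2520) (hs : orderOf s = 7)
    (hcent : ∀ x : alternatingGroup (Fin 7), x * s = s * x → x ∈ Subgroup.zpowers s) :
    Subgroup.centralizer {s} <
      Subgroup.normalizer (Subgroup.zpowers s : Set (alternatingGroup (Fin 7))) ∧
      SmallDich s := by
  have : Fact (Nat.Prime 7) := ⟨by norm_num⟩
  have hpp : ¬ 7 ^ 2 ∣ Nat.card (alternatingGroup (Fin 7)) := by rw [hS]; norm_num
  have hNc : Nat.card (Subgroup.normalizer
      (Subgroup.zpowers s : Set (alternatingGroup (Fin 7)))) = 7 * 3 := by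
    obtain ⟨k, d, hk, hd, hH, hN, -⟩ := sm_order s hs hpp hcent ⊤ trivial
    rw [inf_top_eq] at hN
    rw [Subgroup.card_top, hS] at hH
    rw [hN]
    have h1 := Nat.le_of_dvd (by norm_num) hd
    interval_cases d <;> omega
  refine ⟨sm_part_one s hs hcent hNc (by norm_num), ?_⟩
  have key : ∀ H : Subgroup (alternatingGroup (Fin 7)), s ∈ H → H ≠ ⊤ →
      H ≤ Subgroup.normalizer (Subgroup.zpowers s : Set (alternatingGroup (Fin 7))) ∨
      ((Nat.card H = 168 ∨ Nat.card H = 315) ∧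
      Subgroup.normalizer (Subgroup.zpowers s : Set (alternatingGroup (Fin 7))) ≤ H) := by
    intro H hsH hH
    have h1 := sm_index 6 (by rw [hS]; decide) H hH
    obtain ⟨k, d, hk, hd, hHc, hN, himp⟩ := sm_order s hs hpp hcent H hsH
    by_cases hk1 : k = 1
    · exact Or.inl (himp hk1)
    rw [hS] at h1
    have hd6 := Nat.le_of_dvd (by norm_num) hd
    have hd3 : d ∣ 3 := by
      have h5 := Subgroup.card_dvd_of_le (inf_le_left :
        Subgroup.normalizer (Subgroup.zpowers s : Set (alternatingGroup (Fin 7))) ⊓ H ≤ _)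
      rw [hN, hNc] at h5
      exact Nat.dvd_of_mul_dvd_mul_left (by norm_num) h5
    rcases (Nat.dvd_prime Nat.prime_three).mp hd3 with rfl | rfl
    · exfalso
      have h7 := sm_burnside (p := 7) (by simp) hpp s hcyc hcp hs H hsH (by rw [hN])
      omega
    · right
      refine ⟨by omega, ?_⟩
      have h5 : Subgroup.normalizer (Subgroup.zpowers s : Set (alternatingGroup (Fin 7))) ⊓ H =
          Subgroup.normalizer (Subgroup.zpowers s : Set (alternatingGroup (Fin 7))) :=
        Subgroup.eq_of_le_of_card_ge inf_le_left (by rw [hN, hNc])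
      exact inf_eq_left.mp h5
  intro H hsH hH
  rcases key H hsH hH with h | ⟨hc, hle⟩
  · exact Or.inl h
  · right
    refine ⟨hle, hH, fun L hL => ?_⟩
    by_contra hLtop
    rcases key L (hL.le hsH) hLtop with h | ⟨hc', -⟩
    · have := Nat.le_of_dvd (by rw [hNc]; norm_num) (Subgroup.card_dvd_of_le (hL.le.trans h))
      rw [hNc] at this
      omega
    · have hdv := Subgroup.card_dvd_of_le hL.le
      refine hL.ne (Subgroup.eq_of_le_of_card_ge hL.le ?_)
      rcases hc with hc | hc <;> rcases hc' with hc' | hc' <;> rw [hc, hc'] at hdv ⊢ <;>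
        norm_num at hdv

end Final


/-- For `n ≥ 5`, the alternating group `Alt_n` contains an element `s`
such that (i) the normaliser of `⟨s⟩` properly contains the centraliser of `s`, and
(ii) for every finite almost simple group `G` with socle `Alt_n` (given by an embedding
`ι` whose image is normal with trivial centraliser), at most one member of `M'_G(s)` is a
novelty maximal, and no two members of `M'_G(s)` are conjugate in `G`.  Here `M'_G(s)` is
the set of maximal subgroups of `G` containing `ι s` and not containing the socle, and a
novelty maximal is a maximal subgroup meeting the socle in a proper non-maximal subgroup. -/
theorem stmt_13 (n : ℕ) (hn : 5 ≤ n) :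
    ∃ s : ↥(alternatingGroup (Fin n)),
      Subgroup.centralizer {s} < Subgroup.normalizer (Subgroup.zpowers s) ∧
      ∀ (G : Type*) [Group G] [Finite G] (ι : ↥(alternatingGroup (Fin n)) →* G),
        Function.Injective ι → (ι.range).Normal →
        Subgroup.centralizer (ι.range : Set G) = ⊥ →
        ((∀ M₁ M₂ : Subgroup G,
            (IsCoatom M₁ ∧ ι s ∈ M₁ ∧ ¬ ι.range ≤ M₁) →
            (IsCoatom M₂ ∧ ι s ∈ M₂ ∧ ¬ ι.range ≤ M₂) →
            (M₁.comap ι ≠ ⊤ ∧ ¬ IsCoatom (M₁.comap ι)) →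
            (M₂.comap ι ≠ ⊤ ∧ ¬ IsCoatom (M₂.comap ι)) →
            M₁ = M₂) ∧
          (∀ M₁ M₂ : Subgroup G,
            (IsCoatom M₁ ∧ ι s ∈ M₁ ∧ ¬ ι.range ≤ M₁) →
            (IsCoatom M₂ ∧ ι s ∈ M₂ ∧ ¬ ι.range ≤ M₂) →
            (∃ g : G, Subgroup.map (MulAut.conj g).toMonoidHom M₁ = M₂) →
            M₁ = M₂)) := by
  have hsimple : IsSimpleGroup (alternatingGroup (Fin n)) :=
    alternatingGroup.isSimpleGroup (by simpa using hn)
  have hnt : Nontrivial (Fin n) := Fin.nontrivial_iff_two_le.mpr (by omega)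
  have hcard : Nat.card (alternatingGroup (Fin n)) = n.factorial / 2 := by
    rw [nat_card_alternatingGroup, Nat.card_fin]
  by_cases h8 : 8 ≤ n
  · obtain ⟨s, hs1, hs2, hs3⟩ := ge_main (α := Fin n) (by simpa using h8)
    refine ⟨s, hs2, ?_⟩
    intro G _ _ ι hι hN _
    exact red_distinct s hs1 hs3 ι hι hN
  · have h567 : n = 5 ∨ n = 6 ∨ n = 7 := by omega
    rcases h567 with rfl | rfl | rfl
    · have hS : Nat.card (alternatingGroup (Fin 5)) = 60 := by rw [hcard]; rfl
      have hp : Fact (Nat.Prime 5) := ⟨by norm_num⟩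
      obtain ⟨s, -, -, hs, hcent⟩ := sm_exists (α := Fin 5) 5 (by norm_num) (by decide)
        (by simp) (by simp)
      obtain ⟨h1, h2⟩ := sm_five hS s hs hcent
      refine ⟨s, h1, ?_⟩
      intro G _ _ ι hι hN _
      exact red_sylow s hs (by rw [hS]; norm_num) (by rw [hS]; norm_num) h2 ι hι hN
    · have hS : Nat.card (alternatingGroup (Fin 6)) = 360 := by rw [hcard]; rfl
      have hp : Fact (Nat.Prime 5) := ⟨by norm_num⟩
      obtain ⟨s, -, -, hs, hcent⟩ := sm_exists (α := Fin 6) 5 (by norm_num) (by decide)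
        (by simp) (by simp)
      obtain ⟨h1, h2⟩ := sm_six hS s hs hcent
      refine ⟨s, h1, ?_⟩
      intro G _ _ ι hι hN _
      exact red_sylow s hs (by rw [hS]; norm_num) (by rw [hS]; norm_num) h2 ι hι hN
    · have hS : Nat.card (alternatingGroup (Fin 7)) = 2520 := by rw [hcard]; rfl
      have hp : Fact (Nat.Prime 7) := ⟨by norm_num⟩
      obtain ⟨s, hc, hcp, hs, hcent⟩ := sm_exists (α := Fin 7) 7 (by norm_num) (by decide)
        (by simp) (by simp)
      obtain ⟨h1, h2⟩ := sm_seven s hc hcp hsimple hS hs hcent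
      refine ⟨s, h1, ?_⟩
      intro G _ _ ι hι hN _
      exact red_sylow s hs (by rw [hS]; norm_num) (by rw [hS]; norm_num) h2 ι hι hN
end

section
/- Let m ≥ 8 be a multiple of 4 and let q be a prime power. Define k = (q^{(m−2)/2}+1)(q^{(m+2)/2}+1)/(q+1) if m = 8 and q = 2, and k = (q^{(m−2)/2}+1)(q^{(m+2)/2}+1)/(q+1)^2 otherwise. If m+3 is a primitive prime divisor of q^{m+2} − 1, then the symmetric group on 2m+2 points contains no element of order k. -/
theorem aux_cube_le (c : ℕ) : c ^ 3 ≤ 3 ^ c := by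
  rcases Nat.lt_or_ge c 3 with h | h
  · interval_cases c <;> norm_num
  · induction c, h using Nat.le_induction with
    | base => norm_num
    | succ n hn ih =>
      rw [pow_succ 3 n]
      nlinarith [mul_le_mul hn hn (by norm_num) (by omega), mul_le_mul hn (le_refl (n^2)) (by positivity) (by omega)]

theorem aux_prod_cube_le (s : Multiset ℕ) : s.prod ^ 3 ≤ 3 ^ s.sum := by
  induction s using Multiset.induction_on with
  | empty => simp
  | cons a s ih =>
    rw [Multiset.prod_cons, Multiset.sum_cons, mul_pow, pow_add]
    exact Nat.mul_le_mul (aux_cube_le a) ih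

theorem aux_lcm_dvd_prod (s : Multiset ℕ) : s.lcm ∣ s.prod :=
  Multiset.lcm_dvd.2 fun _ hb => Multiset.dvd_prod hb

theorem aux_prime_dvd_lcm {p : ℕ} (hp : p.Prime) (s : Multiset ℕ) (h : p ∣ s.lcm) :
    ∃ c ∈ s, p ∣ c :=
  hp.prime.exists_mem_multiset_dvd (h.trans (aux_lcm_dvd_prod s))

/-- An element of order divisible by the prime `m + 3` has exactly one cycle of that length. -/
theorem aux_cycleType {m : ℕ} (hprime : (m + 3).Prime) (σ : Equiv.Perm (Fin (2 * m + 2)))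
    (h : m + 3 ∣ orderOf σ) :
    ∃ t : Multiset ℕ, σ.cycleType = (m + 3) ::ₘ t ∧ t.sum + 1 ≤ m := by
  rw [← Equiv.Perm.lcm_cycleType] at h
  obtain ⟨c, hc, hd⟩ := aux_prime_dvd_lcm hprime _ h
  obtain ⟨t, ht⟩ := Multiset.exists_cons_of_mem hc
  have hsum : σ.cycleType.sum ≤ 2 * m + 2 := by
    rw [Equiv.Perm.sum_cycleType]
    simpa using Finset.card_le_univ σ.support
  have h2 := Equiv.Perm.two_le_of_mem_cycleType hc
  rw [ht, Multiset.sum_cons] at hsum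
  obtain ⟨e, rfl⟩ := hd
  have he : e = 1 := by
    rcases e with _ | _ | e
    · simp at h2
    · rfl
    · have : (m + 3) * 2 ≤ (m + 3) * (e + 1 + 1) := Nat.mul_le_mul_left _ (by omega)
      omega
  subst he
  exact ⟨t, by simpa using ht, by omega⟩

theorem aux_bound {m : ℕ} (hprime : (m + 3).Prime) (σ : Equiv.Perm (Fin (2 * m + 2)))
    (h : m + 3 ∣ orderOf σ) : 3 * orderOf σ ^ 3 ≤ (m + 3) ^ 3 * 3 ^ m := by
  obtain ⟨t, ht, hs⟩ := aux_cycleType hprime σ h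
  have hpos : 0 < σ.cycleType.prod := by
    apply Nat.pos_of_ne_zero
    intro h0
    have := Equiv.Perm.two_le_of_mem_cycleType (Multiset.prod_eq_zero_iff.1 h0)
    omega
  have h1 : orderOf σ ≤ σ.cycleType.prod := by
    rw [← Equiv.Perm.lcm_cycleType]
    exact Nat.le_of_dvd hpos (aux_lcm_dvd_prod _)
  rw [ht, Multiset.prod_cons] at h1
  calc 3 * orderOf σ ^ 3 ≤ 3 * ((m + 3) * t.prod) ^ 3 := by gcongr
    _ = (m + 3) ^ 3 * (3 * t.prod ^ 3) := by ring
    _ ≤ (m + 3) ^ 3 * (3 * 3 ^ t.sum) := Nat.mul_le_mul_left _ (Nat.mul_le_mul_left _ (aux_prod_cube_le t))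
    _ = (m + 3) ^ 3 * 3 ^ (t.sum + 1) := by ring
    _ ≤ _ := by gcongr; norm_num

theorem aux_exp (m : ℕ) (hm : 16 ≤ m) : 243 * (m + 3) ^ 3 * 3 ^ m < 8 ^ m := by
  induction m, hm using Nat.le_induction with
  | base => norm_num
  | succ n hn ih =>
    have h1 : 3 * (n + 1 + 3) ^ 3 ≤ 8 * (n + 3) ^ 3 := by
      have : 2 * (n + 1 + 3) ≤ 2 * (n + 3) + 2 := by omega
      nlinarith [sq_nonneg n, Nat.zero_le (n^3)]
    calc 243 * (n + 1 + 3) ^ 3 * 3 ^ (n + 1) = 243 * 3 ^ n * (3 * (n + 1 + 3) ^ 3) := by ring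
      _ ≤ 243 * 3 ^ n * (8 * (n + 3) ^ 3) := by gcongr
      _ = 8 * (243 * (n + 3) ^ 3 * 3 ^ n) := by ring
      _ < 8 * 8 ^ n := by omega
      _ = _ := by ring

/-- Let `m ≥ 8` be a multiple of `4` and let `q` be a prime power.  Set
`k = (q^((m-2)/2)+1)(q^((m+2)/2)+1)/(q+1)` if `m = 8` and `q = 2`, and
`k = (q^((m-2)/2)+1)(q^((m+2)/2)+1)/(q+1)^2` otherwise.  If `m + 3` is a primitive prime
divisor of `q ^ (m+2) - 1`, then the symmetric group on `2m + 2` points contains no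
element of order `k`. -/
theorem stmt_16 (m q : ℕ) (hm8 : 8 ≤ m) (hm4 : 4 ∣ m) (hq : IsPrimePow q) (k : ℕ)
    (hk : k = if m = 8 ∧ q = 2
      then (q ^ ((m - 2) / 2) + 1) * (q ^ ((m + 2) / 2) + 1) / (q + 1)
      else (q ^ ((m - 2) / 2) + 1) * (q ^ ((m + 2) / 2) + 1) / (q + 1) ^ 2)
    (hprime : (m + 3).Prime) (hdvd : (m + 3) ∣ q ^ (m + 2) - 1)
    (hppd : ∀ j : ℕ, 1 ≤ j → j < m + 2 → ¬ (m + 3) ∣ q ^ j - 1) :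
    ∀ σ : Equiv.Perm (Fin (2 * m + 2)), orderOf σ ≠ k := by
  intro σ hσ
  have hq2 : 2 ≤ q := hq.two_le
  by_cases hc : m = 8 ∧ q = 2
  · rw [if_pos hc] at hk
    obtain ⟨rfl, rfl⟩ := hc
    norm_num at hk
    obtain ⟨t, ht, hs⟩ := aux_cycleType hprime σ (by rw [hσ, hk]; norm_num)
    have h33 : orderOf σ ∣ 33 := by
      rw [← Equiv.Perm.lcm_cycleType]
      apply Multiset.lcm_dvd.2
      intro c hc
      have hd : c ∣ 99 := by
        have := Equiv.Perm.dvd_of_mem_cycleType hc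
        rwa [hσ, hk] at this
      rw [ht, Multiset.mem_cons] at hc
      rcases hc with rfl | hc
      · norm_num
      · have := Multiset.le_sum_of_mem hc
        have : c ≤ 7 := by omega
        interval_cases c <;> revert hd <;> norm_num
    rw [hσ, hk] at h33
    norm_num at h33
  rw [if_neg hc] at hk
  obtain ⟨n, rfl⟩ := hm4
  have ea : (4 * n - 2) / 2 = 2 * n - 1 := by omega
  have eb : (4 * n + 2) / 2 = 2 * n + 1 := by omega
  rw [ea, eb] at hk
  have oa : Odd (2 * n - 1) := ⟨n - 1, by omega⟩
  have ob : Odd (2 * n + 1) := ⟨n, rfl⟩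
  obtain ⟨A, hA⟩ : q + 1 ∣ q ^ (2 * n - 1) + 1 := by
    simpa using oa.nat_add_dvd_pow_add_pow q 1
  obtain ⟨B, hB⟩ : q + 1 ∣ q ^ (2 * n + 1) + 1 := by
    simpa using ob.nat_add_dvd_pow_add_pow q 1
  have hkAB : k = A * B := by
    rw [hk, hA, hB]
    apply Nat.div_eq_of_eq_mul_left (by positivity)
    ring
  have hrB : 4 * n + 3 ∣ B := by
    have h1 : q ^ (4 * n + 2) - 1 = (q ^ (2 * n + 1) + 1) * (q ^ (2 * n + 1) - 1) := by
      rw [← Nat.sq_sub_sq, ← pow_mul]; congr 2; ring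
      
    rw [h1] at hdvd
    rcases (hprime.dvd_mul).1 hdvd with h | h
    · rw [hB] at h
      rcases (hprime.dvd_mul).1 h with h | h
      · exfalso
        apply hppd 2 (by omega) (by omega)
        have : q ^ 2 - 1 = (q + 1) * (q - 1) := by
          rw [← Nat.sq_sub_sq]
        rw [this]
        exact h.mul_right _
      · exact h
    · exact absurd h (hppd _ (by omega) (by omega))
  have hb := aux_bound hprime σ (by rw [hσ, hkAB]; exact hrB.mul_left _)
  rw [hσ] at hb
  have hlow : q ^ (4 * n) ≤ k * (q + 1) ^ 2 := by
    calc q ^ (4 * n) = q ^ (2 * n - 1) * q ^ (2 * n + 1) := by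
          rw [← pow_add]; congr 1; omega
      _ ≤ (q ^ (2 * n - 1) + 1) * (q ^ (2 * n + 1) + 1) := by gcongr <;> omega
      _ = k * (q + 1) ^ 2 := by rw [hA, hB, hkAB]; ring
  have hlow2 : 4 * q ^ (4 * n - 2) ≤ 9 * k := by
    have e : q ^ (4 * n) = q ^ (4 * n - 2) * q ^ 2 := by
      rw [← pow_add]; congr 1; omega
    have h4 : 4 * (q + 1) ^ 2 ≤ 9 * q ^ 2 := by nlinarith
    have : (4 * q ^ (4 * n - 2)) * q ^ 2 ≤ (9 * k) * q ^ 2 := by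
      calc _ = 4 * q ^ (4 * n) := by rw [e]; ring
        _ ≤ 4 * (k * (q + 1) ^ 2) := by gcongr
        _ = k * (4 * (q + 1) ^ 2) := by ring
        _ ≤ k * (9 * q ^ 2) := by gcongr
        _ = _ := by ring
    exact Nat.le_of_mul_le_mul_right this (by positivity)
  rcases Nat.lt_or_ge n 4 with hn | hn
  · have : n = 2 ∨ n = 3 := by omega
    rcases this with rfl | rfl
    · have hq3 : 3 ≤ q := by
        by_contra hlt
        exact hc ⟨rfl, by omega⟩
      have h6 : 3 ^ 6 ≤ q ^ 6 := Nat.pow_le_pow_left hq3 6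
      norm_num at hlow2 h6 hb
      have hk3 : 324 ≤ k := by omega
      have := Nat.pow_le_pow_left hk3 3
      omega
    · norm_num at hprime
  · have h2 : 2 ^ (4 * n) ≤ 9 * k := by
      calc 2 ^ (4 * n) = 4 * 2 ^ (4 * n - 2) := by
            rw [show (4 : ℕ) = 2 ^ 2 by norm_num, ← pow_add]; congr 1; omega
        _ ≤ 4 * q ^ (4 * n - 2) := by gcongr
        _ ≤ _ := hlow2
    have h3 := Nat.pow_le_pow_left h2 3
    have e8 : (2 ^ (4 * n)) ^ 3 = 8 ^ (4 * n) := by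
      rw [← pow_mul, mul_comm, pow_mul]; norm_num
    rw [e8, mul_pow] at h3
    have h5 := aux_exp (4 * n) (by omega)
    rw [mul_assoc] at h5
    omega
end

section
/- Let G be a finite group satisfying the rank-independence property, and let P be a non-cyclic normal p-subgroup of G for some prime p. Then P is either elementary abelian or a generalized quaternion group (a group with presentation ⟨a, b | a^{2^{n−1}} = 1, b^2 = a^{2^{n−2}}, a^b = a^{−1}⟩ for some n ≥ 3). -/
/-- `minGen G` is `d(G)`: the smallest cardinality of a generating set for `G`. -/
noncomputable def minGen (G : Type*) [Group G] : ℕ :=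
  sInf {n | ∃ S : Finset G, S.card = n ∧ Subgroup.closure (S : Set G) = ⊤}

/-- A non-cyclic group `G` satisfies the *rank-independence property* if for all `x, y ∈ G`
generating a non-cyclic subgroup, there is a generating set for `G` of cardinality `d(G)`
containing both `x` and `y`. -/
def RankIndependenceProperty (G : Type*) [Group G] : Prop :=
  ¬ IsCyclic G ∧
    ∀ x y : G, ¬ IsCyclic ↥(Subgroup.closure ({x, y} : Set G)) →
      ∃ S : Finset G, S.card = minGen G ∧ x ∈ S ∧ y ∈ S ∧
        Subgroup.closure (S : Set G) = ⊤

/-- `p`-th powers lie in every maximal subgroup of a finite `p`-group, and so do commutators. -/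
lemma aux_frattini {Q : Type*} [Group Q] [Finite Q] {p : ℕ} (hp : p.Prime) (hQ : IsPGroup p Q) :
    (∀ x : Q, x ^ p ∈ frattini Q) ∧ ∀ x y : Q, x * y * x⁻¹ * y⁻¹ ∈ frattini Q := by
  have : Fact p.Prime := ⟨hp⟩
  have key : ∀ M : Subgroup Q, IsCoatom M →
      (∀ x : Q, x ^ p ∈ M) ∧ ∀ x y : Q, x * y * x⁻¹ * y⁻¹ ∈ M := by
    intro M hM
    have := hQ.isNilpotent
    have hMn : M.Normal := Subgroup.NormalizerCondition.normal_of_coatom _ Group.normalizerCondition_of_isNilpotent hM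
    obtain ⟨n, hn⟩ := IsPGroup.iff_card.1 hQ
    obtain ⟨k, hk⟩ := IsPGroup.iff_card.1 (hQ.to_subgroup M)
    have hlt : k < n := by
      by_contra hle
      push Not at hle
      apply hM.1
      apply Subgroup.eq_top_of_le_card
      rw [hn, hk]
      exact Nat.pow_le_pow_right hp.pos hle
    obtain ⟨K, hK, hMK⟩ := Sylow.exists_subgroup_card_pow_succ (G := Q) (p := p) (n := k)
      (hn ▸ pow_dvd_pow p hlt) hk
    have hKt : K = ⊤ := by
      apply hM.2
      refine lt_of_le_of_ne hMK ?_
      rintro rfl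
      rw [hk] at hK
      exact absurd (Nat.pow_right_injective hp.two_le hK) (by omega)
    subst hKt
    have hc : Nat.card (Q ⧸ M) = p := by
      have h1 := Subgroup.card_eq_card_quotient_mul_card_subgroup M
      rw [Subgroup.card_top] at hK
      rw [hK, hk, pow_succ, mul_comm] at h1
      exact (Nat.eq_of_mul_eq_mul_right (pow_pos hp.pos k) h1).symm
    have := isCyclic_of_prime_card hc
    refine ⟨fun x => ?_, fun x y => ?_⟩
    · rw [← QuotientGroup.eq_one_iff, QuotientGroup.mk_pow, ← hc, pow_card_eq_one']
    · rw [← QuotientGroup.eq_one_iff]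
      have hcomm : (x : Q ⧸ M) * (y : Q ⧸ M) = y * x := by
        let := IsCyclic.commGroup (α := Q ⧸ M)
        exact mul_comm _ _
      simp only [QuotientGroup.mk_mul, QuotientGroup.mk_inv]
      rw [hcomm]; group
  constructor
  · intro x
    simp only [frattini, Order.radical, Subgroup.mem_iInf]
    exact fun M hM => (key M hM).1 x
  · intro x y
    simp only [frattini, Order.radical, Subgroup.mem_iInf]
    exact fun M hM => (key M hM).2 x y

/-- Elements of the Frattini subgroup of a normal subgroup can be removed from generating sets. -/
lemma aux_nongen {G : Type*} [Group G] [Finite G] (P : Subgroup G) (hPn : P.Normal)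
    (K : Subgroup G) (x : P) (hx : x ∈ frattini P) (hK : K ⊔ Subgroup.zpowers (x : G) = ⊤) :
    K = ⊤ := by
  have := hPn
  set N : Subgroup G := (frattini P).map P.subtype with hN
  have : N.Normal := ConjAct.normal_of_characteristic_of_normal
  have hxN : Subgroup.zpowers (x : G) ≤ N := by
    rw [Subgroup.zpowers_le]
    exact ⟨x, hx, rfl⟩
  have hKN : K ⊔ N = ⊤ := top_unique (hK ▸ sup_le_sup_left hxN K)
  have h1 : K.subgroupOf P = ⊤ := by
    apply frattini_nongenerating
    rw [eq_top_iff]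
    rintro g -
    have hg : (g : G) ∈ K ⊔ N := hKN ▸ Subgroup.mem_top _
    obtain ⟨k, hk, z, ⟨z', hz', hzz⟩, hkz⟩ := Subgroup.mem_sup_of_normal_right.1 hg
    rw [Subgroup.mem_sup_of_normal_right]
    refine ⟨g * z'⁻¹, ?_, z', hz', by group⟩
    rw [Subgroup.mem_subgroupOf]
    have : ((g * z'⁻¹ : P) : G) = k := by
      have hzz' : (z' : G) = z := hzz
      push_cast
      rw [← hkz, hzz']; group
    rw [this]; exact hk
  have h2 : P ≤ K := Subgroup.subgroupOf_eq_top.1 h1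
  have h3 : N ≤ K := le_trans (Subgroup.map_subtype_le _) h2
  rwa [sup_eq_left.2 h3] at hKN

lemma aux_cyc {G : Type*} [Group G] [Finite G] (h : RankIndependenceProperty G)
    (P : Subgroup G) (hPn : P.Normal) (x : P) (hx : x ∈ frattini P) (y : G) :
    IsCyclic (Subgroup.closure ({(x : G), y} : Set G)) := by
  classical
  by_contra hc
  obtain ⟨S, hS, hxS, -, hgen⟩ := h.2 _ _ hc
  have h1 : Subgroup.closure ((S.erase (x : G) : Finset G) : Set G) = ⊤ := by
    apply aux_nongen P hPn _ x hx
    rw [eq_top_iff, ← hgen, Subgroup.closure_le]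
    intro s hs
    by_cases hsx : s = x
    · subst hsx
      exact Subgroup.mem_sup_right (Subgroup.mem_zpowers _)
    · apply Subgroup.mem_sup_left
      apply Subgroup.subset_closure
      simp only [Finset.coe_erase]
      exact ⟨hs, hsx⟩
  have h2 : minGen G ≤ (S.erase (x : G)).card := Nat.sInf_le ⟨_, rfl, h1⟩
  have h3 := Finset.card_erase_lt_of_mem hxS
  omega

lemma aux_coprime_mem {Q : Type*} [Group Q] {p : ℕ} (hp : p.Prime) (hQ : IsPGroup p Q)
    (g : Q) (m : ℤ) (hm : ¬ (p : ℤ) ∣ m) : g ∈ Subgroup.zpowers (g ^ m) := by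
  obtain ⟨n, hn⟩ := hQ g
  have : IsCoprime m ((p : ℤ) ^ n) :=
    (IsCoprime.pow_left ((Nat.prime_iff_prime_int.1 hp).irreducible.coprime_iff_not_dvd.2 hm)).symm
  obtain ⟨a, b, hab⟩ := this
  refine ⟨a, ?_⟩
  have hn' : g ^ ((p : ℤ) ^ n) = 1 := by exact_mod_cast hn
  calc (g ^ m) ^ a = g ^ (a * m) := by rw [← zpow_mul, mul_comm]
    _ = g ^ (a * m + b * (p : ℤ) ^ n) := by
      rw [zpow_add, mul_comm b, zpow_mul g ((p : ℤ) ^ n), hn', one_zpow, mul_one]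
    _ = g := by rw [hab, zpow_one]

/-- In a cyclic `p`-group, of two elements one is a power of the other. -/
lemma aux_chain {Q : Type*} [Group Q] {p : ℕ} (hp : p.Prime) (hQ : IsPGroup p Q)
    (f y : Q) (hc : ∃ w : Q, f ∈ Subgroup.zpowers w ∧ y ∈ Subgroup.zpowers w) :
    y ∈ Subgroup.zpowers f ∨ ∃ k : ℤ, f = y ^ k := by
  obtain ⟨w, ⟨i, hi⟩, ⟨j, hj⟩⟩ := hc
  have hcop := aux_coprime_mem hp hQ
  simp only at hi hj
  by_cases hi0 : i = 0
  · right; exact ⟨0, by simp [← hi, hi0]⟩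
  by_cases hj0 : j = 0
  · left; exact ⟨0, by simp [← hj, hj0]⟩
  have hfin : ∀ m : ℤ, m ≠ 0 → FiniteMultiplicity (p : ℤ) m := fun m hm =>
    Int.finiteMultiplicity_iff.2 ⟨by simpa using hp.ne_one, hm⟩
  obtain ⟨i', hi', hpi⟩ := (hfin i hi0).exists_eq_pow_mul_and_not_dvd
  obtain ⟨j', hj', hpj⟩ := (hfin j hj0).exists_eq_pow_mul_and_not_dvd
  generalize multiplicity (p : ℤ) i = s at *
  generalize multiplicity (p : ℤ) j = t at *
  rcases le_total s t with hst | hst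
  · left
    have h1 := hcop (w ^ ((p : ℤ) ^ s)) i' hpi
    rw [← zpow_mul, ← hi', hi] at h1
    obtain ⟨d, rfl⟩ := Nat.exists_eq_add_of_le hst
    have : y = (w ^ ((p : ℤ) ^ s)) ^ ((p : ℤ) ^ d * j') := by
      rw [← zpow_mul, ← mul_assoc, ← pow_add, ← hj', hj]
    rw [this]
    exact Subgroup.zpow_mem _ h1 _
  · right
    have h1 := hcop (w ^ ((p : ℤ) ^ t)) j' hpj
    rw [← zpow_mul, ← hj', hj] at h1
    obtain ⟨d, rfl⟩ := Nat.exists_eq_add_of_le hst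
    have : f = (w ^ ((p : ℤ) ^ t)) ^ ((p : ℤ) ^ d * i') := by
      rw [← zpow_mul, ← mul_assoc, ← pow_add, ← hi', hi]
    have h2 : f ∈ Subgroup.zpowers y := by
      rw [this]; exact Subgroup.zpow_mem _ h1 _
    obtain ⟨k, hk⟩ := h2
    exact ⟨k, hk.symm⟩

/-- Powers of a product when the commutator `d` is central. -/
lemma aux_pow {Q : Type*} [Group Q] (u y d : Q) (hd : ∀ g, d * g = g * d)
    (hyu : y * u = u * y * d) (n : ℕ) :
    y ^ n * u = u * y ^ n * d ^ n ∧ (u * y) ^ n = u ^ n * y ^ n * d ^ (n.choose 2) := by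
  have hdn : ∀ (m : ℕ) g, d ^ m * g = g * d ^ m := fun m g =>
    (Commute.pow_left (hd g : Commute d g) m).eq
  have h1 : ∀ n : ℕ, y ^ n * u = u * y ^ n * d ^ n := by
    intro n
    induction n with
    | zero => simp
    | succ n ih =>
      calc y ^ (n + 1) * u = y ^ n * (y * u) := by rw [pow_succ, mul_assoc]
        _ = (y ^ n * u) * y * d := by rw [hyu]; group
        _ = u * y ^ n * (d ^ n * y) * d := by rw [ih]; group
        _ = u * y ^ (n + 1) * d ^ (n + 1) := by
          rw [hdn, pow_succ, pow_succ]; simp only [mul_assoc]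
  refine ⟨h1 n, ?_⟩
  induction n with
  | zero => simp
  | succ n ih =>
    calc (u * y) ^ (n + 1) = u ^ n * y ^ n * (d ^ (n.choose 2) * (u * y)) := by
          rw [pow_succ, ih]; simp only [mul_assoc]
      _ = u ^ n * (y ^ n * u) * y * d ^ (n.choose 2) := by rw [hdn]; simp only [mul_assoc]
      _ = u ^ n * u * y ^ n * (d ^ n * y) * d ^ (n.choose 2) := by
          rw [h1]; simp only [mul_assoc]
      _ = u ^ (n + 1) * y ^ (n + 1) * d ^ ((n + 1).choose 2) := by
          rw [hdn, Nat.choose_succ_succ' n 1, Nat.choose_one_right, pow_add d, pow_succ, pow_succ]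
          simp only [mul_assoc]

/-- Recognition of the quaternion group of order eight. -/
lemma aux_quat {Q : Type*} [Group Q] (x y : Q) (hx4 : x ^ 4 = 1) (hx2 : x ^ 2 ≠ 1)
    (hyx : y ^ 2 = x ^ 2) (hxy : x * y = y * x⁻¹) (hy : y ∉ Subgroup.zpowers x)
    (hall : ∀ z : Q, z ∈ Subgroup.zpowers x ∨ y⁻¹ * z ∈ Subgroup.zpowers x) :
    Nonempty (Q ≃* QuaternionGroup 2) := by
  let E : ZMod (2 * 2) → Q := fun i => x ^ i.val
  have hE : ∀ i j, E i * E j = E (i + j) := by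
    intro i j
    simp only [E]
    rw [← pow_add, ZMod.val_add, pow_eq_pow_mod (i.val + j.val) hx4]
  have hE0 : E 0 = 1 := by simp [E]
  have hEn : ∀ i, E (-i) = (E i)⁻¹ := by
    intro i
    rw [eq_inv_iff_mul_eq_one, hE]; simp [hE0]
  have hEy : ∀ i, E i * y = y * E (-i) := by
    intro i
    rw [hEn]
    simp only [E]
    have : SemiconjBy y x⁻¹ x := hxy.symm
    have := this.pow_right i.val
    rw [inv_pow] at this
    exact this.symm
  have hE2 : E 2 = y * y := by
    have h3 : E 2 = x ^ 2 := rfl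
    rw [h3, ← hyx, sq]
  let f : QuaternionGroup 2 → Q := fun q => match q with
    | .a i => E i
    | .xa i => y * E i
  let F : QuaternionGroup 2 →* Q := MonoidHom.mk' f (by
    rintro (i | i) (j | j)
    · simp only [QuaternionGroup.a_mul_a, f, hE]
    · simp only [QuaternionGroup.a_mul_xa, f]
      rw [← mul_assoc, hEy, mul_assoc, hE, neg_add_eq_sub]
    · simp only [QuaternionGroup.xa_mul_a, f]
      rw [mul_assoc, hE]
    · simp only [QuaternionGroup.xa_mul_xa, f]
      calc E ((2 : ℕ) + j - i) = E 2 * (E (-i) * E j) := by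
            rw [hE, hE]; congr 1; push_cast; ring
        _ = y * (E i * y) * E j := by rw [hE2, hEy]; simp only [mul_assoc]
        _ = y * E i * (y * E j) := by simp only [mul_assoc])
  have hz : ∀ g ∈ Subgroup.zpowers x, ∃ i, E i = g := by
    rintro g ⟨k, rfl⟩
    refine ⟨(k : ZMod (2 * 2)), ?_⟩
    simp only [E]
    rw [← zpow_natCast, ZMod.val_intCast]
    have hx4' : x ^ ((2 * 2 : ℕ) : ℤ) = 1 := by
      rw [zpow_natCast]; exact hx4
    conv_rhs => rw [← Int.emod_add_mul_ediv k ((2 * 2 : ℕ) : ℤ), zpow_add, zpow_mul, hx4', one_zpow,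
      mul_one]
  have hsurj : Function.Surjective F := by
    intro z
    rcases hall z with h | h
    · obtain ⟨i, hi⟩ := hz _ h
      exact ⟨.a i, hi⟩
    · obtain ⟨i, hi⟩ := hz _ h
      refine ⟨.xa i, ?_⟩
      change y * E i = z
      rw [hi]; group
  have hord : orderOf x = 2 * 2 := by
    have := orderOf_eq_prime_pow (x := x) (p := 2) (n := 1) (by simpa using hx2) (by simpa using hx4)
    simpa using this
  have hinj : Function.Injective F := by
    rw [injective_iff_map_eq_one]
    rintro (i | i) hi
    · change x ^ i.val = 1 at hi
      have h1 := orderOf_dvd_of_pow_eq_one hi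
      rw [hord] at h1
      have h2 : i.val = 0 := Nat.eq_zero_of_dvd_of_lt h1 (ZMod.val_lt i)
      rw [ZMod.val_eq_zero] at h2
      rw [h2]; rfl
    · exfalso
      change y * x ^ i.val = 1 at hi
      apply hy
      rw [eq_inv_of_mul_eq_one_left hi]
      exact Subgroup.inv_mem _ (Subgroup.pow_mem _ (Subgroup.mem_zpowers x) _)
  exact ⟨(MulEquiv.ofBijective F ⟨hinj, hsurj⟩).symm⟩

lemma aux_main {Q : Type*} [Group Q] {p : ℕ} (hp : p.Prime) (hQ : IsPGroup p Q)
    (F : Subgroup Q) (hF0 : F ≠ ⊥) (hF1 : F ≠ ⊤) (hpow : ∀ x : Q, x ^ p ∈ F)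
    (hcom : ∀ x y : Q, x * y * x⁻¹ * y⁻¹ ∈ F)
    (hcyc : ∀ f ∈ F, ∀ y, ∃ w : Q, f ∈ Subgroup.zpowers w ∧ y ∈ Subgroup.zpowers w)
    (hnc : ¬ IsCyclic Q) : Nonempty (Q ≃* QuaternionGroup 2) := by
  have hcent : ∀ f ∈ F, ∀ y, f * y = y * f := by
    intro f hf y
    obtain ⟨w, ⟨i, rfl⟩, ⟨j, rfl⟩⟩ := hcyc f hf y
    exact (Commute.zpow_zpow_self w i j).eq
  have hFz : ∀ y, y ∉ F → F = Subgroup.zpowers (y ^ p) := by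
    intro y hy
    apply le_antisymm
    · intro f hf
      rcases aux_chain hp hQ f y (hcyc f hf y) with h | ⟨k, hk⟩
      · exact absurd ((Subgroup.zpowers_le.2 hf) h) hy
      · by_cases hpk : (p : ℤ) ∣ k
        · obtain ⟨m, rfl⟩ := hpk
          exact ⟨m, by simp [hk, zpow_mul]⟩
        · exfalso
          have := aux_coprime_mem hp hQ y k hpk
          rw [← hk] at this
          exact hy ((Subgroup.zpowers_le.2 hf) this)
    · exact Subgroup.zpowers_le.2 (hpow y)
  obtain ⟨x, hx⟩ : ∃ x, x ∉ F := by
    by_contra hcon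
    push Not at hcon
    exact hF1 ((Subgroup.eq_top_iff' F).2 hcon)
  obtain ⟨y, hy⟩ : ∃ y, y ∉ Subgroup.zpowers x := by
    by_contra hcon
    push Not at hcon
    exact hnc ⟨x, hcon⟩
  have hFx : F ≤ Subgroup.zpowers x := by
    rw [hFz x hx]
    exact Subgroup.zpowers_le.2 (Subgroup.pow_mem _ (Subgroup.mem_zpowers x) _)
  have hyF : y ∉ F := fun hh => hy (hFx hh)
  obtain ⟨k, hk⟩ : y ^ p ∈ Subgroup.zpowers (x ^ p) := hFz x hx ▸ hpow y
  simp only at hk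
  set u := x ^ (-k) with hu
  have huy : u ^ p * y ^ p = 1 := by
    rw [← hk, hu, ← zpow_natCast, ← zpow_natCast, ← zpow_mul, ← zpow_mul, ← zpow_add]
    simp [mul_comm]
  have huz : u ∈ Subgroup.zpowers x := ⟨-k, rfl⟩
  have hw : u * y ∉ F := fun hh => hy (by
    have := Subgroup.mul_mem _ (Subgroup.inv_mem _ huz) (hFx hh)
    simpa using this)
  set d := y⁻¹ * u⁻¹ * y * u with hd
  have hdF : d ∈ F := by simpa using hcom y⁻¹ u⁻¹
  have hdc := hcent d hdF
  have hyu : y * u = u * y * d := by rw [hd]; group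
  obtain ⟨h1, h2⟩ := aux_pow u y d hdc hyu p
  have hdp : d ^ p = 1 := by
    rw [hcent _ (hpow y) u] at h1
    simpa using h1
  rw [huy, one_mul] at h2
  have hFw := hFz _ hw
  rw [h2] at hFw
  by_cases hp2 : p = 2
  swap
  · exfalso
    have : p ∣ p.choose 2 := hp.dvd_choose_self (by norm_num) (lt_of_le_of_ne hp.two_le (Ne.symm hp2))
    obtain ⟨m, hm⟩ := this
    rw [hm, pow_mul, hdp, one_pow, Subgroup.zpowers_one_eq_bot] at hFw
    exact hF0 hFw
  subst hp2
  rw [Nat.choose_self, pow_one] at hFw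
  have hd1 : d ≠ 1 := by
    intro hh
    rw [hh, Subgroup.zpowers_one_eq_bot] at hFw
    exact hF0 hFw
  have hF2 : ∀ f ∈ F, f = 1 ∨ f = d := by
    intro f hf
    rw [hFw] at hf
    obtain ⟨m, rfl⟩ := hf
    rcases Int.even_or_odd' m with ⟨c, rfl | rfl⟩
    · left
      simp only [zpow_mul]
      have : d ^ (2 : ℤ) = 1 := by exact_mod_cast hdp
      rw [this, one_zpow]
    · right
      simp only [zpow_add, zpow_mul]
      have : d ^ (2 : ℤ) = 1 := by exact_mod_cast hdp
      rw [this, one_zpow, zpow_one, one_mul]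
  have hsq : ∀ g, g ∉ F → g * g = d := by
    intro g hg
    rcases hF2 _ (hpow g) with hh | hh
    · exfalso
      have := hFz g hg
      rw [hh, Subgroup.zpowers_one_eq_bot] at this
      exact hF0 this
    · rw [← sq]; exact hh
  have hdd : d * d = 1 := by rw [← sq]; exact hdp
  have hinv : ∀ g, g ∉ F → g⁻¹ = g * d := by
    intro g hg
    rw [inv_eq_iff_mul_eq_one, ← mul_assoc, hsq g hg, hdd]
  have hanti : ∀ g h, g ∉ F → h ∉ F → g * h ∉ F → g * h = d * (h * g) := by
    intro g h hg hh hgh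
    have e1 := hsq _ hgh
    have e2 : g * h = d * (g * h)⁻¹ := by rw [← e1]; group
    rw [e2, mul_inv_rev, hinv g hg, hinv h hh]
    have e3 : h * d * (g * d) = h * g := by
      rw [mul_assoc, ← mul_assoc d g d, hdc g, mul_assoc g d d, hdd, mul_one]
    rw [e3]
  have hxyF : x * y ∉ F := fun hh => hy (by
    have := Subgroup.mul_mem _ (Subgroup.inv_mem _ (Subgroup.mem_zpowers x)) (hFx hh)
    simpa using this)
  have hxy := hanti x y hx hyF hxyF
  have hdz : d ∈ Subgroup.zpowers x := hFx hdF
  have hxz := Subgroup.mem_zpowers x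
  refine aux_quat x y ?_ ?_ ?_ ?_ hy ?_
  · rw [show 4 = 2 * 2 from rfl, pow_mul, sq x, hsq x hx, hdp]
  · rw [sq, hsq x hx]; exact hd1
  · rw [sq, sq, hsq x hx, hsq y hyF]
  · rw [hinv x hx, ← mul_assoc, ← hdc]; exact hxy
  · intro z
    by_contra hcon
    push Not at hcon
    obtain ⟨hz1, hz2⟩ := hcon
    have hzF : z ∉ F := fun hh => hz1 (hFx hh)
    have hxzF : x * z ∉ F := fun hh => hz1 (by
      have := Subgroup.mul_mem _ (Subgroup.inv_mem _ hxz) (hFx hh)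
      simpa using this)
    have hyzz : y * z ∉ Subgroup.zpowers x := fun hh => hz2 (by
      rw [hinv y hyF, ← hdc, mul_assoc]
      exact Subgroup.mul_mem _ hdz hh)
    have hyzF : y * z ∉ F := fun hh => hyzz (hFx hh)
    have hxyzF : x * (y * z) ∉ F := fun hh => hyzz (by
      have := Subgroup.mul_mem _ (Subgroup.inv_mem _ hxz) (hFx hh)
      simpa using this)
    have e1 := hanti x (y * z) hx hyzF hxyzF
    have e2 := hanti x z hx hzF hxzF
    have e4 : x * (y * z) = y * z * x := by
      calc x * (y * z) = (x * y) * z := by group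
        _ = d * y * (x * z) := by rw [hxy]; simp only [mul_assoc]
        _ = d * (y * d) * (z * x) := by rw [e2]; simp only [mul_assoc]
        _ = y * z * x := by
          rw [← hdc y, ← mul_assoc d d y, hdd, one_mul]; simp only [mul_assoc]
    rw [e4] at e1
    exact hd1 (right_eq_mul.1 e1)

/-- Let `G` be a finite group satisfying the rank-independence property
and let `P` be a non-cyclic normal `p`-subgroup of `G`.  Then `P` is either elementary
abelian, or a generalized quaternion group of order `2 ^ n` for some `n ≥ 3`
(`QuaternionGroup (2 ^ (n - 2))` is the group
`⟨a, b ∣ a ^ 2 ^ (n - 1) = 1, b ^ 2 = a ^ 2 ^ (n - 2), a ^ b = a⁻¹⟩`). -/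
theorem stmt_18 (G : Type*) [Group G] [Finite G] (h : RankIndependenceProperty G)
    (p : ℕ) (hp : p.Prime) (P : Subgroup G) (hPn : P.Normal) (hPp : IsPGroup p ↥P)
    (hPnc : ¬ IsCyclic ↥P) :
    ((∀ x ∈ P, ∀ y ∈ P, x * y = y * x) ∧ ∀ x ∈ P, x ^ p = 1) ∨
      ∃ n : ℕ, 3 ≤ n ∧ Nonempty (↥P ≃* QuaternionGroup (2 ^ (n - 2))) := by
  have hcyc := aux_cyc h P hPn
  obtain ⟨hpow, hcom⟩ := aux_frattini hp hPp
  by_cases hF0 : frattini P = ⊥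
  · left
    refine ⟨fun x hx y hy => ?_, fun x hx => ?_⟩
    · have h1 := hcom ⟨x, hx⟩ ⟨y, hy⟩
      rw [hF0, Subgroup.mem_bot] at h1
      have h2 : x * y * x⁻¹ * y⁻¹ = 1 := congrArg Subtype.val h1
      rw [mul_inv_eq_one, mul_inv_eq_iff_eq_mul] at h2
      exact h2
    · have h1 := hpow ⟨x, hx⟩
      rw [hF0, Subgroup.mem_bot] at h1
      exact congrArg Subtype.val h1
  · right
    refine ⟨3, le_rfl, ?_⟩
    have hF1 : frattini P ≠ ⊤ := by
      intro ht
      have hb : (⊥ : Subgroup P) = ⊤ := frattini_nongenerating (by simp [ht])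
      apply hPnc
      refine ⟨1, fun g => ?_⟩
      have hg : g ∈ (⊥ : Subgroup P) := hb ▸ Subgroup.mem_top g
      exact ⟨0, by simpa using (Subgroup.mem_bot.1 hg).symm⟩
    refine aux_main hp hPp (frattini P) hF0 hF1 hpow hcom ?_ hPnc
    intro f hf y
    obtain ⟨⟨w, hw⟩, hgen⟩ := hcyc f hf y
    have hle : Subgroup.closure ({(f : G), (y : G)} : Set G) ≤ P := by
      rw [Subgroup.closure_le]
      rintro g (rfl | rfl)
      · exact f.2
      · exact y.2
    refine ⟨⟨w, hle hw⟩, ?_, ?_⟩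
    · obtain ⟨n, hn⟩ := hgen ⟨f, Subgroup.subset_closure (by simp)⟩
      have h3 : w ^ n = (f : G) := congrArg Subtype.val hn
      exact ⟨n, Subtype.ext h3⟩
    · obtain ⟨n, hn⟩ := hgen ⟨y, Subgroup.subset_closure (by simp)⟩
      have h3 : w ^ n = (y : G) := congrArg Subtype.val hn
      exact ⟨n, Subtype.ext h3⟩
end

section
/- Let G be a non-cyclic finite nilpotent group. Then G satisfies the rank-independence property if and only if one of the following holds: (i) G is isomorphic to C_p × C_p for some prime p; (ii) G is isomorphic to the quaternion group Q_8 of order 8; (iii) G is isomorphic to P × C, where P is an elementary abelian Sylow p-subgroup of G with d(P) ≥ 3 for some prime p, and C is a cyclic group of order coprime to p (possibly trivial). -/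
namespace RIP
open Subgroup

lemma minGen_le {G : Type*} [Group G] (S : Finset G) (h : closure (S : Set G) = ⊤) :
    minGen G ≤ S.card := Nat.sInf_le ⟨S, rfl, h⟩

lemma exists_minGen (G : Type*) [Group G] [Finite G] :
    ∃ S : Finset G, S.card = minGen G ∧ closure (S : Set G) = ⊤ := by
  have : Fintype G := Fintype.ofFinite G
  exact Nat.sInf_mem (s := {n | ∃ S : Finset G, S.card = n ∧ closure (S : Set G) = ⊤})
    ⟨_, Finset.univ, rfl, by simp⟩

lemma minGen_le_of_surj {G H : Type*} [Group G] [Group H] [Finite G] (f : G →* H)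
    (hf : Function.Surjective f) : minGen H ≤ minGen G := by
  classical
  obtain ⟨S, hS, hc⟩ := exists_minGen G
  rw [← hS]
  refine (minGen_le (S.image f) ?_).trans Finset.card_image_le
  rw [Finset.coe_image, ← MonoidHom.map_closure, hc, ← MonoidHom.range_eq_map,
    MonoidHom.range_eq_top.mpr hf]

lemma minGen_congr {G H : Type*} [Group G] [Group H] [Finite G] (e : G ≃* H) :
    minGen G = minGen H := by
  have : Finite H := Finite.of_equiv G e.toEquiv
  exact le_antisymm (minGen_le_of_surj e.symm.toMonoidHom e.symm.surjective)
    (minGen_le_of_surj e.toMonoidHom e.surjective)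

lemma two_le_minGen {G : Type*} [Group G] [Finite G] (h : ¬ IsCyclic G) : 2 ≤ minGen G := by
  by_contra hlt
  apply h
  obtain ⟨S, hS, hc⟩ := exists_minGen G
  have h1 : S.card ≤ 1 := by omega
  obtain ⟨x, hx⟩ := Finset.card_le_one_iff_subset_singleton.mp h1
  refine ⟨x, fun y => ?_⟩
  change y ∈ zpowers x
  rw [zpowers_eq_closure]
  have : y ∈ closure (S : Set G) := by rw [hc]; trivial
  exact closure_mono (by exact_mod_cast hx) this

lemma minGen_le_one {G : Type*} [Group G] [h : IsCyclic G] : minGen G ≤ 1 := by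
  obtain ⟨g, hg⟩ := h
  refine (minGen_le {g} ?_).trans (by simp)
  rw [Finset.coe_singleton, ← zpowers_eq_closure, eq_top_iff]
  exact fun y _ => hg y

/-- Set-theoretic reformulation of the independence property. -/
def IP (G : Type*) [Group G] : Prop :=
  ∀ x y : G, ¬ IsCyclic (closure ({x, y} : Set G)) →
    ∃ T : Finset G, T.card + 2 ≤ minGen G ∧ closure ({x, y} ∪ (T : Set G)) = ⊤

lemma rip_iff {G : Type*} [Group G] [Finite G] (hnc : ¬ IsCyclic G) :
    RankIndependenceProperty G ↔ IP G := by
  classical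
  constructor
  · rintro ⟨-, h⟩ x y hxy
    obtain ⟨S, hS, hx, hy, hc⟩ := h x y hxy
    have hne : x ≠ y := by
      rintro rfl
      apply hxy
      rw [Set.pair_eq_singleton, ← zpowers_eq_closure]
      infer_instance
    have hsub : ({x, y} : Finset G) ⊆ S := by
      intro z hz
      simp only [Finset.mem_insert, Finset.mem_singleton] at hz
      rcases hz with rfl | rfl <;> assumption
    refine ⟨S \ {x, y}, ?_, ?_⟩
    · have := Finset.card_sdiff_add_card_eq_card hsub
      rw [Finset.card_pair hne] at this
      omega
    · rw [← hc]
      congr 1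
      have := Finset.union_sdiff_of_subset hsub
      conv_rhs => rw [← this]
      push_cast
      rfl
  · intro h
    refine ⟨hnc, fun x y hxy => ?_⟩
    obtain ⟨T, hT, hc⟩ := h x y hxy
    have hc' : closure ((({x, y} ∪ T : Finset G)) : Set G) = ⊤ := by
      push_cast; exact hc
    refine ⟨{x, y} ∪ T, le_antisymm ?_ (minGen_le _ hc'), by simp, by simp, hc'⟩
    have h1 := Finset.card_union_le {x, y} T
    have h2 : ({x, y} : Finset G).card ≤ 2 := Finset.card_le_two
    omega

lemma isCyclic_closure_image {G H : Type*} [Group G] [Group H] (f : G →* H)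
    (hf : Function.Injective f) (x y : G) :
    IsCyclic (closure ({f x, f y} : Set H)) ↔ IsCyclic (closure ({x, y} : Set G)) := by
  have : closure ({f x, f y} : Set H) = (closure ({x, y} : Set G)).map f := by
    rw [MonoidHom.map_closure, Set.image_pair]
  rw [this]
  exact (equivMapOfInjective _ f hf).isCyclic.symm

lemma IP_of_equiv {G H : Type*} [Group G] [Group H] [Finite G] (e : G ≃* H) (h : IP G) : IP H := by
  classical
  intro x y hxy
  rw [← isCyclic_closure_image e.symm.toMonoidHom e.symm.injective] at hxy
  obtain ⟨T, hT, hc⟩ := h _ _ hxy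
  refine ⟨T.image e, ?_, ?_⟩
  · rw [← minGen_congr e]
    have := Finset.card_image_le (s := T) (f := e)
    omega
  · have := congrArg (Subgroup.map e.toMonoidHom) hc
    rw [MonoidHom.map_closure, Set.image_union, Set.image_pair, ← MonoidHom.range_eq_map,
      MonoidHom.range_eq_top.mpr e.surjective] at this
    simpa using this

lemma exists_pair {G : Type*} [Group G] [Finite G] (hnc : ¬ IsCyclic G) :
    ∃ x y : G, ¬ IsCyclic (closure ({x, y} : Set G)) := by
  by_contra! h
  apply hnc
  obtain ⟨x, hx⟩ := Finite.exists_max (fun x : G => orderOf x)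
  refine ⟨x, fun y => ?_⟩
  change y ∈ zpowers x
  obtain ⟨g, hg⟩ := isCyclic_iff_exists_zpowers_eq_top.mp (h x y)
  have hg' : zpowers (g : G) = closure {x, y} := by
    have := congrArg (Subgroup.map (closure {x, y}).subtype) hg
    rwa [MonoidHom.map_zpowers, ← MonoidHom.range_eq_map, range_subtype] at this
  have hxg : zpowers x ≤ zpowers (g : G) := by
    rw [hg', zpowers_le]; exact subset_closure (by simp)
  have := eq_of_le_of_card_ge hxg (by simpa using hx g)
  rw [this, hg']; exact subset_closure (by simp)

lemma pow_modOne {X : Type*} [Group X] [Finite X] (x : X) (n : ℕ)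
    (hn : n ≡ 1 [MOD Nat.card X]) : x ^ n = x := by
  have := (pow_eq_pow_iff_modEq (x := x) (n := n) (m := 1)).mpr
    (hn.of_dvd (orderOf_dvd_natCard x))
  simpa using this

lemma pow_modZero {X : Type*} [Group X] [Finite X] (x : X) (n : ℕ)
    (hn : n ≡ 0 [MOD Nat.card X]) : x ^ n = 1 := by
  have := (pow_eq_pow_iff_modEq (x := x) (n := n) (m := 0)).mpr
    (hn.of_dvd (orderOf_dvd_natCard x))
  simpa using this

lemma exists_family {X : Type*} [Group X] [Finite X] (k : ℕ) (hX : minGen X ≤ k) :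
    ∃ f : Fin k → X, closure (Set.range f) = ⊤ := by
  classical
  obtain ⟨S, hS, hc⟩ := exists_minGen X
  refine ⟨fun i => if h : i.1 < S.card then (S.equivFin.symm ⟨i.1, h⟩ : X) else 1, ?_⟩
  rw [eq_top_iff, ← hc]
  apply Subgroup.closure_mono
  intro x hx
  have hlt := (S.equivFin ⟨x, hx⟩).2
  exact ⟨⟨S.equivFin ⟨x, hx⟩, by omega⟩, by simp⟩

/-- coprime products -/
lemma prod_top {A B : Type*} [Group A] [Group B] [Finite A] [Finite B]
    (hco : (Nat.card A).Coprime (Nat.card B)) (H : Subgroup (A × B))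
    (h1 : H.map (MonoidHom.fst A B) = ⊤) (h2 : H.map (MonoidHom.snd A B) = ⊤) : H = ⊤ := by
  obtain ⟨k, hkA, hkB⟩ := Nat.chineseRemainder hco 1 0
  obtain ⟨l, hlA, hlB⟩ := Nat.chineseRemainder hco 0 1
  rw [eq_top_iff]
  rintro ⟨a, b⟩ -
  have ha : a ∈ H.map (MonoidHom.fst A B) := by rw [h1]; trivial
  have hb : b ∈ H.map (MonoidHom.snd A B) := by rw [h2]; trivial
  obtain ⟨⟨a, b'⟩, ha, rfl⟩ := ha
  obtain ⟨⟨a', b⟩, hb, rfl⟩ := hb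
  have := H.mul_mem (H.pow_mem ha k) (H.pow_mem hb l)
  simpa [pow_modOne a k hkA, pow_modZero a' l hlA, pow_modZero b' k hkB, pow_modOne b l hlB] using this

lemma minGen_prod_le {A B : Type*} [Group A] [Group B] [Finite A] [Finite B]
    (hco : (Nat.card A).Coprime (Nat.card B)) (k : ℕ) (hA : minGen A ≤ k) (hB : minGen B ≤ k) :
    minGen (A × B) ≤ k := by
  classical
  obtain ⟨f, hf⟩ := exists_family k hA
  obtain ⟨g, hg⟩ := exists_family k hB
  refine (minGen_le (Finset.univ.image fun i => (f i, g i)) ?_).trans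
    (Finset.card_image_le.trans (by simp))
  apply prod_top hco
  · rw [MonoidHom.map_closure, ← hf]
    congr 1; ext x; simp
  · rw [MonoidHom.map_closure, ← hg]
    congr 1; ext x; simp

lemma forward_prod {A B : Type*} [Group A] [Group B] [Finite A] [Finite B]
    (hco : (Nat.card A).Coprime (Nat.card B)) (hA : ¬ IsCyclic A) (h : IP (A × B)) :
    IsCyclic B ∧ IP A ∧ minGen A = minGen (A × B) ∧ (minGen A = 2 → Subsingleton B) := by
  classical
  have s1 : minGen A ≤ minGen (A × B) := minGen_le_of_surj (MonoidHom.fst A B) Prod.fst_surjective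
  have hA2 := two_le_minGen hA
  have stepA : ∀ x y : A, ¬ IsCyclic (closure ({x, y} : Set A)) → ∃ T : Finset (A × B),
      T.card + 2 ≤ minGen (A × B) ∧ closure ({x, y} ∪ (T.image Prod.fst : Set A)) = ⊤ ∧
      closure (T.image Prod.snd : Set B) = ⊤ := by
    intro x y hxy
    rw [← isCyclic_closure_image (MonoidHom.inl A B) (fun a b hab => by simpa using hab)] at hxy
    obtain ⟨T, hT, hc⟩ := h _ _ hxy
    refine ⟨T, hT, ?_, ?_⟩
    · have := congrArg (Subgroup.map (MonoidHom.fst A B)) hc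
      rw [MonoidHom.map_closure, Set.image_union, Set.image_pair, ← MonoidHom.range_eq_map,
        MonoidHom.range_eq_top.mpr Prod.fst_surjective] at this
      simpa using this
    · have := congrArg (Subgroup.map (MonoidHom.snd A B)) hc
      rw [MonoidHom.map_closure, Set.image_union, Set.image_pair, ← MonoidHom.range_eq_map,
        MonoidHom.range_eq_top.mpr Prod.snd_surjective, Subgroup.closure_union] at this
      simpa using this
  obtain ⟨x, y, hxy⟩ := exists_pair hA
  obtain ⟨T, hT, -, hT2⟩ := stepA x y hxy
  have hB1 : minGen B ≤ T.card := (minGen_le (T.image Prod.snd) (by simpa using hT2)).trans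
    Finset.card_image_le
  have hB : IsCyclic B := by
    by_contra hB
    obtain ⟨u, v, huv⟩ := exists_pair hB
    rw [← isCyclic_closure_image (MonoidHom.inr A B) (fun a b hab => by simpa using hab)] at huv
    obtain ⟨T', hT', hc⟩ := h _ _ huv
    have := congrArg (Subgroup.map (MonoidHom.fst A B)) hc
    rw [MonoidHom.map_closure, Set.image_union, Set.image_pair, ← MonoidHom.range_eq_map,
      MonoidHom.range_eq_top.mpr Prod.fst_surjective, Subgroup.closure_union] at this
    have hA1 : minGen A ≤ T'.card := (minGen_le (T'.image Prod.fst) (by simpa using this)).trans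
      Finset.card_image_le
    have := minGen_prod_le hco (minGen (A × B) - 2) (by omega) (by omega)
    omega
  have hB1' : minGen B ≤ 1 := minGen_le_one
  have s2 := minGen_prod_le hco (minGen A) le_rfl (by omega)
  refine ⟨hB, ?_, by omega, ?_⟩
  · intro x y hxy
    obtain ⟨T, hT, hT1, -⟩ := stepA x y hxy
    refine ⟨T.image Prod.fst, ?_, hT1⟩
    have := Finset.card_image_le (s := T) (f := Prod.fst)
    omega
  · intro h2
    have : T.card = 0 := by omega
    rw [Finset.card_eq_zero] at this
    subst this
    simp only [Finset.image_empty, Finset.coe_empty, Subgroup.closure_empty] at hT2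
    refine ⟨fun a b => ?_⟩
    have ha : a ∈ (⊥ : Subgroup B) := by rw [hT2]; trivial
    have hb : b ∈ (⊥ : Subgroup B) := by rw [hT2]; trivial
    rw [mem_bot.mp ha, mem_bot.mp hb]

end RIP

namespace RIP
open Subgroup

lemma mem_zpowers_of_dvd {C : Type*} [Group C] [Finite C] [IsCyclic C] {x y : C}
    (h : orderOf x ∣ orderOf y) : x ∈ zpowers y := by
  classical
  have : Fintype C := Fintype.ofFinite C
  by_contra hx
  have h1 := IsCyclic.card_pow_eq_one_le (α := C) (orderOf_pos y)
  have h2 : insert x (Finset.univ.filter (· ∈ zpowers y)) ⊆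
      Finset.univ.filter (fun a : C => a ^ orderOf y = 1) := by
    intro a ha
    simp only [Finset.mem_insert, Finset.mem_filter, Finset.mem_univ, true_and] at ha ⊢
    rcases ha with rfl | ha
    · exact orderOf_dvd_iff_pow_eq_one.mp h
    · obtain ⟨k, rfl⟩ := ha
      simp only
      rw [← zpow_natCast, ← zpow_mul, mul_comm, zpow_mul, zpow_natCast, pow_orderOf_eq_one, one_zpow]
  have h3 := Finset.card_le_card h2
  rw [Finset.card_insert_of_notMem (by simpa using hx)] at h3
  have h4 : (Finset.univ.filter (· ∈ zpowers y)).card = orderOf y := by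
    rw [← Nat.card_zpowers, Nat.card_eq_fintype_card, Fintype.card_subtype]
  omega

lemma cyc_total {G : Type*} [Group G] [Finite G] {p : ℕ} [Fact p.Prime] (hG : IsPGroup p G)
    {x y : G} (h : IsCyclic (closure ({x, y} : Set G))) : x ∈ zpowers y ∨ y ∈ zpowers x := by
  set C := closure ({x, y} : Set G) with hC
  have hx : x ∈ C := subset_closure (by simp)
  have hy : y ∈ C := subset_closure (by simp)
  obtain ⟨i, hi⟩ := (IsPGroup.iff_orderOf.mp hG) x
  obtain ⟨j, hj⟩ := (IsPGroup.iff_orderOf.mp hG) y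
  have aux : ∀ a b : C, orderOf (a : G) ∣ orderOf (b : G) → (a : G) ∈ zpowers (b : G) := by
    intro a b hab
    have : a ∈ zpowers b := mem_zpowers_of_dvd (by simpa using hab)
    obtain ⟨k, rfl⟩ := this
    exact ⟨k, by simp⟩
  rcases le_total i j with hij | hij
  · left
    exact aux ⟨x, hx⟩ ⟨y, hy⟩ (by simpa [hi, hj] using pow_dvd_pow p hij)
  · right
    exact aux ⟨y, hy⟩ ⟨x, hx⟩ (by simpa [hi, hj] using pow_dvd_pow p hij)

lemma coatom_facts {G : Type*} [Group G] [Finite G] {p : ℕ} [Fact p.Prime] (hG : IsPGroup p G)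
    {M : Subgroup G} (hM : IsCoatom M) : (∀ x : G, x ^ p ∈ M) ∧ ∀ x y : G, x * y * x⁻¹ * y⁻¹ ∈ M := by
  have hnil := hG.isNilpotent
  have hn : M.Normal := ((Group.isNilpotent_of_finite_tfae (G := G)).out 0 2 rfl rfl).mp hnil M hM
  obtain ⟨n, hn'⟩ := IsPGroup.iff_card.mp hG
  obtain ⟨k, hk⟩ := IsPGroup.iff_card.mp (hG.to_subgroup M)
  have hp : p.Prime := Fact.out
  have hlt : k < n := by
    have h1 : Nat.card M ∣ Nat.card G := M.card_subgroup_dvd_card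
    rw [hk, hn', Nat.pow_dvd_pow_iff_le_right hp.one_lt] at h1
    refine lt_of_le_of_ne h1 ?_
    rintro rfl
    exact hM.1 (M.eq_top_of_card_eq (by rw [hk, hn']))
  obtain ⟨K, hK, hMK⟩ := Sylow.exists_subgroup_card_pow_succ (p := p) (n := k)
    (by rw [hn']; exact pow_dvd_pow p hlt) hk
  have hKt : K = ⊤ := by
    apply hM.2
    refine lt_of_le_of_ne hMK ?_
    rintro rfl
    rw [hk] at hK
    exact absurd (Nat.pow_right_injective hp.two_le hK) (by omega)
  have hidx : Nat.card (G ⧸ M) = p := by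
    have h1 := M.card_mul_index
    rw [hKt, Subgroup.card_top] at hK
    rw [hk, hK, pow_succ] at h1
    exact Nat.eq_of_mul_eq_mul_left (pow_pos hp.pos k) h1
  have : IsCyclic (G ⧸ M) := isCyclic_of_prime_card hidx
  constructor
  · intro x
    rw [← QuotientGroup.eq_one_iff, QuotientGroup.mk_pow, ← hidx, pow_card_eq_one']
  · intro x y
    rw [← QuotientGroup.eq_one_iff]
    have hc : ((x : G ⧸ M)) * y = y * x := (IsCyclic.commGroup (α := G ⧸ M)).mul_comm _ _
    change (x : G ⧸ M) * (y : G ⧸ M) * (x : G ⧸ M)⁻¹ * (y : G ⧸ M)⁻¹ = 1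
    rw [hc]; group

lemma frattini_facts {G : Type*} [Group G] [Finite G] {p : ℕ} [Fact p.Prime] (hG : IsPGroup p G) :
    (∀ x : G, x ^ p ∈ frattini G) ∧ ∀ x y : G, x * y * x⁻¹ * y⁻¹ ∈ frattini G := by
  have key : ∀ z : G, (∀ M : Subgroup G, IsCoatom M → z ∈ M) → z ∈ frattini G := by
    intro z hz
    simp only [frattini, Order.radical, mem_iInf]
    exact hz
  exact ⟨fun x => key _ fun M hM => (coatom_facts hG hM).1 x,
    fun x y => key _ fun M hM => (coatom_facts hG hM).2 x y⟩

lemma frattini_cyclic {G : Type*} [Group G] [Finite G] (h : IP G) (x w : G)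
    (hw : w ∈ frattini G) : IsCyclic (closure ({x, w} : Set G)) := by
  classical
  by_contra hc
  obtain ⟨T, hT, hTc⟩ := h x w hc
  have : closure ((insert x T : Finset G) : Set G) = ⊤ := by
    apply frattini_nongenerating
    rw [eq_top_iff, ← hTc, closure_le]
    rintro z ((rfl | rfl) | hz)
    · exact mem_sup_left (subset_closure (by simp))
    · exact mem_sup_right hw
    · exact mem_sup_left (subset_closure (by simpa using Or.inr hz))
  have h1 := minGen_le _ this
  have h2 := Finset.card_insert_le x T
  omega

lemma mul_pow_class_two {G : Type*} [Group G] {m n c : G} (h : n * m = m * n * c)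
    (hm : Commute c m) (hn : Commute c n) (k : ℕ) :
    (m * n) ^ k = m ^ k * n ^ k * c ^ (k.choose 2) := by
  have h1 : ∀ k : ℕ, n ^ k * m = m * n ^ k * c ^ k := by
    intro k
    induction k with
    | zero => simp
    | succ k ih =>
      calc n ^ (k + 1) * m = n * (n ^ k * m) := by rw [pow_succ']; group
        _ = n * m * n ^ k * c ^ k := by rw [ih]; group
        _ = m * n * (c * n ^ k) * c ^ k := by rw [h]; group
        _ = m * n * (n ^ k * c) * c ^ k := by rw [(hn.pow_right k).eq]
        _ = m * n ^ (k + 1) * c ^ (k + 1) := by rw [pow_succ' n, pow_succ' c]; group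
  induction k with
  | zero => simp
  | succ k ih =>
    have hcm : Commute (c ^ (k.choose 2)) (m * n) := (hm.mul_right hn).pow_left _
    calc (m * n) ^ (k + 1) = m ^ k * n ^ k * (c ^ (k.choose 2) * (m * n)) := by
          rw [pow_succ, ih]; group
      _ = m ^ k * (n ^ k * m) * n * c ^ (k.choose 2) := by rw [hcm.eq]; group
      _ = m ^ k * m * n ^ k * (c ^ k * n) * c ^ (k.choose 2) := by rw [h1]; group
      _ = m ^ k * m * n ^ k * (n * c ^ k) * c ^ (k.choose 2) := by rw [(hn.pow_left k).eq]
      _ = m ^ (k + 1) * n ^ (k + 1) * c ^ ((k + 1).choose 2) := by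
          rw [Nat.choose_succ_succ' k 1, Nat.choose_one_right, pow_add c, pow_succ m, pow_succ n]
          group

/-- structure of `p`-groups in which every `⟨x, w⟩`, `w ∈ Φ`, is cyclic. -/
lemma pgroup_main {G : Type*} [Group G] [Finite G] {p : ℕ} [Fact p.Prime] (hG : IsPGroup p G)
    (hnc : ¬ IsCyclic G) (Φ : Subgroup G) (hpow : ∀ x : G, x ^ p ∈ Φ)
    (hcom : ∀ x y : G, x * y * x⁻¹ * y⁻¹ ∈ Φ) (hB : ∀ x, ∀ w ∈ Φ, IsCyclic (closure ({x, w} : Set G)))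
    (hΦ : Φ ≠ ⊥) :
    p = 2 ∧ ∃ c : G, c ∈ Φ ∧ c ≠ 1 ∧ c ^ 2 = 1 ∧ (∀ w ∈ Φ, w = 1 ∨ w = c) ∧
      (∀ y, y ∉ Φ → y ^ 2 = c) ∧ (∀ y, Commute c y) := by
  have hp : p.Prime := Fact.out
  have hcent : ∀ w ∈ Φ, ∀ y, Commute w y := by
    intro w hw y
    have := hB y w hw
    have h1 := (IsCyclic.commGroup (α := closure ({y, w} : Set G))).mul_comm
      ⟨w, subset_closure (by simp)⟩ ⟨y, subset_closure (by simp)⟩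
    exact congrArg Subtype.val h1
  have hgen : ∀ y, y ∉ Φ → ∀ w ∈ Φ, w ∈ zpowers (y ^ p) := by
    intro y hy w hw
    rcases cyc_total hG (hB y w hw) with h | h
    · exact absurd (zpowers_le.mpr hw h) hy
    · obtain ⟨j, rfl⟩ := h
      simp only at hw ⊢
      by_cases hj : (p : ℤ) ∣ j
      · obtain ⟨l, rfl⟩ := hj
        exact ⟨l, by simp only; rw [zpow_mul, zpow_natCast]⟩
      · exfalso
        apply hy
        have hco : IsCoprime (p : ℤ) j :=
          (Nat.prime_iff_prime_int.mp hp).coprime_iff_not_dvd.mpr hj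
        obtain ⟨a, b, hab⟩ := hco
        have : y = (y ^ p) ^ a * (y ^ j) ^ b := by
          rw [← zpow_natCast, ← zpow_mul, ← zpow_mul, ← zpow_add]
          rw [mul_comm (p : ℤ), mul_comm j, hab, zpow_one]
        rw [this]
        exact Φ.mul_mem (Φ.zpow_mem (hpow y) a) (Φ.zpow_mem hw b)
  have hle : ∀ y, y ∉ Φ → Φ ≤ zpowers y := by
    intro y hy w hw
    exact zpowers_le.mpr ((zpowers y).pow_mem (mem_zpowers y) p) (hgen y hy w hw)
  have hbot : ∀ y, y ∉ Φ → y ^ p ≠ 1 := by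
    intro y hy h1
    apply hΦ
    rw [eq_bot_iff]
    intro w hw
    simpa [h1] using hgen y hy w hw
  -- pick n outside Φ
  obtain ⟨n, hn⟩ : ∃ n, n ∉ Φ := by
    by_contra! hall
    obtain ⟨x, y, hxy⟩ := exists_pair hnc
    exact hxy (hB x y (hall y))
  obtain ⟨m, hm⟩ : ∃ m, m ∉ zpowers n := by
    by_contra! hall
    exact hnc ⟨n, hall⟩
  have hmΦ : m ∉ Φ := fun h => hm (hle n hn h)
  obtain ⟨i, hi⟩ := hgen n hn _ (hpow m)
  -- n' with the same p-th power
  set v : G := (n ^ i)⁻¹ with hv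
  have hvn : v ∈ zpowers n := (zpowers n).inv_mem ⟨i, rfl⟩
  have hvp : m ^ p * v ^ p = 1 := by
    have : (n ^ p) ^ i = (n ^ i) ^ p := by
      rw [← zpow_natCast, ← zpow_natCast, ← zpow_mul, ← zpow_mul, mul_comm]
    simp only at hi
    rw [← hi, this, hv, inv_pow, mul_inv_cancel]
  have hu : m * v ∉ Φ := by
    intro h
    apply hm
    have := (zpowers n).mul_mem (hle n hn h) ((zpowers n).inv_mem hvn)
    simpa using this
  set c : G := v⁻¹ * m⁻¹ * v⁻¹⁻¹ * m⁻¹⁻¹ with hc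
  have hcΦ : c ∈ Φ := hcom _ _
  have hcom' : v * m = m * v * c := by
    rw [hc]; group
  have hcp : c ^ p = 1 := by
    have h1 : v * m ^ p = m ^ p * v := ((hcent _ (hpow m)) v).eq.symm
    have h2 : ∀ k : ℕ, v * m ^ k = m ^ k * v * c ^ k := by
      intro k
      induction k with
      | zero => simp
      | succ k ih =>
        calc v * m ^ (k + 1) = (v * m ^ k) * m := by rw [pow_succ]; group
          _ = m ^ k * v * (c ^ k * m) := by rw [ih]; group
          _ = m ^ k * (v * m) * c ^ k := by rw [((hcent c hcΦ m).pow_left k).eq]; group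
          _ = m ^ (k + 1) * v * c ^ (k + 1) := by rw [hcom', pow_succ m, pow_succ' c]; group
    rw [h2 p] at h1
    simpa using h1
  have hup : (m * v) ^ p = c ^ (p.choose 2) := by
    rw [mul_pow_class_two hcom' (hcent c hcΦ m) (hcent c hcΦ v), hvp, one_mul]
  rcases hp.eq_two_or_odd' with h2 | hodd
  · subst h2
    refine ⟨rfl, c, hcΦ, ?_, hcp, ?_⟩
    · intro h1
      apply hbot _ hu
      rw [hup, h1, one_pow]
    have hup' : (m * v) ^ 2 = c := by rw [hup]; simp
    have hdich : ∀ w ∈ Φ, w = 1 ∨ w = c := by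
      intro w hw
      obtain ⟨k, rfl⟩ := hgen _ hu w hw
      simp only [hup']
      rcases Int.even_or_odd' k with ⟨l, rfl | rfl⟩
      · left
        rw [zpow_mul]; norm_cast; rw [hcp, one_zpow]
      · right
        rw [zpow_add, zpow_mul]; norm_cast; rw [hcp, one_zpow]; simp
    refine ⟨hdich, ?_, hcent c hcΦ⟩
    intro y hy
    exact (hdich _ (hpow y)).resolve_left (hbot y hy)
  · exfalso
    apply hbot _ hu
    rw [hup]
    have : p ∣ p.choose 2 := hp.dvd_choose_self (by norm_num) (by
      rcases hp.two_le.lt_or_eq with h | h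
      · exact h
      · subst h; revert hodd; decide)
    obtain ⟨l, hl⟩ := this
    rw [hl, pow_mul, hcp, one_pow]

end RIP

namespace RIP
open Subgroup

lemma q8_equiv {G : Type*} [Group G] {m n c : G} (hm : m ^ 2 = c) (hn : n ^ 2 = c)
    (hc1 : c ≠ 1) (hc2 : c ^ 2 = 1) (hnm : n * m = m * n * c) (hcm : Commute c m)
    (hcn : Commute c n)
    (hnz : n ∉ zpowers m) (htop : closure ({m, n} : Set G) = ⊤) :
    Nonempty (G ≃* QuaternionGroup 2) := by
  have hm4 : m ^ 4 = 1 := by rw [show 4 = 2 * 2 by norm_num, pow_mul, hm, hc2]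
  have hord : orderOf m = 4 := by
    have := orderOf_eq_prime_pow (p := 2) (n := 1) (x := m) (by simpa [hm] using hc1)
      (by simpa using hm4)
    simpa using this
  have hmod : ∀ k : ℕ, m ^ (k % 4) = m ^ k := fun k => by rw [← hord, pow_mod_orderOf]
  have hadd : ∀ i j : ZMod (2 * 2), m ^ (i + j).val = m ^ i.val * m ^ j.val := by
    intro i j
    rw [ZMod.val_add]
    change m ^ ((i.val + j.val) % 4) = _
    rw [hmod, pow_add]
  have hsub : ∀ i j : ZMod (2 * 2), m ^ (i - j).val = m ^ i.val * (m ^ j.val)⁻¹ := by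
    intro i j
    rw [eq_mul_inv_iff_mul_eq, ← hadd, sub_add_cancel]
  have hnm' : n * m = m⁻¹ * n := by
    have h3 : m * c = m⁻¹ := by
      rw [eq_inv_iff_mul_eq_one, mul_assoc, hcm.eq, ← mul_assoc, ← sq, hm, ← sq, hc2]
    rw [hnm, mul_assoc, ← hcn.eq, ← mul_assoc, h3]
  have hpow : ∀ k : ℕ, n * m ^ k = (m ^ k)⁻¹ * n := by
    intro k
    induction k with
    | zero => simp
    | succ k ih =>
      calc n * m ^ (k + 1) = (n * m ^ k) * m := by rw [pow_succ]; group
        _ = (m ^ k)⁻¹ * (n * m) := by rw [ih]; group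
        _ = (m ^ (k + 1))⁻¹ * n := by rw [hnm', pow_succ']; group
  have hpow' : ∀ k : ℕ, m ^ k * n = n * (m ^ k)⁻¹ := by
    intro k
    have := hpow k
    rw [eq_mul_inv_iff_mul_eq, mul_assoc, this]; group
  let f : QuaternionGroup 2 → G := fun q => match q with
    | .a i => m ^ i.val
    | .xa i => n * m ^ i.val
  have h2 : m ^ ((2 : ℕ) : ZMod (2 * 2)).val = c := by
    rw [← hm]; congr 1
  let F : QuaternionGroup 2 →* G := MonoidHom.mk' f (by
    rintro (i | i) (j | j)
    · simp only [QuaternionGroup.a_mul_a, f, hadd]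
    · simp only [QuaternionGroup.a_mul_xa, f, hsub]
      rw [← mul_assoc, ← mul_assoc, hpow', mul_assoc, mul_assoc,
        (Commute.pow_pow (Commute.refl m) _ _).inv_right.eq]
    · simp only [QuaternionGroup.xa_mul_a, f, hadd, mul_assoc]
    · simp only [QuaternionGroup.xa_mul_xa, f, hsub, hadd]
      rw [h2, ← hn]
      calc n ^ 2 * m ^ j.val * (m ^ i.val)⁻¹ = n * n * (m ^ j.val * (m ^ i.val)⁻¹) := by
            rw [sq]; group
        _ = n * (n * (m ^ i.val)⁻¹) * m ^ j.val := by
            rw [(Commute.pow_pow (Commute.refl m) _ _).inv_right.eq]; group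
        _ = n * m ^ i.val * (n * m ^ j.val) := by rw [← hpow']; group)
  have hinj : Function.Injective F := by
    rw [injective_iff_map_eq_one]
    rintro (i | i) hi
    · change m ^ i.val = 1 at hi
      have h1 := orderOf_dvd_of_pow_eq_one hi
      rw [hord] at h1
      have h3 : i.val < 4 := ZMod.val_lt i
      have h4 : i.val = 0 := Nat.eq_zero_of_dvd_of_lt h1 h3
      rw [ZMod.val_eq_zero] at h4
      rw [h4]; rfl
    · change n * m ^ i.val = 1 at hi
      exfalso
      apply hnz
      rw [eq_inv_of_mul_eq_one_left hi]
      exact inv_mem (pow_mem (mem_zpowers m) _)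
  have hsurj : Function.Surjective F := by
    rw [← MonoidHom.range_eq_top, eq_top_iff, ← htop, closure_le]
    rintro z (rfl | rfl)
    · exact ⟨.a 1, by
        change z ^ (1 : ZMod (2 * 2)).val = z
        rw [show (1 : ZMod (2 * 2)).val = 1 from rfl, pow_one]⟩
    · exact ⟨.xa 0, by
        change z * m ^ (0 : ZMod (2 * 2)).val = z
        simp⟩
  exact ⟨(MulEquiv.ofBijective F ⟨hinj, hsurj⟩).symm⟩

lemma pgroup_final {G : Type*} [Group G] [Finite G] {p : ℕ} [Fact p.Prime] (hG : IsPGroup p G)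
    (hnc : ¬ IsCyclic G) (h : IP G) :
    ((∀ x y : G, x * y = y * x) ∧ ∀ x : G, x ^ p = 1) ∨
    (minGen G = 2 ∧ Nonempty (G ≃* QuaternionGroup 2)) := by
  classical
  obtain ⟨hpow, hcom⟩ := frattini_facts hG
  by_cases hΦ : frattini G = ⊥
  · left
    rw [hΦ] at hpow hcom
    refine ⟨fun x y => ?_, fun x => mem_bot.mp (hpow x)⟩
    have := mem_bot.mp (hcom x y)
    rw [mul_inv_eq_one, mul_inv_eq_iff_eq_mul] at this
    exact this
  right
  obtain ⟨rfl, c, hcΦ, hc1, hc2, hdich, hsq, hcent⟩ :=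
    pgroup_main hG hnc (frattini G) hpow hcom (frattini_cyclic h) hΦ
  set Φ := frattini G
  have hcomm : ∀ x y : G, y * x ≠ x * y → y * x = x * y * c := by
    intro x y hne
    rcases hdich _ (hcom y⁻¹ x⁻¹) with h1 | h1
    · exfalso
      apply hne
      simp only [inv_inv] at h1
      rw [mul_eq_one_iff_eq_inv, mul_eq_one_iff_eq_inv.symm] at h1
      rw [← mul_inv_rev] at h1
      have : (x * y)⁻¹ * (y * x) = 1 := by rw [← h1]; group
      exact (inv_mul_eq_one.mp this).symm
    · rw [← h1]; group
  have hnoncomm : ∀ x y : G, x ∉ Φ → y ∉ Φ → x * y ∉ Φ → y * x ≠ x * y := by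
    intro x y hx hy hxy he
    have h1 := hsq _ hxy
    rw [(show Commute x y from he.symm).mul_pow, hsq x hx, hsq y hy, ← sq, hc2] at h1
    exact hc1 h1.symm
  obtain ⟨m, hm⟩ : ∃ n, n ∉ Φ := by
    by_contra! hall
    obtain ⟨x, y, hxy⟩ := exists_pair hnc
    exact hxy (frattini_cyclic h x y (hall y))
  have hgen : ∀ S : Finset G, S.card < minGen G → ∃ n, n ∉ closure (S : Set G) ⊔ Φ := by
    intro S hS
    by_contra! hall
    have := minGen_le S (frattini_nongenerating (eq_top_iff.mpr fun x _ => hall x))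
    omega
  have h2 := two_le_minGen hnc
  obtain ⟨n, hn⟩ := hgen {m} (by simp; omega)
  rw [Finset.coe_singleton] at hn
  have hnΦ : n ∉ Φ := fun hh => hn (mem_sup_right hh)
  have hmem : m ∈ closure ({m} : Set G) ⊔ Φ := mem_sup_left (subset_closure (by simp))
  have hmn : m * n ∉ Φ := by
    intro hh
    apply hn
    have := mul_mem (inv_mem hmem) (mem_sup_right hh : m * n ∈ closure ({m} : Set G) ⊔ Φ)
    simpa using this
  have hd : minGen G = 2 := by
    by_contra hne
    obtain ⟨k, hk⟩ := hgen {m, n} (lt_of_le_of_lt Finset.card_le_two (by omega))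
    rw [Finset.coe_pair] at hk
    set K := closure ({m, n} : Set G) ⊔ Φ with hK
    have hmK : m ∈ K := mem_sup_left (subset_closure (by simp))
    have hnK : n ∈ K := mem_sup_left (subset_closure (by simp))
    have hΦK : Φ ≤ K := le_sup_right
    have hkΦ : k ∉ Φ := fun hh => hk (hΦK hh)
    have hmk : m * k ∉ Φ := by
      intro hh
      apply hk
      simpa using mul_mem (inv_mem hmK) (hΦK hh)
    have hnk : n * k ∉ Φ := by
      intro hh
      apply hk
      simpa using mul_mem (inv_mem hnK) (hΦK hh)
    have hmnk : m * (n * k) ∉ Φ := by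
      intro hh
      apply hk
      simpa using mul_mem (inv_mem hnK) (mul_mem (inv_mem hmK) (hΦK hh))
    apply hnoncomm m (n * k) hm hnk hmnk
    have e1 := hcomm m n (hnoncomm m n hm hnΦ hmn)
    have e2 := hcomm m k (hnoncomm m k hm hkΦ hmk)
    calc n * k * m = n * (k * m) := by group
      _ = (n * m) * k * c := by rw [e2]; group
      _ = m * n * (c * k) * c := by rw [e1]; group
      _ = m * n * k * c ^ 2 := by rw [(hcent k).eq, sq]; group
      _ = m * (n * k) := by rw [hc2]; group
  refine ⟨hd, q8_equiv (hsq m hm) (hsq n hnΦ) hc1 hc2 (hcomm m n (hnoncomm m n hm hnΦ hmn))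
    (hcent m) (hcent n) ?_ ?_⟩
  · intro hh
    exact hn (mem_sup_left (by rwa [← zpowers_eq_closure]))
  · have hcyc : ¬ IsCyclic (closure ({m, n} : Set G)) := by
      intro hh
      apply hnoncomm m n hm hnΦ hmn
      have h1 := (IsCyclic.commGroup (α := closure ({m, n} : Set G))).mul_comm
        ⟨n, subset_closure (by simp)⟩ ⟨m, subset_closure (by simp)⟩
      exact congrArg Subtype.val h1
    obtain ⟨T, hT, hTc⟩ := h m n hcyc
    have : T = ∅ := by rw [← Finset.card_eq_zero]; omega
    subst this
    simpa using hTc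

/-- Elementary abelian: extension of an independent pair to a small generating set. -/
lemma elem_IP {G : Type*} [Group G] [Finite G] {p : ℕ} [hp : Fact p.Prime]
    (hcomm : ∀ x y : G, x * y = y * x) (hpow : ∀ x : G, x ^ p = 1) :
    IP G ∧ (¬ IsCyclic G → minGen G = 2 → Nonempty (G ≃* Multiplicative (ZMod p × ZMod p))) := by
  classical
  let _ : CommGroup G := { (inferInstance : Group G) with mul_comm := hcomm }
  let V := Additive G
  let _ : Module (ZMod p) V := AddCommGroup.zmodModule (n := p) (fun x => hpow x.toMul)
  have : Finite V := inferInstanceAs (Finite G)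
  have : Module.Finite (ZMod p) V := Module.Finite.of_finite
  have hspan : ∀ (S : Set V) (x : V), x ∈ Submodule.span (ZMod p) S →
      x.toMul ∈ Subgroup.closure (Additive.ofMul ⁻¹' S : Set G) := by
    intro S x hx
    induction hx using Submodule.span_induction with
    | mem x hx => exact subset_closure hx
    | zero => exact one_mem _
    | add x y _ _ hx hy => exact mul_mem hx hy
    | smul a x _ hx =>
      have : a • x = a.val • x := by
        rw [← Nat.cast_smul_eq_nsmul (ZMod p), ZMod.natCast_zmod_val]
      rw [this]
      exact pow_mem hx a.val
  have hspan' : ∀ (S : Set G) (x : G), x ∈ Subgroup.closure S →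
      (Additive.ofMul x : V) ∈ Submodule.span (ZMod p) (Additive.toMul ⁻¹' S : Set V) := by
    intro S x hx
    induction hx using Subgroup.closure_induction with
    | mem x hx => exact Submodule.subset_span hx
    | one => exact zero_mem _
    | mul x y _ _ hx hy => exact add_mem hx hy
    | inv x _ hx => exact neg_mem hx
  have hfin : Module.finrank (ZMod p) V ≤ minGen G := by
    obtain ⟨S, hS, hc⟩ := exists_minGen G
    rw [← hS]
    let S' : Finset V := S.map Additive.ofMul.toEmbedding
    have hS' : S'.card = S.card := Finset.card_map _
    rw [← hS', ← finrank_top (ZMod p) V]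
    have : (⊤ : Submodule (ZMod p) V) = Submodule.span (ZMod p) (S' : Set V) := by
      symm
      rw [eq_top_iff]
      intro x _
      have h1 := hspan' (S : Set G) x.toMul (by rw [hc]; trivial)
      refine Submodule.span_mono ?_ h1
      intro y hy
      simp only [S', Finset.coe_map]
      exact ⟨y.toMul, hy, rfl⟩
    rw [this]
    exact finrank_span_finset_le_card S'
  constructor
  · intro x y hxy
    let s : Set V := {Additive.ofMul x, Additive.ofMul y}
    have hne : x ≠ y := by
      rintro rfl
      apply hxy
      rw [Set.pair_eq_singleton, ← zpowers_eq_closure]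
      infer_instance
    have hx0 : (Additive.ofMul x : V) ≠ 0 := by
      intro h0
      have : x = 1 := h0
      subst this
      apply hxy
      have : closure ({1, y} : Set G) = zpowers y := by
        rw [zpowers_eq_closure, Subgroup.closure_insert_one]
      rw [this]; infer_instance
    have hli' : LinearIndependent (ZMod p) ![(Additive.ofMul x : V), Additive.ofMul y] := by
      rw [LinearIndependent.pair_iff' hx0]
      intro a hay
      have : a • (Additive.ofMul x : V) = a.val • (Additive.ofMul x : V) := by
        rw [← Nat.cast_smul_eq_nsmul (ZMod p), ZMod.natCast_zmod_val]
      rw [this] at hay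
      have hay' : x ^ a.val = y := hay
      apply hxy
      have h1 : closure ({x, y} : Set G) = zpowers x := by
        apply le_antisymm
        · rw [closure_le]
          rintro z (rfl | rfl)
          · exact mem_zpowers _
          · rw [← hay']; exact pow_mem (mem_zpowers x) _
        · rw [zpowers_le]; exact subset_closure (by simp)
      rw [h1]; infer_instance
    have hli : LinearIndepOn (ZMod p) id s := by
      have := hli'.linearIndepOn_id
      simpa [s, Set.pair_comm] using this
    obtain ⟨B, b, hbr, hsB⟩ : ∃ (B : Set V) (b : Module.Basis B (ZMod p) V),
        Set.range b = B ∧ s ⊆ B :=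
      ⟨_, Module.Basis.extend hli, Module.Basis.range_extend hli, hli.subset_extend _⟩
    have hBf : B.Finite := Set.toFinite B
    have : Fintype B := hBf.fintype
    have hcard : B.toFinset.card ≤ minGen G := by
      rw [Set.toFinset_card, ← Module.finrank_eq_card_basis b]
      exact hfin
    let S : Finset V := {Additive.ofMul x, Additive.ofMul y}
    have hS : S ⊆ B.toFinset := by
      intro z hz
      rw [Set.mem_toFinset]
      apply hsB
      simpa [S, s] using hz
    have hS2 : S.card = 2 := Finset.card_pair (by simpa using hne)
    refine ⟨(B.toFinset \ S).map Additive.toMul.toEmbedding, ?_, ?_⟩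
    · rw [Finset.card_map]
      have := Finset.card_sdiff_add_card_eq_card hS
      omega
    · rw [eq_top_iff]
      intro z _
      have hz : (Additive.ofMul z : V) ∈ Submodule.span (ZMod p) B := by
        rw [← hbr, b.span_eq]; trivial
      have h1 := hspan _ _ hz
      refine Subgroup.closure_mono ?_ h1
      intro w hw
      have hw' : (Additive.ofMul w : V) ∈ B := hw
      by_cases hwS : w = x ∨ w = y
      · exact Or.inl (by simpa using hwS)
      · right
        simp only [Finset.coe_map]
        refine ⟨Additive.ofMul w, ?_, rfl⟩
        simpa [S, hw'] using hwS
  · intro hnc hd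
    have h2 : 2 ≤ Module.finrank (ZMod p) V := by
      by_contra hlt
      have h1 : Module.finrank (ZMod p) V ≤ 1 := by omega
      obtain ⟨v, hv⟩ := finrank_le_one_iff.mp h1
      apply hnc
      refine ⟨v.toMul, fun w => ?_⟩
      obtain ⟨a, ha⟩ := hv (Additive.ofMul w)
      have : a • v = a.val • v := by
        rw [← Nat.cast_smul_eq_nsmul (ZMod p), ZMod.natCast_zmod_val]
      rw [this] at ha
      refine ⟨a.val, ?_⟩
      simp only [zpow_natCast]
      exact ha
    have hfe : Module.finrank (ZMod p) V = Module.finrank (ZMod p) (ZMod p × ZMod p) := by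
      rw [Module.finrank_prod, Module.finrank_self]; omega
    let e : V ≃ₗ[ZMod p] (ZMod p × ZMod p) := LinearEquiv.ofFinrankEq _ _ hfe
    refine ⟨{ toFun := fun g => Multiplicative.ofAdd (e (Additive.ofMul g))
              invFun := fun w => (e.symm w.toAdd).toMul
              left_inv := fun g => by simp
              right_inv := fun w => by simp
              map_mul' := fun g h => ?_ }⟩
    have := e.map_add (Additive.ofMul g) (Additive.ofMul h)
    exact this

end RIP

namespace RIP
open Subgroup

lemma back_prod {A B : Type*} [Group A] [Group B] [Finite A] [Finite B]
    (hco : (Nat.card A).Coprime (Nat.card B)) (hA : IP A) (h3 : 3 ≤ minGen A) [hB : IsCyclic B] :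
    IP (A × B) := by
  classical
  rintro ⟨a, b⟩ ⟨a', b'⟩ hxy
  have hle : minGen A ≤ minGen (A × B) :=
    minGen_le_of_surj (MonoidHom.fst A B) Prod.fst_surjective
  have hc : ¬ IsCyclic (closure ({a, a'} : Set A)) := by
    intro hcyc
    apply hxy
    have hsub : closure ({(a, b), (a', b')} : Set (A × B)) ≤
        (closure ({a, a'} : Set A)).prod (⊤ : Subgroup B) := by
      rw [closure_le]
      rintro z (rfl | rfl)
      · exact ⟨subset_closure (by simp), trivial⟩
      · exact ⟨subset_closure (by simp), trivial⟩
    have hBt : IsCyclic (⊤ : Subgroup B) := Subgroup.topEquiv.isCyclic.mpr hB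
    have h1 : IsCyclic ((closure ({a, a'} : Set A)).prod (⊤ : Subgroup B)) := by
      rw [(Subgroup.prodEquiv _ _).isCyclic, Group.isCyclic_prod_iff]
      refine ⟨hcyc, hBt, ?_⟩
      rw [Subgroup.card_top]
      exact hco.coprime_dvd_left (card_subgroup_dvd_card _)
    exact Subgroup.isCyclic_of_le hsub
  obtain ⟨T, hT, hTc⟩ := hA a a' hc
  obtain ⟨g, hg⟩ := hB
  have hTne : T.Nonempty := by
    rw [Finset.nonempty_iff_ne_empty]
    rintro rfl
    have := minGen_le ({a, a'} : Finset A) (by simpa using hTc)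
    have h2 : ({a, a'} : Finset A).card ≤ 2 := Finset.card_le_two
    omega
  obtain ⟨t, ht⟩ := hTne
  refine ⟨T.image fun z => (z, g), ?_, ?_⟩
  · have := Finset.card_image_le (s := T) (f := fun z => (z, g))
    omega
  · apply prod_top hco
    · rw [eq_top_iff, ← hTc, MonoidHom.map_closure]
      apply Subgroup.closure_mono
      rintro z ((rfl | rfl) | hz)
      · exact ⟨(z, b), by simp, rfl⟩
      · exact ⟨(z, b'), by simp, rfl⟩
      · exact ⟨(z, g), Or.inr (by simpa using hz), rfl⟩
    · rw [eq_top_iff, MonoidHom.map_closure]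
      intro z _
      have h1 : g ∈ closure ((MonoidHom.snd A B) '' ({(a, b), (a', b')} ∪
          ((T.image fun z => (z, g) : Finset (A × B)) : Set (A × B)))) :=
        subset_closure ⟨(t, g), Or.inr (by simpa using ht), rfl⟩
      exact zpowers_le.mpr h1 (hg z)

lemma IP_of_minimal {G : Type*} [Group G] [Finite G] (hnc : ¬ IsCyclic G)
    (h : ∀ H : Subgroup G, H ≠ ⊤ → IsCyclic H) : IP G := by
  intro x y hxy
  refine ⟨∅, by simpa using two_le_minGen hnc, ?_⟩
  by_contra hne
  exact hxy (h _ (by simpa using hne))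

lemma IP_prime_sq {G : Type*} [Group G] [Finite G] (hnc : ¬ IsCyclic G) {p : ℕ} (hp : p.Prime)
    (hcard : Nat.card G = p ^ 2) : IP G := by
  apply IP_of_minimal hnc
  intro H hH
  have h1 : Nat.card H ∣ p ^ 2 := hcard ▸ card_subgroup_dvd_card H
  obtain ⟨k, hk, hk'⟩ := (Nat.dvd_prime_pow hp).mp h1
  have : Fact p.Prime := ⟨hp⟩
  have hk1 : k ≤ 1 := by
    by_contra hlt
    have : k = 2 := by omega
    subst this
    exact hH (H.eq_top_of_card_eq (by rw [hk', hcard]))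
  apply isCyclic_of_card_dvd_prime (p := p)
  rw [hk']
  simpa using pow_dvd_pow p hk1

lemma IP_q8 (hnc : ¬ IsCyclic (QuaternionGroup 2)) : IP (QuaternionGroup 2) := by
  apply IP_of_minimal hnc
  intro H hH
  have hcard : Nat.card (QuaternionGroup 2) = 2 ^ 3 := by
    rw [Nat.card_eq_fintype_card, QuaternionGroup.card]; norm_num
  have h1 : Nat.card H ∣ 2 ^ 3 := hcard ▸ card_subgroup_dvd_card H
  obtain ⟨k, hk, hk'⟩ := (Nat.dvd_prime_pow Nat.prime_two).mp h1
  have hk1 : k ≤ 2 := by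
    by_contra hlt
    have : k = 3 := by omega
    subst this
    exact hH (H.eq_top_of_card_eq (by rw [hk', hcard]))
  rcases hk1.lt_or_eq with hlt | rfl
  · apply isCyclic_of_card_dvd_prime (p := 2)
    rw [hk']
    simpa using pow_dvd_pow 2 (by omega : k ≤ 1)
  · by_contra hc
    have hexp := (not_isCyclic_iff_exponent_eq_prime Nat.prime_two hk').mp hc
    have h2 : ∀ x : H, (x : QuaternionGroup 2) ^ 2 = 1 := by
      intro x
      have := Monoid.pow_exponent_eq_one x
      rw [hexp] at this
      exact_mod_cast congrArg Subtype.val this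
    have h3 : Nat.card H ≤ Nat.card {x : QuaternionGroup 2 // x ^ 2 = 1} :=
      Nat.card_le_card_of_injective (fun x : H => ⟨x, h2 x⟩) (by
        intro x y hxy
        have h5 : (x : QuaternionGroup 2) = y := (Subtype.mk.injEq _ _ _ _).mp hxy
        exact Subtype.ext h5)
    have h4 : Nat.card {x : QuaternionGroup 2 // x ^ 2 = 1} = 2 := by
      rw [Nat.card_eq_fintype_card]; decide
    rw [hk', h4] at h3
    norm_num at h3

lemma prod_equiv {G : Type*} [Group G] (P C : Subgroup G)
    (hcomm : ∀ x ∈ P, ∀ y ∈ C, x * y = y * x) (hinf : P ⊓ C = ⊥) (hsup : P ⊔ C = ⊤) :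
    Nonempty (P × C ≃* G) := by
  have hc : ∀ (m : P) (n : C), Commute (P.subtype m) (C.subtype n) :=
    fun x y => hcomm x x.2 y y.2
  let F : P × C →* G := MonoidHom.noncommCoprod P.subtype C.subtype hc
  refine ⟨MulEquiv.ofBijective F ⟨?_, ?_⟩⟩
  · rw [injective_iff_map_eq_one]
    rintro ⟨x, y⟩ hxy
    have hxy' : (x : G) * y = 1 := hxy
    have hx : (x : G) ∈ P ⊓ C := ⟨x.2, by
      rw [eq_inv_of_mul_eq_one_left hxy']; exact C.inv_mem y.2⟩
    rw [hinf, mem_bot] at hx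
    rw [hx, one_mul] at hxy'
    ext <;> simp [hx, hxy']
  · rw [← MonoidHom.range_eq_top]
    simp only [F]
    rw [MonoidHom.noncommCoprod_range, range_subtype, range_subtype, hsup]

lemma exists_decomp {G : Type*} [Group G] [Finite G] (hnil : Group.IsNilpotent G)
    {p : ℕ} [hp : Fact p.Prime] (P : Sylow p G) (hP : ¬ IsCyclic (P : Subgroup G)) :
    ∃ C : Subgroup G, Nat.Coprime (Nat.card C) p ∧
      (∀ x ∈ (P : Subgroup G), ∀ y ∈ C, x * y = y * x) ∧
      (P : Subgroup G) ⊓ C = ⊥ ∧ (P : Subgroup G) ⊔ C = ⊤ := by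
  obtain ⟨e⟩ := ((Group.isNilpotent_of_finite_tfae (G := G)).out 0 4 rfl rfl).mp hnil
  have hPn : (P : Subgroup G).Normal :=
    ((Group.isNilpotent_of_finite_tfae (G := G)).out 0 3 rfl rfl).mp hnil p hp P
  have hpm : p ∈ (Nat.card G).primeFactors := by
    rw [Nat.mem_primeFactors]
    refine ⟨hp.out, ?_, Nat.card_pos.ne'⟩
    by_contra hnd
    apply hP
    obtain ⟨k, hk⟩ := IsPGroup.iff_card.mp P.isPGroup'
    have h1 : Nat.card (P : Subgroup G) ∣ Nat.card G := card_subgroup_dvd_card _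
    have h0 : k = 0 := by
      by_contra hk0
      exact hnd ((dvd_pow_self p hk0).trans (hk ▸ h1))
    have : Nat.card (P : Subgroup G) = 1 := by rw [hk, h0, pow_zero]
    apply isCyclic_of_card_dvd_prime (p := p)
    rw [this]; exact one_dvd _
  let φ₀ : (∀ p : (Nat.card G).primeFactors, ∀ P : Sylow p G, (↑P : Subgroup G)) →*
      (P : Subgroup G) :=
    { toFun := fun f => f ⟨p, hpm⟩ P
      map_one' := rfl
      map_mul' := fun _ _ => rfl }
  have hφ₀ : Function.Surjective φ₀ := by
    classical
    intro x
    refine ⟨fun q => if h : q = ⟨p, hpm⟩ then by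
      subst h
      exact Function.update (fun Q => 1) P x else fun Q => 1, ?_⟩
    simp [φ₀]
  let φ : G →* (P : Subgroup G) := φ₀.comp e.symm.toMonoidHom
  have hφ : Function.Surjective φ := hφ₀.comp e.symm.surjective
  have hcard : Nat.card (P : Subgroup G) * Nat.card φ.ker = Nat.card G := by
    rw [← φ.ker.card_mul_index, Subgroup.index_ker, MonoidHom.range_eq_top.mpr hφ,
      Subgroup.card_top, mul_comm]
  have hidx : Nat.card φ.ker = (P : Subgroup G).index := by
    have h1 := (P : Subgroup G).card_mul_index
    exact Nat.eq_of_mul_eq_mul_left Nat.card_pos (hcard.trans h1.symm)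
  have hco : (Nat.card (P : Subgroup G)).Coprime (Nat.card φ.ker) := by
    rw [hidx]; exact P.card_coprime_index
  have hcompl := Subgroup.isComplement'_of_coprime hcard hco
  refine ⟨φ.ker, ?_, ?_, hcompl.disjoint.eq_bot, hcompl.sup_eq_top⟩
  · rw [hidx]
    exact ((Nat.Prime.coprime_iff_not_dvd hp.out).mpr P.not_dvd_index).symm
  · intro x hx y hy
    exact Subgroup.commute_of_normal_of_disjoint _ _ hPn inferInstance hcompl.disjoint x y hx hy

lemma coprime_of_sylow {G : Type*} [Group G] [Finite G] {p : ℕ} [hp : Fact p.Prime]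
    (P : Sylow p G) (C : Subgroup G) (h : Nat.Coprime (Nat.card C) p) :
    (Nat.card (P : Subgroup G)).Coprime (Nat.card C) := by
  obtain ⟨k, hk⟩ := IsPGroup.iff_card.mp P.isPGroup'
  rw [hk]
  exact (h.pow_right k).symm

end RIP

/-- A non-cyclic finite nilpotent group `G` satisfies the
rank-independence property iff `G ≅ C_p × C_p` for a prime `p`, or `G ≅ Q₈`, or `G` is
the (internal) direct product of an elementary abelian Sylow `p`-subgroup `P` with
`d(P) ≥ 3` and a cyclic subgroup `C` of order coprime to `p`. -/
theorem stmt_19 (G : Type*) [Group G] [Finite G] (hnil : Group.IsNilpotent G)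
    (hnc : ¬ IsCyclic G) :
    RankIndependenceProperty G ↔
      (∃ p : ℕ, p.Prime ∧ Nonempty (G ≃* Multiplicative (ZMod p × ZMod p))) ∨
      Nonempty (G ≃* QuaternionGroup 2) ∨
      (∃ (p : ℕ) (_ : Fact p.Prime) (P : Sylow p G) (C : Subgroup G),
        (∀ x ∈ (P : Subgroup G), ∀ y ∈ (P : Subgroup G), x * y = y * x) ∧
        (∀ x ∈ (P : Subgroup G), x ^ p = 1) ∧
        3 ≤ minGen ↥(P : Subgroup G) ∧
        IsCyclic ↥C ∧ Nat.Coprime (Nat.card ↥C) p ∧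
        (∀ x ∈ (P : Subgroup G), ∀ y ∈ C, x * y = y * x) ∧
        (P : Subgroup G) ⊓ C = ⊥ ∧ (P : Subgroup G) ⊔ C = ⊤) := by
  constructor
  · intro h
    rw [RIP.rip_iff hnc] at h
    obtain ⟨p, hp, P, hP⟩ : ∃ (p : ℕ) (_ : Fact p.Prime) (P : Sylow p G),
        ¬ IsCyclic (P : Subgroup G) := by
      by_contra! hall
      apply hnc
      have : IsZGroup G := ⟨fun p hp P => hall p ⟨hp⟩ P⟩
      infer_instance
    obtain ⟨C, hC, hcomm, hinf, hsup⟩ := RIP.exists_decomp hnil P hP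
    obtain ⟨e⟩ := RIP.prod_equiv (P : Subgroup G) C hcomm hinf hsup
    obtain ⟨hCc, hIP, hmin, hsub⟩ := RIP.forward_prod (RIP.coprime_of_sylow P C hC) hP
      (RIP.IP_of_equiv e.symm h)
    have h2 := RIP.two_le_minGen hP
    have heq : minGen (P : Subgroup G) = 2 → Nonempty (G ≃* (P : Subgroup G)) := by
      intro h2
      have := hsub h2
      have : Unique C := uniqueOfSubsingleton 1
      exact ⟨e.symm.trans MulEquiv.prodUnique⟩
    rcases RIP.pgroup_final P.isPGroup' hP hIP with ⟨hab, hpow⟩ | ⟨hm, ⟨q⟩⟩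
    · rcases h2.lt_or_eq with h3 | h3
      · right; right
        refine ⟨p, hp, P, C, ?_, ?_, h3, hCc, hC, hcomm, hinf, hsup⟩
        · intro x hx y hy
          exact congrArg Subtype.val (hab ⟨x, hx⟩ ⟨y, hy⟩)
        · intro x hx
          exact congrArg Subtype.val (hpow ⟨x, hx⟩)
      · left
        obtain ⟨f⟩ := heq h3.symm
        obtain ⟨g⟩ := (RIP.elem_IP hab hpow).2 hP h3.symm
        exact ⟨p, hp.out, ⟨f.trans g⟩⟩
    · right; left
      obtain ⟨f⟩ := heq hm
      exact ⟨f.trans q⟩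
  · intro h
    rw [RIP.rip_iff hnc]
    rcases h with ⟨p, hp, ⟨e⟩⟩ | ⟨⟨e⟩⟩ | ⟨p, hp, P, C, hab, hpow, h3, hCc, hC, hcomm, hinf, hsup⟩
    · apply RIP.IP_prime_sq hnc hp
      rw [Nat.card_congr e.toEquiv, Nat.card_congr Multiplicative.toAdd, Nat.card_prod,
        Nat.card_zmod, sq]
    · refine RIP.IP_of_equiv e.symm (RIP.IP_q8 ?_)
      rwa [← e.isCyclic]
    · obtain ⟨e⟩ := RIP.prod_equiv (P : Subgroup G) C hcomm hinf hsup
      refine RIP.IP_of_equiv e (RIP.back_prod (RIP.coprime_of_sylow P C hC) ?_ h3)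
      exact (RIP.elem_IP (p := p) (fun x y => Subtype.ext (hab x x.2 y y.2))
        (fun x => Subtype.ext (hpow x x.2))).1
end
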